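/- Let G be an affine reductive algebraic group over an algebraically closed field k of characteristic zero, X an affine G-variety, and x ∈ X. Then x is stable if and only if x is 1PS stable. -/

import Mathlib

open scoped MatrixGroups

namespace PaperGIT

variable {k : Type} [Field k]

/-- The zero locus in affine space `k^σ` of a set of polynomials. -/
def zeroLocus {σ : Type} (I : Set (MvPolynomial σ k)) : Set (σ → k) :=
  {x | ∀ f ∈ I, MvPolynomial.eval x f = 0}

/-- A subset of affine space is Zariski closed if it is the zero locus of a set
of polynomials. -/
def IsZClosed {σ : Type} (S : Set (σ → k)) : Prop :=
  ∃ I : Set (MvPolynomial σ k), S = zeroLocus I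

/-- The Zariski closure of a subset of affine space. -/
def zClosure {σ : Type} (S : Set (σ → k)) : Set (σ → k) :=
  ⋂₀ {C | IsZClosed C ∧ S ⊆ C}

/-- A matrix viewed as a point of affine space. -/
def mat2pt {n : ℕ} (A : Matrix (Fin n) (Fin n) k) : Fin n × Fin n → k :=
  fun p => A p.1 p.2

/-- An affine algebraic group over `k`, realized (as is always possible) as a
Zariski closed subgroup of some `GL n k`. -/
structure AlgGroup (k : Type) [Field k] where
  n : ℕ
  toSubgroup : Subgroup (GL (Fin n) k)
  closed : ∃ I : Set (MvPolynomial (Fin n × Fin n) k),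
    ∀ A : GL (Fin n) k, A ∈ toSubgroup ↔
      mat2pt (A : Matrix (Fin n) (Fin n) k) ∈ zeroLocus I

/-- A one-parameter subgroup (cocharacter) of `G`: a group homomorphism
`k^× → G` whose matrix entries are Laurent polynomials in the parameter. -/
structure OnePS (G : AlgGroup k) where
  toFun : kˣ →* GL (Fin G.n) k
  mem : ∀ t : kˣ, toFun t ∈ G.toSubgroup
  regular : ∃ p : Fin G.n × Fin G.n → MvPolynomial Bool k,
    ∀ (t : kˣ) (ij : Fin G.n × Fin G.n),
      (toFun t : Matrix (Fin G.n) (Fin G.n) k) ij.1 ij.2 =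
        MvPolynomial.eval (fun b => if b then (t : k) else ((t⁻¹ : kˣ) : k)) (p ij)

/-- `GLimit lam g h` says that the morphism `t ↦ lam(t) * g * lam(t)⁻¹` of `k^×`
into `G` extends to a morphism `k → G` with value `h` at `t = 0`; i.e. that
`lam⁺g = lim_{t→0} lam(t) g lam(t)⁻¹` exists and equals `h`. -/
def GLimit {G : AlgGroup k} (lam : OnePS G) (g h : GL (Fin G.n) k) : Prop :=
  h ∈ G.toSubgroup ∧
  ∃ q : Fin G.n × Fin G.n → Polynomial k,
    (∀ (t : kˣ) (ij : Fin G.n × Fin G.n),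
      ((lam.toFun t * g * (lam.toFun t)⁻¹ : GL (Fin G.n) k) :
          Matrix (Fin G.n) (Fin G.n) k) ij.1 ij.2 = (q ij).eval (t : k)) ∧
    ∀ ij : Fin G.n × Fin G.n,
      (h : Matrix (Fin G.n) (Fin G.n) k) ij.1 ij.2 = (q ij).eval 0

/-- The R-parabolic subgroup `P(λ) = {g ∈ G : lim_{t→0} λ(t) g λ(t)⁻¹ exists}`. -/
def Pset {G : AlgGroup k} (lam : OnePS G) : Set (GL (Fin G.n) k) :=
  {g | g ∈ G.toSubgroup ∧ ∃ h, GLimit lam g h}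

/-- The R-Levi subgroup `L(λ) = {g ∈ G : lim_{t→0} λ(t) g λ(t)⁻¹ = g}`. -/
def Lset {G : AlgGroup k} (lam : OnePS G) : Set (GL (Fin G.n) k) :=
  {g | g ∈ G.toSubgroup ∧ GLimit lam g g}

/-- `L` is an R-Levi subgroup of the R-parabolic subgroup `P`, i.e. `L = L(μ)`
for some one-parameter subgroup `μ` with `P(μ) = P`. -/
def IsRLeviOf {G : AlgGroup k} (L P : Set (GL (Fin G.n) k)) : Prop :=
  ∃ mu : OnePS G, Pset mu = P ∧ Lset mu = L

/-- `P` is an R-parabolic subgroup of `G`. -/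
def IsRParabolic {G : AlgGroup k} (P : Set (GL (Fin G.n) k)) : Prop :=
  ∃ lam : OnePS G, P = Pset lam

/-- Two one-parameter subgroups are opposite if `P(λ) ∩ P(λ')` is an R-Levi
subgroup of both `P(λ)` and `P(λ')`. -/
def AreOpposite {G : AlgGroup k} (lam lam' : OnePS G) : Prop :=
  IsRLeviOf (Pset lam ∩ Pset lam') (Pset lam) ∧
  IsRLeviOf (Pset lam ∩ Pset lam') (Pset lam')

/-- A subgroup (given as a subset) `H ⊆ G` is completely reducible in `G` if
every R-parabolic subgroup of `G` containing `H` has an R-Levi subgroup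
containing `H`. -/
def CompletelyReducible (G : AlgGroup k) (H : Set (GL (Fin G.n) k)) : Prop :=
  ∀ lam : OnePS G, H ⊆ Pset lam →
    ∃ L : Set (GL (Fin G.n) k), IsRLeviOf L (Pset lam) ∧ H ⊆ L

/-- A subgroup (given as a subset) `H ⊆ G` is irreducible in `G` if it is not
contained in any proper R-parabolic subgroup of `G`. -/
def IrreducibleIn (G : AlgGroup k) (H : Set (GL (Fin G.n) k)) : Prop :=
  ∀ lam : OnePS G, H ⊆ Pset lam → Pset lam = (G.toSubgroup : Set (GL (Fin G.n) k))

/-- The center `Z(G)` of `G`, as a subset. -/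
def centerSet (G : AlgGroup k) : Set (GL (Fin G.n) k) :=
  {g | g ∈ G.toSubgroup ∧ ∀ h ∈ G.toSubgroup, g * h = h * g}

/-- The centralizer `Z_G(H)` of a subset `H` in `G`. -/
def centralizerSet (G : AlgGroup k) (H : Set (GL (Fin G.n) k)) :
    Set (GL (Fin G.n) k) :=
  {g | g ∈ G.toSubgroup ∧ ∀ h ∈ H, g * h = h * g}

/-- A subset of `GL n k` which is Zariski closed in `GL n k` (with the subspace
topology coming from the space of matrices). -/
def ClosedInGL {n : ℕ} (S : Set (GL (Fin n) k)) : Prop :=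
  ∃ I : Set (MvPolynomial (Fin n × Fin n) k),
    S = {A : GL (Fin n) k | mat2pt (A : Matrix (Fin n) (Fin n) k) ∈ zeroLocus I}

/-- Zariski connectedness (preconnectedness) of a subset of `GL n k`. -/
def IsConnSet {n : ℕ} (T : Set (GL (Fin n) k)) : Prop :=
  ∀ V W : Set (GL (Fin n) k), ClosedInGL V → ClosedInGL W →
    T ⊆ V ∪ W → T ∩ V ∩ W = ∅ → T ⊆ V ∨ T ⊆ W

/-- The connected component of the identity of `G`. -/
def idComponent (G : AlgGroup k) : Set (GL (Fin G.n) k) :=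
  ⋃₀ {C | C ⊆ (G.toSubgroup : Set (GL (Fin G.n) k)) ∧
      (1 : GL (Fin G.n) k) ∈ C ∧ IsConnSet C}

/-- A unipotent element of `GL n k`. -/
def IsUnipotentEl {n : ℕ} (A : GL (Fin n) k) : Prop :=
  ((A : Matrix (Fin n) (Fin n) k) - 1) ^ n = 0

/-- `G` is reductive: the unipotent radical of the identity component `G⁰` is
trivial, i.e. every connected normal subgroup of `G⁰` consisting of unipotent
elements is trivial. -/
def IsReductive (G : AlgGroup k) : Prop :=
  ∀ H : Set (GL (Fin G.n) k),
    H ⊆ idComponent G → (1 : GL (Fin G.n) k) ∈ H →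
    (∀ a ∈ H, ∀ b ∈ H, a * b ∈ H) → (∀ a ∈ H, a⁻¹ ∈ H) →
    (∀ g ∈ idComponent G, ∀ h ∈ H, g * h * g⁻¹ ∈ H) →
    IsConnSet H → (∀ h ∈ H, IsUnipotentEl h) →
    H = {1}

/-- A semisimple (diagonalizable) element of `GL n k`. -/
def IsSemisimpleEl {n : ℕ} (A : GL (Fin n) k) : Prop :=
  ∃ P : GL (Fin n) k,
    ((P * A * P⁻¹ : GL (Fin n) k) : Matrix (Fin n) (Fin n) k).IsDiag

/-- A torus in `G`: a Zariski closed connected commutative subgroup all of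
whose elements are semisimple. -/
def IsTorusIn (G : AlgGroup k) (T : Set (GL (Fin G.n) k)) : Prop :=
  T ⊆ (G.toSubgroup : Set (GL (Fin G.n) k)) ∧ (1 : GL (Fin G.n) k) ∈ T ∧
  (∀ a ∈ T, ∀ b ∈ T, a * b ∈ T) ∧ (∀ a ∈ T, a⁻¹ ∈ T) ∧
  ClosedInGL T ∧ IsConnSet T ∧
  (∀ a ∈ T, ∀ b ∈ T, a * b = b * a) ∧
  (∀ a ∈ T, IsSemisimpleEl a)

/-- A maximal torus of `G`. -/
def IsMaximalTorusIn (G : AlgGroup k) (T : Set (GL (Fin G.n) k)) : Prop :=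
  IsTorusIn G T ∧ ∀ T' : Set (GL (Fin G.n) k), IsTorusIn G T' → T ⊆ T' → T' = T

/-- A morphism of affine algebraic groups: a group homomorphism on the points
of `G` whose matrix entries are regular functions on `G`. -/
structure AlgGroupHom (G G' : AlgGroup k) where
  toFun : GL (Fin G.n) k → GL (Fin G'.n) k
  mem : ∀ g ∈ G.toSubgroup, toFun g ∈ G'.toSubgroup
  map_one : toFun 1 = 1
  map_mul : ∀ g ∈ G.toSubgroup, ∀ h ∈ G.toSubgroup, toFun (g * h) = toFun g * toFun h
  regular : ∃ p : Fin G'.n × Fin G'.n → MvPolynomial ((Fin G.n × Fin G.n) ⊕ Unit) k,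
    ∀ g ∈ G.toSubgroup, ∀ ij : Fin G'.n × Fin G'.n,
      (toFun g : Matrix (Fin G'.n) (Fin G'.n) k) ij.1 ij.2 =
        MvPolynomial.eval
          (Sum.elim (mat2pt (g : Matrix (Fin G.n) (Fin G.n) k))
            (fun _ => ((g⁻¹ : GL (Fin G.n) k) : Matrix (Fin G.n) (Fin G.n) k).det))
          (p ij)

/-- Surjectivity of a morphism of algebraic groups (onto the points of `G'`). -/
def AlgGroupHom.Surj {G G' : AlgGroup k} (f : AlgGroupHom G G') : Prop :=
  ∀ g' ∈ G'.toSubgroup, ∃ g ∈ G.toSubgroup, f.toFun g = g'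

/-- An affine `G`-variety: a Zariski closed subset of affine space `k^m`
together with an algebraic (polynomially defined) action of `G`. -/
structure GVariety (G : AlgGroup k) (m : ℕ) where
  carrier : Set (Fin m → k)
  closed : IsZClosed carrier
  act : GL (Fin G.n) k → (Fin m → k) → (Fin m → k)
  act_mem : ∀ g ∈ G.toSubgroup, ∀ x ∈ carrier, act g x ∈ carrier
  act_one : ∀ x ∈ carrier, act 1 x = x
  act_mul : ∀ g ∈ G.toSubgroup, ∀ h ∈ G.toSubgroup, ∀ x ∈ carrier,
    act (g * h) x = act g (act h x)
  regular : ∃ p : Fin m → MvPolynomial ((Fin G.n × Fin G.n) ⊕ (Unit ⊕ Fin m)) k,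
    ∀ g ∈ G.toSubgroup, ∀ x ∈ carrier, ∀ i : Fin m,
      act g x i =
        MvPolynomial.eval
          (Sum.elim (mat2pt (g : Matrix (Fin G.n) (Fin G.n) k))
            (Sum.elim
              (fun _ => ((g⁻¹ : GL (Fin G.n) k) : Matrix (Fin G.n) (Fin G.n) k).det)
              x))
          (p i)

/-- `XLimit X lam x y` : the `lam`-ray through `x`, `t ↦ lam(t)·x`, extends to
a morphism `k → X` with value `y` at `0`; i.e. `lam⁺x` exists and equals `y`. -/
def XLimit {G : AlgGroup k} {m : ℕ} (X : GVariety G m) (lam : OnePS G)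
    (x y : Fin m → k) : Prop :=
  y ∈ X.carrier ∧
  ∃ q : Fin m → Polynomial k,
    (∀ (t : kˣ) (i : Fin m), X.act (lam.toFun t) x i = (q i).eval (t : k)) ∧
    ∀ i : Fin m, y i = (q i).eval 0

/-- `lam ∈ Λ_x` : the limit `lam⁺x` exists. -/
def InLambda {G : AlgGroup k} {m : ℕ} (X : GVariety G m) (x : Fin m → k)
    (lam : OnePS G) : Prop :=
  ∃ y, XLimit X lam x y

/-- `H_x = ∩_{λ ∈ Λ_x} P(λ)`. -/
def Hx {G : AlgGroup k} {m : ℕ} (X : GVariety G m) (x : Fin m → k) :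
    Set (GL (Fin G.n) k) :=
  {g | g ∈ G.toSubgroup ∧ ∀ lam : OnePS G, InLambda X x lam → g ∈ Pset lam}

/-- `Λ_x` is symmetric: every `λ ∈ Λ_x` admits an opposite `λ' ∈ Λ_x`. -/
def SymmetricLambda {G : AlgGroup k} {m : ℕ} (X : GVariety G m)
    (x : Fin m → k) : Prop :=
  ∀ lam : OnePS G, InLambda X x lam →
    ∃ lam' : OnePS G, InLambda X x lam' ∧ AreOpposite lam lam'

/-- The map `η : X → S(G)`, `x ↦ H_x`, is proper: `H_x ⊆ P(λ)` implies `λ ∈ Λ_x`. -/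
def EtaProper {G : AlgGroup k} {m : ℕ} (X : GVariety G m) : Prop :=
  ∀ x ∈ X.carrier, ∀ lam : OnePS G, Hx X x ⊆ Pset lam → InLambda X x lam

/-- The `G`-orbit of `x`. -/
def orbitSet {G : AlgGroup k} {m : ℕ} (X : GVariety G m) (x : Fin m → k) :
    Set (Fin m → k) :=
  {y | ∃ g ∈ G.toSubgroup, y = X.act g x}

/-- `x` is polystable: its `G`-orbit is Zariski closed. -/
def Polystable {G : AlgGroup k} {m : ℕ} (X : GVariety G m) (x : Fin m → k) : Prop :=
  IsZClosed (orbitSet X x)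

/-- The stabilizer `G_x` of `x`, as a subset of `G`. -/
def stabSet {G : AlgGroup k} {m : ℕ} (X : GVariety G m) (x : Fin m → k) :
    Set (GL (Fin G.n) k) :=
  {g | g ∈ G.toSubgroup ∧ X.act g x = x}

/-- The center of the action, `G_X = ∩_{x ∈ X} G_x`. -/
def actionCenter {G : AlgGroup k} {m : ℕ} (X : GVariety G m) :
    Set (GL (Fin G.n) k) :=
  {g | g ∈ G.toSubgroup ∧ ∀ x ∈ X.carrier, X.act g x = x}

/-- `x` is stable: polystable and `G_x/G_X` is finite (finitely many cosets
`g·G_X` with `g ∈ G_x`). -/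
def Stable {G : AlgGroup k} {m : ℕ} (X : GVariety G m) (x : Fin m → k) : Prop :=
  Polystable X x ∧
  Set.Finite ((fun g => (fun h => g * h) '' actionCenter X) '' stabSet X x)

/-- `x` is properly stable: polystable with finite stabilizer. -/
def ProperlyStable {G : AlgGroup k} {m : ℕ} (X : GVariety G m) (x : Fin m → k) : Prop :=
  Polystable X x ∧ (stabSet X x).Finite

/-- `x` is equicentral: polystable and `G_x = G_X`. -/
def Equicentral {G : AlgGroup k} {m : ℕ} (X : GVariety G m) (x : Fin m → k) : Prop :=
  Polystable X x ∧ stabSet X x = actionCenter X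

/-- `x` is 1PS stable: polystable, and for every one-parameter subgroup `λ`
of `G` with `λ(k^×) ⊄ G_X` the limit `λ⁺x` does not exist. -/
def OnePSStable {G : AlgGroup k} {m : ℕ} (X : GVariety G m) (x : Fin m → k) : Prop :=
  Polystable X x ∧
  ∀ lam : OnePS G, ¬ (∀ t : kˣ, lam.toFun t ∈ actionCenter X) → ¬ InLambda X x lam

/-- The weight space of weight `n ∈ ℤ` for the 1PS `lam` acting on `k^m`. -/
def weightSpace {G : AlgGroup k} {m : ℕ} (X : GVariety G m) (lam : OnePS G)
    (n : ℤ) : Set (Fin m → k) :=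
  {w | ∀ t : kˣ, X.act (lam.toFun t) w = (((t ^ n : kˣ) : k)) • w}

/-- `μ(v, lam) = μ0`: decomposing `v` into nonzero weight vectors for `lam`,
the minimal occurring weight equals `μ0`. -/
def MuIs {G : AlgGroup k} {m : ℕ} (X : GVariety G m) (lam : OnePS G)
    (v : Fin m → k) (μ0 : ℤ) : Prop :=
  ∃ (s : Finset ℤ) (c : ℤ → (Fin m → k)),
    (∀ n ∈ s, c n ∈ weightSpace X lam n ∧ c n ≠ 0) ∧
    v = ∑ n ∈ s, c n ∧ μ0 ∈ s ∧ ∀ n ∈ s, μ0 ≤ n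

/-- `GL n k` itself, as an affine algebraic group. -/
def fullGL (k : Type) [Field k] (n : ℕ) : AlgGroup k where
  n := n
  toSubgroup := ⊤
  closed := ⟨∅, by intro A; simp [zeroLocus]⟩

/-- A subset `X ⊆ G^N` which is Zariski closed in `G^N`. -/
def GNClosed (G : AlgGroup k) (N : ℕ)
    (S : Set (Fin N → GL (Fin G.n) k)) : Prop :=
  ∃ I : Set (MvPolynomial (Fin N × (Fin G.n × Fin G.n)) k),
    S = {x | (∀ i, x i ∈ G.toSubgroup) ∧
          ∀ f ∈ I, MvPolynomial.eval
            (fun p => ((x p.1 : Matrix (Fin G.n) (Fin G.n) k) p.2.1 p.2.2)) f = 0}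

/-- Limits of the `lam`-ray through `x ∈ X ⊆ G^N`, for the simultaneous
conjugation action. -/
def GNLimit {G : AlgGroup k} {N : ℕ} (X : Set (Fin N → GL (Fin G.n) k))
    (lam : OnePS G) (x y : Fin N → GL (Fin G.n) k) : Prop :=
  y ∈ X ∧
  ∃ q : Fin N → Fin G.n × Fin G.n → Polynomial k,
    (∀ (t : kˣ) (i : Fin N) (ij : Fin G.n × Fin G.n),
      ((lam.toFun t * x i * (lam.toFun t)⁻¹ : GL (Fin G.n) k) :
          Matrix (Fin G.n) (Fin G.n) k) ij.1 ij.2 = (q i ij).eval (t : k)) ∧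
    ∀ (i : Fin N) (ij : Fin G.n × Fin G.n),
      (y i : Matrix (Fin G.n) (Fin G.n) k) ij.1 ij.2 = (q i ij).eval 0

/-- `lam ∈ Λ_x` for `x ∈ X ⊆ G^N`. -/
def GNInLambda {G : AlgGroup k} {N : ℕ} (X : Set (Fin N → GL (Fin G.n) k))
    (x : Fin N → GL (Fin G.n) k) (lam : OnePS G) : Prop :=
  ∃ y, GNLimit X lam x y

/-- `H_x` for `x ∈ X ⊆ G^N`. -/
def GNHx {G : AlgGroup k} {N : ℕ} (X : Set (Fin N → GL (Fin G.n) k))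
    (x : Fin N → GL (Fin G.n) k) : Set (GL (Fin G.n) k) :=
  {g | g ∈ G.toSubgroup ∧ ∀ lam : OnePS G, GNInLambda X x lam → g ∈ Pset lam}

/-- `φ_x`: the subgroup of `G` generated by the components of `x ∈ G^N`. -/
def phiSet {G : AlgGroup k} {N : ℕ} (x : Fin N → GL (Fin G.n) k) :
    Set (GL (Fin G.n) k) :=
  (Subgroup.closure (Set.range x) : Subgroup (GL (Fin G.n) k))

/-- The orbit of `x ∈ G^N` under simultaneous conjugation. -/
def GNOrbit {G : AlgGroup k} {N : ℕ} (x : Fin N → GL (Fin G.n) k) :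
    Set (Fin N → GL (Fin G.n) k) :=
  {y | ∃ g ∈ G.toSubgroup, y = fun i => g * x i * g⁻¹}

/-- Polystability of `x ∈ X ⊆ G^N`: the conjugation orbit is Zariski closed. -/
def GNPolystable (G : AlgGroup k) {N : ℕ} (x : Fin N → GL (Fin G.n) k) : Prop :=
  GNClosed G N (GNOrbit x)

/-- The stabilizer of `x ∈ G^N` under simultaneous conjugation. -/
def GNStab (G : AlgGroup k) {N : ℕ} (x : Fin N → GL (Fin G.n) k) :
    Set (GL (Fin G.n) k) :=
  {g | g ∈ G.toSubgroup ∧ ∀ i, g * x i * g⁻¹ = x i}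

/-- `G_X` for `X ⊆ G^N` with the simultaneous conjugation action. -/
def GNActionCenter (G : AlgGroup k) {N : ℕ}
    (X : Set (Fin N → GL (Fin G.n) k)) : Set (GL (Fin G.n) k) :=
  {g | g ∈ G.toSubgroup ∧ ∀ x ∈ X, ∀ i, g * x i * g⁻¹ = x i}

/-- `x ∈ X ⊆ G^N` is stable: polystable and `G_x/G_X` finite. -/
def GNStable (G : AlgGroup k) {N : ℕ} (X : Set (Fin N → GL (Fin G.n) k))
    (x : Fin N → GL (Fin G.n) k) : Prop :=
  GNPolystable G x ∧
  Set.Finite ((fun g => (fun h => g * h) '' GNActionCenter G X) '' GNStab G x)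

/-- `x ∈ X ⊆ G^N` is equicentral: polystable and `G_x = G_X`. -/
def GNEquicentral (G : AlgGroup k) {N : ℕ} (X : Set (Fin N → GL (Fin G.n) k))
    (x : Fin N → GL (Fin G.n) k) : Prop :=
  GNPolystable G x ∧ GNStab G x = GNActionCenter G X

/-- A subgroup `H ⊆ G` is isotropic: completely reducible with `Z_G(H) = Z(G)`. -/
def IsIsotropic (G : AlgGroup k) (H : Set (GL (Fin G.n) k)) : Prop :=
  CompletelyReducible G H ∧ centralizerSet G H = centerSet G

set_option linter.all false


noncomputable section basics

/-- Coordinates on `GL n`: matrix entries and the inverse determinant. -/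
abbrev Vr (n : ℕ) : Type := (Fin n × Fin n) ⊕ Unit

/-- Polynomial ring surjecting onto the coordinate ring of `GL n`. -/
abbrev QQ (k : Type) [Field k] (n : ℕ) : Type := MvPolynomial (Vr n) k

variable {n : ℕ}

def pt (g : GL (Fin n) k) : Vr n → k :=
  Sum.elim (mat2pt (g : Matrix (Fin n) (Fin n) k))
    (fun _ => ((g⁻¹ : GL (Fin n) k) : Matrix (Fin n) (Fin n) k).det)

/-- generic matrix -/
def XM (k : Type) [Field k] (n : ℕ) : Matrix (Fin n) (Fin n) (QQ k n) :=
  Matrix.of fun i j => MvPolynomial.X (Sum.inl (i, j))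

/-- constant matrices -/
def cM (a : Matrix (Fin n) (Fin n) k) : Matrix (Fin n) (Fin n) (QQ k n) :=
  a.map MvPolynomial.C

def DD (a : Matrix (Fin n) (Fin n) k) : Derivation k (QQ k n) (QQ k n) :=
  MvPolynomial.mkDerivation k (Sum.elim (fun p => (XM k n * cM a) p.1 p.2)
    (fun _ => MvPolynomial.C (-(a.trace)) * MvPolynomial.X (Sum.inr ())))

def RR (g : GL (Fin n) k) : QQ k n →ₐ[k] QQ k n :=
  MvPolynomial.aeval (Sum.elim (fun p => (XM k n * cM g.1) p.1 p.2)
    (fun _ => MvPolynomial.C (((g⁻¹ : GL (Fin n) k) : Matrix (Fin n) (Fin n) k).det) *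
      MvPolynomial.X (Sum.inr ())))

def LL (g : GL (Fin n) k) : QQ k n →ₐ[k] QQ k n :=
  MvPolynomial.aeval (Sum.elim (fun p => (cM g.1 * XM k n) p.1 p.2)
    (fun _ => MvPolynomial.C (((g⁻¹ : GL (Fin n) k) : Matrix (Fin n) (Fin n) k).det) *
      MvPolynomial.X (Sum.inr ())))

theorem cM_mul (a b : Matrix (Fin n) (Fin n) k) : cM (a * b) = cM a * cM b := by
  simp [cM, Matrix.map_mul]

theorem DD_XM (a c : Matrix (Fin n) (Fin n) k) (i j : Fin n) :
    DD a ((XM k n * cM c) i j) = (XM k n * cM (a * c)) i j := by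
  rw [cM_mul, ← Matrix.mul_assoc]
  simp only [Matrix.mul_apply (M := XM k n * cM a)]
  rw [Matrix.mul_apply, map_sum]
  refine Finset.sum_congr rfl fun l _ => ?_
  rw [Derivation.leibniz]
  have h1 : DD a (cM c l j) = 0 := by
    simp [cM, DD]
  have h2 : DD a (XM k n i l) = (XM k n * cM a) i l := by
    simp [DD, XM, MvPolynomial.mkDerivation_X]
  rw [h1, h2]; simp [mul_comm]

theorem DD_X (a : Matrix (Fin n) (Fin n) k) (p : Fin n × Fin n) :
    DD a (MvPolynomial.X (Sum.inl p)) = (XM k n * cM a) p.1 p.2 := by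
  simp [DD, MvPolynomial.mkDerivation_X]

theorem DD_Xr (a : Matrix (Fin n) (Fin n) k) (u : Unit) :
    DD a (MvPolynomial.X (Sum.inr u)) =
      MvPolynomial.C (-(a.trace)) * MvPolynomial.X (Sum.inr ()) := by
  simp [DD, MvPolynomial.mkDerivation_X]

theorem DD_add (a b : Matrix (Fin n) (Fin n) k) : DD (a + b) = DD a + DD b := by
  apply MvPolynomial.derivation_ext
  rintro (p | u)
  · simp only [Derivation.add_apply, DD_X]
    rw [← Matrix.add_apply, ← mul_add]
    have : cM (a + b) = cM a + cM b := by
      apply Matrix.ext; intro i j; simp [cM]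
    rw [this]
  · simp only [Derivation.add_apply, DD_Xr, Matrix.trace_add]
    rw [← add_mul, ← map_add]; congr 2; ring

theorem DD_smul (c : k) (a : Matrix (Fin n) (Fin n) k) : DD (c • a) = c • DD a := by
  apply MvPolynomial.derivation_ext
  rintro (p | u)
  · simp only [Derivation.smul_apply, DD_X]
    rw [← Matrix.smul_apply, ← Matrix.mul_smul]
    have : cM (c • a) = c • cM a := by
      apply Matrix.ext; intro i j; simp [cM, MvPolynomial.smul_eq_C_mul]
    rw [this]
  · simp only [Derivation.smul_apply, DD_Xr, Matrix.trace_smul, MvPolynomial.smul_eq_C_mul]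
    rw [← mul_assoc, ← map_mul]; congr 2; simp

/-- `DD` as a linear map. -/
def DDl (k : Type) [Field k] (n : ℕ) :
    Matrix (Fin n) (Fin n) k →ₗ[k] Derivation k (QQ k n) (QQ k n) where
  toFun := DD
  map_add' := DD_add
  map_smul' := DD_smul

theorem DD_lie (a b : Matrix (Fin n) (Fin n) k) : DD (a * b - b * a) = ⁅DD a, DD b⁆ := by
  apply MvPolynomial.derivation_ext
  rintro (p | u)
  · rw [Derivation.commutator_apply, DD_X, DD_X, DD_X, DD_XM, DD_XM]
    rw [← Matrix.sub_apply, ← mul_sub]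
    have : cM (a * b - b * a) = cM (a * b) - cM (b * a) := by
      apply Matrix.ext; intro i j; simp [cM, -Matrix.map_mul]
    rw [this]
  · rw [Derivation.commutator_apply, DD_Xr, DD_Xr, DD_Xr, Derivation.leibniz, Derivation.leibniz]
    simp only [DD_Xr, Matrix.trace_sub, Matrix.trace_mul_comm a b]
    simp [MvPolynomial.algebraMap_eq, DD]
    ring

theorem DD_LL (a : Matrix (Fin n) (Fin n) k) (g : GL (Fin n) k) (f : QQ k n) :
    DD a (LL g f) = LL g (DD a f) := by
  induction f using MvPolynomial.induction_on with
  | C c => simp [LL, DD, MvPolynomial.algebraMap_eq]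
  | add p q hp hq => simp only [map_add, hp, hq]
  | mul_X p v hp =>
    have : DD a (LL g (MvPolynomial.X v)) = LL g (DD a (MvPolynomial.X v)) := by
      rcases v with p | u
      · have e : LL g (MvPolynomial.X (Sum.inl p)) = (cM g.1 * XM k n) p.1 p.2 := by
          simp [LL]
        rw [e, DD_X, Matrix.mul_apply, map_sum, Matrix.mul_apply, map_sum]
        have e2 : ∀ l, LL g (XM k n p.1 l) = (cM g.1 * XM k n) p.1 l := by
          intro l; simp [LL, XM]
        have e3 : ∀ l, LL g (cM a l p.2) = cM a l p.2 := by
          intro l; simp [LL, cM, MvPolynomial.algebraMap_eq]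
        have e4 : ∀ l, DD a (cM g.1 p.1 l) = 0 := by intro l; simp [cM, DD]
        have e5 : ∀ l, DD a (XM k n l p.2) = (XM k n * cM a) l p.2 := by
          intro l; simp [XM, DD_X]
        simp only [map_mul, e2, e3, Derivation.leibniz, e4, e5, smul_eq_mul, mul_zero, add_zero]
        simp only [← Matrix.mul_apply, Matrix.mul_assoc]
      · simp [LL, DD_Xr, Derivation.leibniz, MvPolynomial.algebraMap_eq]
        try simp [DD]
        try ring
    simp only [map_mul, Derivation.leibniz, hp, this, map_add, smul_eq_mul]

theorem eval_LL (g h : GL (Fin n) k) (f : QQ k n) :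
    MvPolynomial.eval (pt h) (LL g f) = MvPolynomial.eval (pt (g * h)) f := by
  induction f using MvPolynomial.induction_on with
  | C c => simp [LL, MvPolynomial.algebraMap_eq]
  | add p q hp hq => simp only [map_add, hp, hq]
  | mul_X p v hp =>
    rw [map_mul, map_mul, hp, map_mul]
    congr 1
    rcases v with p | u
    · simp [LL, pt, mat2pt, Matrix.mul_apply, cM, XM]
    · simp [LL, pt, mul_comm]

theorem eval_RR (g h : GL (Fin n) k) (f : QQ k n) :
    MvPolynomial.eval (pt h) (RR g f) = MvPolynomial.eval (pt (h * g)) f := by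
  induction f using MvPolynomial.induction_on with
  | C c => simp [RR, MvPolynomial.algebraMap_eq]
  | add p q hp hq => simp only [map_add, hp, hq]
  | mul_X p v hp =>
    rw [map_mul, map_mul, hp, map_mul]
    congr 1
    rcases v with p | u
    · simp [RR, pt, mat2pt, Matrix.mul_apply, cM, XM]
    · simp [RR, pt, mul_comm]

/-- vanishing ideal of a subgroup -/
def II (K : Subgroup (GL (Fin n) k)) : Ideal (QQ k n) where
  carrier := {f | ∀ g ∈ K, MvPolynomial.eval (pt g) f = 0}
  zero_mem' := by intro g _; simp
  add_mem' := by intro a b ha hb g hg; simp [ha g hg, hb g hg]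
  smul_mem' := by intro c a ha g hg; simp [ha g hg]

theorem mem_II {K : Subgroup (GL (Fin n) k)} {f : QQ k n} :
    f ∈ II K ↔ ∀ g ∈ K, MvPolynomial.eval (pt g) f = 0 := Iff.rfl

def ClosedK (K : Subgroup (GL (Fin n) k)) : Prop :=
  ∀ g : GL (Fin n) k, (∀ f ∈ II K, MvPolynomial.eval (pt g) f = 0) → g ∈ K

theorem II_mono {K K' : Subgroup (GL (Fin n) k)} (h : K ≤ K') : II K' ≤ II K :=
  fun _ hf g hg => hf g (h hg)

/-- Lie algebra of a subgroup -/
def LieK (K : Subgroup (GL (Fin n) k)) : Submodule k (Matrix (Fin n) (Fin n) k) where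
  carrier := {a | ∀ f ∈ II K, MvPolynomial.eval (pt (1 : GL (Fin n) k)) (DD a f) = 0}
  zero_mem' := by
    intro f _
    have : DD (0 : Matrix (Fin n) (Fin n) k) = 0 := (DDl k n).map_zero
    simp [this]
  add_mem' := by intro a b ha hb f hf; simp [DD_add, ha f hf, hb f hf]
  smul_mem' := by intro c a ha f hf; simp [DD_smul, ha f hf, MvPolynomial.smul_eval]

theorem LieK_mono {K K' : Subgroup (GL (Fin n) k)} (h : K ≤ K') : LieK K ≤ LieK K' :=
  fun _ ha f hf => ha f (II_mono h hf)

theorem LL_mem_II {K : Subgroup (GL (Fin n) k)} {f : QQ k n} (hf : f ∈ II K)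
    {g : GL (Fin n) k} (hg : g ∈ K) : LL g f ∈ II K := by
  intro h hh; rw [eval_LL]; exact hf _ (K.mul_mem hg hh)

theorem RR_mem_II {K : Subgroup (GL (Fin n) k)} {f : QQ k n} (hf : f ∈ II K)
    {g : GL (Fin n) k} (hg : g ∈ K) : RR g f ∈ II K := by
  intro h hh; rw [eval_RR]; exact hf _ (K.mul_mem hh hg)

theorem DD_mem_II {K : Subgroup (GL (Fin n) k)} {a : Matrix (Fin n) (Fin n) k}
    (ha : a ∈ LieK K) {f : QQ k n} (hf : f ∈ II K) : DD a f ∈ II K := by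
  intro g hg
  have := ha _ (LL_mem_II hf hg)
  rwa [DD_LL, eval_LL, mul_one] at this

theorem mem_LieK_of_DD {K : Subgroup (GL (Fin n) k)} {a : Matrix (Fin n) (Fin n) k}
    (h : ∀ f ∈ II K, DD a f ∈ II K) : a ∈ LieK K :=
  fun f hf => h f hf 1 K.one_mem

theorem mem_of_RR {K : Subgroup (GL (Fin n) k)} (hK : ClosedK K) {g : GL (Fin n) k}
    (h : ∀ f ∈ II K, RR g f ∈ II K) : g ∈ K := by
  apply hK
  intro f hf
  have := h f hf 1 K.one_mem
  rwa [eval_RR, one_mul] at this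

theorem LieK_lie {K : Subgroup (GL (Fin n) k)} {a b : Matrix (Fin n) (Fin n) k}
    (ha : a ∈ LieK K) (hb : b ∈ LieK K) : a * b - b * a ∈ LieK K := by
  apply mem_LieK_of_DD
  intro f hf
  rw [DD_lie, Derivation.commutator_apply]
  exact sub_mem (DD_mem_II ha (DD_mem_II hb hf)) (DD_mem_II hb (DD_mem_II ha hf))

end basics

noncomputable section exps
variable {n : ℕ} [CharZero k]

/-- exponential of a nilpotent matrix as a unit (junk value `1` otherwise) -/
def exG (a : Matrix (Fin n) (Fin n) k) (ha : IsNilpotent a) : GL (Fin n) k where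
  val := IsNilpotent.exp a
  inv := IsNilpotent.exp (-a)
  val_inv := IsNilpotent.exp_mul_exp_neg_self ha
  inv_val := IsNilpotent.exp_neg_mul_exp_self ha

theorem exG_neg (a : Matrix (Fin n) (Fin n) k) (ha : IsNilpotent a) :
    (exG a ha)⁻¹ = exG (-a) ha.neg := by
  apply Units.ext; rfl

theorem exG_congr {a b : Matrix (Fin n) (Fin n) k} (h : a = b) (ha : IsNilpotent a)
    (hb : IsNilpotent b) : exG a ha = exG b hb := by subst h; rfl

theorem exG_zero (h : IsNilpotent (0 : Matrix (Fin n) (Fin n) k)) : exG 0 h = 1 := by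
  apply Units.ext; exact IsNilpotent.exp_zero

theorem det_one_add_nil (a : Matrix (Fin n) (Fin n) k) (ha : IsNilpotent a) :
    (1 + a).det = 1 := by
  have h := (Matrix.isNilpotent_charpoly_sub_pow_of_isNilpotent ha.neg).eq_zero
  have h2 := Matrix.eval_charpoly (-a) 1
  rw [sub_eq_zero] at h
  rw [h] at h2
  simpa using h2.symm

theorem det_exp (a : Matrix (Fin n) (Fin n) k) (ha : IsNilpotent a) :
    (IsNilpotent.exp a).det = 1 := by
  have := det_one_add_nil _ (IsNilpotent.isNilpotent_exp_sub_one ha)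
  simpa using this

theorem trace_nil (a : Matrix (Fin n) (Fin n) k) (ha : IsNilpotent a) : a.trace = 0 :=
  (Matrix.isNilpotent_trace_of_isNilpotent ha).eq_zero

theorem exp_eq_one (a : Matrix (Fin n) (Fin n) k) (ha : IsNilpotent a)
    (h : IsNilpotent.exp a = 1) : a = 0 := by
  obtain ⟨N, hN⟩ := ha
  have hN2 : a ^ (N + 2) = 0 := by rw [pow_add, hN, zero_mul]
  rw [IsNilpotent.exp_eq_sum hN2, Finset.sum_range_succ', Finset.sum_range_succ'] at h
  set c : Matrix (Fin n) (Fin n) k := ∑ i ∈ Finset.range N, ((i + 1 + 1).factorial : ℚ)⁻¹ • a ^ i with hc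
  have e : ∑ i ∈ Finset.range N, ((i + 1 + 1).factorial : ℚ)⁻¹ • a ^ (i + 1 + 1) = a * (a * c) := by
    rw [hc, Finset.mul_sum, Finset.mul_sum]
    refine Finset.sum_congr rfl fun i _ => ?_
    rw [mul_smul_comm, mul_smul_comm, pow_succ', pow_succ']
  rw [e] at h
  have h2 : a * (1 + a * c) = 0 := by
    simp only [zero_add, Nat.factorial, pow_zero, pow_one] at h
    simp at h
    rw [mul_add, mul_one, add_comm]; exact h
  have hcomm : Commute a c := by
    rw [hc]
    exact Commute.sum_right _ _ _ fun i _ => ((Commute.refl a).pow_right i).smul_right _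
  have hu : IsUnit (1 + a * c) :=
    IsNilpotent.isUnit_one_add (hcomm.isNilpotent_mul_right ⟨N, hN⟩)
  exact (hu.mul_left_eq_zero).1 h2

open Polynomial in
/-- matrix of polynomials representing `exp(T a)` -/
def pE (a : Matrix (Fin n) (Fin n) k) (N : ℕ) : Matrix (Fin n) (Fin n) k[X] :=
  Matrix.of fun i j => ∑ r ∈ Finset.range N, C ((r.factorial : k)⁻¹ * (a ^ r) i j) * X ^ r

open Polynomial in
theorem pE_eval (a : Matrix (Fin n) (Fin n) k) (N : ℕ) (hN : a ^ N = 0) (t : k) (i j : Fin n) :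
    (pE a N i j).eval t = IsNilpotent.exp (t • a) i j := by
  have : (t • a) ^ N = 0 := by rw [_root_.smul_pow, hN, smul_zero]
  rw [IsNilpotent.exp_eq_sum this, Matrix.sum_apply]
  simp only [pE, Matrix.of_apply, eval_finset_sum, eval_mul, eval_C, eval_pow, eval_X]
  refine Finset.sum_congr rfl fun r _ => ?_
  rw [Matrix.smul_apply, _root_.smul_pow, Matrix.smul_apply, smul_eq_mul, Algebra.smul_def]
  simp
  ring

open Polynomial in
theorem pE_deriv (a : Matrix (Fin n) (Fin n) k) (N : ℕ) (hN : a ^ N = 0) (i j : Fin n) :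
    derivative (pE a N i j) = (pE a N * a.map C) i j := by
  have hR : (pE a N * a.map C) i j =
      ∑ r ∈ Finset.range N, C ((r.factorial : k)⁻¹ * (a ^ (r + 1)) i j) * X ^ r := by
    rw [Matrix.mul_apply]
    simp only [pE, Matrix.of_apply, Matrix.map_apply, Finset.sum_mul]
    rw [Finset.sum_comm]
    refine Finset.sum_congr rfl fun r _ => ?_
    rw [pow_succ a r, Matrix.mul_apply, Finset.mul_sum, map_sum, Finset.sum_mul]
    refine Finset.sum_congr rfl fun l _ => ?_
    simp only [map_mul]; ring
  rw [hR]
  simp only [pE, Matrix.of_apply, derivative_sum]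
  rcases N with _ | N
  · simp
  · rw [Finset.sum_range_succ', Finset.sum_range_succ]
    simp only [hN]
    simp only [Matrix.zero_apply, mul_zero, map_zero, zero_mul, add_zero, pow_zero, mul_one, derivative_C]
    refine Finset.sum_congr rfl fun r _ => ?_
    rw [derivative_C_mul, derivative_X_pow, Nat.factorial_succ]
    rw [← mul_assoc, ← map_mul]
    congr 2
    have : ((r : k) + 1) ≠ 0 := by exact_mod_cast Nat.succ_ne_zero r
    push_cast
    field_simp

open Polynomial in
/-- restriction of regular functions to the curve `g exp(T a)` -/
def Phi (a : Matrix (Fin n) (Fin n) k) (N : ℕ) (g : GL (Fin n) k) : QQ k n →ₐ[k] k[X] :=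
  MvPolynomial.aeval (Sum.elim (fun p => (g.1.map C * pE a N) p.1 p.2)
    (fun _ => C (((g⁻¹ : GL (Fin n) k) : Matrix (Fin n) (Fin n) k).det)))

open Polynomial in
theorem Phi_eval (a : Matrix (Fin n) (Fin n) k) (ha : IsNilpotent a) (N : ℕ) (hN : a ^ N = 0)
    (g : GL (Fin n) k) (t : k) (f : QQ k n) :
    (Phi a N g f).eval t = MvPolynomial.eval (pt (g * exG (t • a) (ha.smul t))) f := by
  induction f using MvPolynomial.induction_on with
  | C c => simp [Phi]
  | add p q hp hq => simp only [map_add, eval_add, hp, hq]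
  | mul_X p v hp =>
    rw [map_mul, eval_mul, hp, map_mul]
    congr 1
    rcases v with p | u
    · simp only [Phi, MvPolynomial.aeval_X, Sum.elim_inl, MvPolynomial.eval_X, pt, mat2pt,
        Matrix.mul_apply, eval_finset_sum, eval_mul, pE_eval a N hN, Matrix.map_apply, eval_C]
      rw [Units.val_mul, Matrix.mul_apply]; rfl
    · simp only [Phi, MvPolynomial.aeval_X, Sum.elim_inr, MvPolynomial.eval_X, pt, eval_C]
      rw [mul_inv_rev, exG_neg, Units.val_mul, Matrix.det_mul]
      simp only [exG]
      rw [det_exp _ (ha.smul t).neg, one_mul]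

open Polynomial in
theorem Phi_deriv (a : Matrix (Fin n) (Fin n) k) (ha : IsNilpotent a) (N : ℕ) (hN : a ^ N = 0)
    (g : GL (Fin n) k) (f : QQ k n) :
    derivative (Phi a N g f) = Phi a N g (DD a f) := by
  induction f using MvPolynomial.induction_on with
  | C c => simp [Phi, DD]
  | add p q hp hq => simp only [map_add, hp, hq]
  | mul_X p v hp =>
    have : derivative (Phi a N g (MvPolynomial.X v)) = Phi a N g (DD a (MvPolynomial.X v)) := by
      rcases v with p | u
      · rw [DD_X]
        have e : Phi a N g (MvPolynomial.X (Sum.inl p)) = (g.1.map C * pE a N) p.1 p.2 := by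
          simp [Phi]
        have e2 : Phi a N g ((XM k n * cM a) p.1 p.2) = (g.1.map C * (pE a N * a.map C)) p.1 p.2 := by
          rw [← Matrix.mul_assoc, Matrix.mul_apply, map_sum, Matrix.mul_apply]
          refine Finset.sum_congr rfl fun l _ => ?_
          simp [Phi, XM, cM]
        rw [e, e2, Matrix.mul_apply, derivative_sum, Matrix.mul_apply]
        refine Finset.sum_congr rfl fun l _ => ?_
        simp only [Matrix.map_apply]
        rw [derivative_C_mul, pE_deriv a N hN]
      · rw [DD_Xr, trace_nil a ha]
        simp [Phi]
    simp only [map_mul, Derivation.leibniz, map_add, smul_eq_mul, derivative_mul, hp, this]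
    ring

open Polynomial in
theorem exG_mem {K : Subgroup (GL (Fin n) k)} (hK : ClosedK K) {a : Matrix (Fin n) (Fin n) k}
    (ha : IsNilpotent a) (haK : a ∈ LieK K) : exG a ha ∈ K := by
  apply hK
  intro f hf
  obtain ⟨N, hN⟩ := id ha
  have key : ∀ j : ℕ, ∀ f ∈ II K, derivative^[j] (Phi a N 1 f) = Phi a N 1 ((DD a)^[j] f) := by
    intro j
    induction j with
    | zero => intro f _; rfl
    | succ j ih =>
      intro f hf
      rw [Function.iterate_succ_apply, Function.iterate_succ_apply, Phi_deriv a ha N hN,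
        ih _ (DD_mem_II haK hf)]
  have hmem : ∀ j : ℕ, (DD a)^[j] f ∈ II K := by
    intro j
    induction j with
    | zero => exact hf
    | succ j ih => rw [Function.iterate_succ_apply']; exact DD_mem_II haK ih
  have h0 : Phi a N 1 f = 0 := by
    ext j
    have h1 := congrArg (fun p => p.eval 0) (key j f hf)
    beta_reduce at h1
    rw [Phi_eval a ha N hN] at h1
    have e : exG ((0:k) • a) (ha.smul 0) = 1 := by
      rw [exG_congr (zero_smul k a) _ IsNilpotent.zero, exG_zero]
    rw [e, one_mul, hmem j 1 K.one_mem, ← coeff_zero_eq_eval_zero, coeff_iterate_derivative] at h1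
    simp only [zero_add, Nat.descFactorial_self, nsmul_eq_mul, mul_eq_zero] at h1
    rcases h1 with h1 | h1
    · exact absurd h1 (by exact_mod_cast Nat.factorial_ne_zero j)
    · simpa using h1
  have := Phi_eval a ha N hN 1 1 f
  rw [h0, one_mul, exG_congr (one_smul k a) _ ha] at this
  simpa using this.symm

open Polynomial in
theorem mem_LieK_of_exG {K : Subgroup (GL (Fin n) k)} {a : Matrix (Fin n) (Fin n) k}
    (ha : IsNilpotent a) (h : ∀ t : k, exG (t • a) (ha.smul t) ∈ K) : a ∈ LieK K := by
  intro f hf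
  obtain ⟨N, hN⟩ := id ha
  have h0 : Phi a N 1 f = 0 := by
    apply Polynomial.funext
    intro t
    rw [Phi_eval a ha N hN, one_mul, hf _ (h t)]; simp
  have h1 := Phi_deriv a ha N hN 1 f
  have h2 := Phi_eval a ha N hN 1 0 (DD a f)
  rw [← h1, h0] at h2
  have e : exG ((0:k) • a) (ha.smul 0) = 1 := by
    rw [exG_congr (zero_smul k a) _ IsNilpotent.zero, exG_zero]
  rw [e, one_mul] at h2
  simpa using h2.symm

end exps

noncomputable section spec

theorem spec_comp {M : Type*} [AddCommGroup M] [Module k M] (T : Module.End k M)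
    (I : Submodule k M) (hT : I ≤ I.comap T) (s : Finset k) (F : k → M)
    (hF : ∀ w ∈ s, F w ∈ T.maxGenEigenspace w) (hs : ∑ w ∈ s, F w ∈ I) :
    ∀ w ∈ s, F w ∈ I := by
  classical
  set T' : Module.End k (M ⧸ I) := I.mapQ I T hT with hT'
  have hpow : ∀ (w : k) (r : ℕ) (f : M), ((T' - algebraMap k _ w) ^ r) (I.mkQ f)
      = I.mkQ (((T - algebraMap k _ w) ^ r) f) := by
    intro w r
    induction r with
    | zero => intro f; rfl
    | succ r ih =>
      intro f
      rw [pow_succ, pow_succ, Module.End.mul_apply, Module.End.mul_apply, ← ih]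
      congr 1
  have hF' : ∀ w ∈ s, I.mkQ (F w) ∈ T'.maxGenEigenspace w := by
    intro w hw
    obtain ⟨r, hr⟩ := Module.End.mem_maxGenEigenspace _ _ _ |>.1 (hF w hw)
    refine (Module.End.mem_maxGenEigenspace _ _ _).2 ⟨r, ?_⟩
    have := hpow w r (F w)
    have e : ∀ (X : Module.End k M), (X - w • 1 : Module.End k M) = X - algebraMap k _ w := by
      intro X; rw [Algebra.algebraMap_eq_smul_one]
    rw [Algebra.algebraMap_eq_smul_one, Algebra.algebraMap_eq_smul_one] at this
    rw [this, hr, map_zero]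
  have hind := Module.End.independent_maxGenEigenspace T'
  have h0 : ∑ w ∈ s, I.mkQ (F w) = 0 := by
    rw [← map_sum]; exact (Submodule.Quotient.mk_eq_zero I).2 hs
  intro w hw
  exact (Submodule.Quotient.mk_eq_zero I).1
    ((iSupIndep_iff_finsetSum_eq_zero_imp_eq_zero _).1 hind s (fun w => I.mkQ (F w)) hF' h0 w hw)

/-- decomposition of an element of the span of vectors with a label -/
theorem span_decomp {M : Type*} [AddCommGroup M] [Module k M] (E : k → Submodule k M)
    (h : Submodule.span k {f | ∃ w, f ∈ E w} = ⊤) (f : M) :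
    ∃ (s : Finset k) (F : k → M), (∀ w, F w ∈ E w) ∧ f = ∑ w ∈ s, F w := by
  classical
  have hf : f ∈ ⨆ w, E w := by
    have h1 : Submodule.span k {f | ∃ w, f ∈ E w} ≤ ⨆ w, E w := by
      rw [Submodule.span_le]
      rintro f ⟨w, hw⟩
      exact Submodule.mem_iSup_of_mem w hw
    rw [h] at h1
    exact h1 trivial
  rw [Submodule.mem_iSup_iff_exists_dfinsupp'] at hf
  obtain ⟨g, hg⟩ := hf
  exact ⟨g.support, fun w => g w, fun w => (g w).2, hg.symm⟩

theorem spec {M : Type*} [AddCommGroup M] [Module k M] (T S : Module.End k M) (c : k → k)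
    (h : Submodule.span k {f | ∃ w, f ∈ T.maxGenEigenspace w ∧ S f = c w • f} = ⊤)
    (I : Submodule k M) (hT : I ≤ I.comap T) : ∀ f ∈ I, S f ∈ I := by
  intro f hf
  obtain ⟨s, F, hF, e⟩ := span_decomp
    (fun w => T.maxGenEigenspace w ⊓ LinearMap.ker (S - c w • 1)) (by
      convert h using 3
      ext f
      simp [sub_eq_zero]) f
  rw [e] at hf
  have := spec_comp T I hT s F (fun w _ => (hF w).1) hf
  rw [e, map_sum]
  refine Submodule.sum_mem _ fun w hw => ?_
  have h2 : S (F w) = c w • F w := by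
    have := (hF w).2
    simpa [sub_eq_zero] using this
  rw [h2]
  exact I.smul_mem _ (this w hw)

theorem toLin_app {A : Type*} [CommRing A] [Algebra k A] (D : Derivation k A A) (f : A) :
    D.toLinearMap f = D f := rfl

theorem gen_mul {A : Type*} [CommRing A] [Algebra k A] (D : Derivation k A A) (α β : k) :
    ∀ (N p q : ℕ) (f g : A), p + q = N → ((D.toLinearMap - α • 1 : Module.End k A) ^ p) f = 0 →
      ((D.toLinearMap - β • 1 : Module.End k A) ^ q) g = 0 →
      ((D.toLinearMap - (α + β) • 1 : Module.End k A) ^ N) (f * g) = 0 := by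
  intro N
  induction N with
  | zero =>
    intro p q f g h hf hg
    obtain ⟨rfl, rfl⟩ : p = 0 ∧ q = 0 := by omega
    have : f = 0 := by simpa using hf
    simp [this]
  | succ N ih =>
    intro p q f g h hf hg
    have e : (D.toLinearMap - (α + β) • 1 : Module.End k A) (f * g) =
        ((D.toLinearMap - α • 1 : Module.End k A) f) * g +
        f * ((D.toLinearMap - β • 1 : Module.End k A) g) := by
      simp only [LinearMap.sub_apply, LinearMap.smul_apply, Module.End.one_apply,
        toLin_app, Derivation.leibniz, smul_eq_mul]
      simp only [Algebra.smul_def, map_add]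
      ring
    rw [pow_succ, Module.End.mul_apply, e, map_add]
    rcases p with _ | p
    · have : f = 0 := by simpa using hf
      simp [this]
    rcases q with _ | q
    · have : g = 0 := by simpa using hg
      simp [this]
    rw [ih p (q + 1) _ _ (by omega) (by rwa [← Module.End.mul_apply, ← pow_succ]) hg,
      ih (p + 1) q _ _ (by omega) hf (by rwa [← Module.End.mul_apply, ← pow_succ]), add_zero]

theorem maxGen_mul {A : Type*} [CommRing A] [Algebra k A] (D : Derivation k A A) (α β : k)
    {f g : A} (hf : f ∈ Module.End.maxGenEigenspace D.toLinearMap α)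
    (hg : g ∈ Module.End.maxGenEigenspace D.toLinearMap β) :
    f * g ∈ Module.End.maxGenEigenspace D.toLinearMap (α + β) := by
  rw [Module.End.mem_maxGenEigenspace] at *
  obtain ⟨p, hp⟩ := hf
  obtain ⟨q, hq⟩ := hg
  exact ⟨p + q, gen_mul D α β _ p q f g rfl hp hq⟩

variable {n : ℕ}

/-- Jordan decomposition data for a matrix -/
structure JD (k : Type) [Field k] (n : ℕ) where
  P : GL (Fin n) k
  d : Fin n → k
  nu : Matrix (Fin n) (Fin n) k
  nil : IsNilpotent nu
  comm : Matrix.diagonal d * nu = nu * Matrix.diagonal d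

namespace JD

def cj (J : JD k n) (c : Matrix (Fin n) (Fin n) k) : Matrix (Fin n) (Fin n) k :=
  J.P.1 * c * (J.P⁻¹).1

def a (J : JD k n) : Matrix (Fin n) (Fin n) k := J.cj (Matrix.diagonal J.d + J.nu)

theorem PP (J : JD k n) : J.P.1 * (J.P⁻¹).1 = 1 := by
  rw [← Units.val_mul, mul_inv_cancel]; rfl

theorem PP' (J : JD k n) : (J.P⁻¹).1 * J.P.1 = 1 := by
  rw [← Units.val_mul, inv_mul_cancel]; rfl

theorem cj_mul_P (J : JD k n) (c : Matrix (Fin n) (Fin n) k) : J.cj c * J.P.1 = J.P.1 * c := by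
  rw [cj, Matrix.mul_assoc, PP', Matrix.mul_one]

theorem cj_mul (J : JD k n) (c c' : Matrix (Fin n) (Fin n) k) :
    J.cj c * J.cj c' = J.cj (c * c') := by
  rw [cj, cj, cj]
  calc _ = J.P.1 * c * ((J.P⁻¹).1 * J.P.1) * c' * (J.P⁻¹).1 := by simp only [Matrix.mul_assoc]
    _ = _ := by rw [PP']; simp only [Matrix.mul_assoc, Matrix.one_mul]

theorem cj_add (J : JD k n) (c c' : Matrix (Fin n) (Fin n) k) :
    J.cj (c + c') = J.cj c + J.cj c' := by
  simp [cj, mul_add, add_mul]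

theorem cj_smul (J : JD k n) (r : k) (c : Matrix (Fin n) (Fin n) k) :
    J.cj (r • c) = r • J.cj c := by
  simp [cj]

theorem cj_one (J : JD k n) : J.cj 1 = 1 := by
  rw [cj, Matrix.mul_one, PP]

theorem trace_cj (J : JD k n) (c : Matrix (Fin n) (Fin n) k) : (J.cj c).trace = c.trace := by
  rw [cj, Matrix.trace_mul_comm, ← Matrix.mul_assoc, PP', Matrix.one_mul]

theorem det_cj (J : JD k n) (c : Matrix (Fin n) (Fin n) k) : (J.cj c).det = c.det := by
  rw [cj, Matrix.det_mul_comm, ← Matrix.mul_assoc, PP', Matrix.one_mul]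

/-- the diagonal matrix `ψ(d)` in the eigenbasis -/
def ss (J : JD k n) (e : Fin n → k) : Matrix (Fin n) (Fin n) k := J.cj (Matrix.diagonal e)

/-- the torus element -/
def lam (J : JD k n) (e : Fin n → ℤ) : kˣ →* GL (Fin n) k where
  toFun t :=
    { val := J.cj (Matrix.diagonal fun i => ((t ^ e i : kˣ) : k))
      inv := J.cj (Matrix.diagonal fun i => ((t⁻¹ ^ e i : kˣ) : k))
      val_inv := by
        rw [cj_mul, Matrix.diagonal_mul_diagonal]
        simp only [← Units.val_mul, ← mul_zpow, mul_inv_cancel, one_zpow, Units.val_one,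
          Matrix.diagonal_one, cj_one]
      inv_val := by
        rw [cj_mul, Matrix.diagonal_mul_diagonal]
        simp only [← Units.val_mul, ← mul_zpow, inv_mul_cancel, one_zpow, Units.val_one,
          Matrix.diagonal_one, cj_one] }
  map_one' := by
    apply Units.ext
    simp [cj_one]
  map_mul' s t := by
    apply Units.ext
    show J.cj (Matrix.diagonal fun i => (((s * t) ^ e i : kˣ) : k)) =
      J.cj (Matrix.diagonal fun i => ((s ^ e i : kˣ) : k)) *
      J.cj (Matrix.diagonal fun i => ((t ^ e i : kˣ) : k))
    rw [cj_mul, Matrix.diagonal_mul_diagonal]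
    simp only [mul_zpow, Units.val_mul]

/-- eigen-coordinates -/
def z (J : JD k n) (i j : Fin n) : QQ k n := (XM k n * cM J.P.1) i j

def del (k : Type) [Field k] (n : ℕ) : QQ k n := MvPolynomial.X (Sum.inr ())

theorem XM_diag (J : JD k n) (e : Fin n → k) (u : Matrix (Fin n) (Fin n) k) (i j : Fin n) :
    (XM k n * cM (J.P.1 * (u * Matrix.diagonal e))) i j = e j • (XM k n * cM (J.P.1 * u)) i j := by
  rw [← Matrix.mul_assoc, Matrix.mul_apply, Matrix.mul_apply, Finset.smul_sum]
  refine Finset.sum_congr rfl fun l _ => ?_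
  simp only [cM, Matrix.map_apply, Matrix.mul_diagonal, MvPolynomial.smul_eq_C_mul, map_mul]
  ring

theorem DD_z_pow (J : JD k n) (i j : Fin n) (r : ℕ) :
    (((DD J.a).toLinearMap - J.d j • 1 : Module.End k (QQ k n)) ^ r) (J.z i j) =
      (XM k n * cM (J.P.1 * J.nu ^ r)) i j := by
  induction r with
  | zero => simp [z]
  | succ r ih =>
    rw [pow_succ', Module.End.mul_apply, ih]
    simp only [LinearMap.sub_apply, LinearMap.smul_apply, Module.End.one_apply,
        toLin_app]
    rw [DD_XM, a, ← Matrix.mul_assoc, cj_mul_P, Matrix.mul_assoc, add_mul]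
    have hc : Matrix.diagonal J.d * J.nu ^ r = J.nu ^ r * Matrix.diagonal J.d :=
      (show Commute (Matrix.diagonal J.d) J.nu from J.comm).pow_right r
    rw [hc, mul_add]
    have : cM (J.P.1 * (J.nu ^ r * Matrix.diagonal J.d) + J.P.1 * (J.nu * J.nu ^ r)) =
      cM (J.P.1 * (J.nu ^ r * Matrix.diagonal J.d)) + cM (J.P.1 * (J.nu * J.nu ^ r)) := by
      apply Matrix.ext; intro i j; simp [cM, -Matrix.map_mul]
    rw [this, mul_add, Matrix.add_apply, XM_diag, add_sub_cancel_left, pow_succ']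

theorem z_mem (J : JD k n) (i j : Fin n) :
    J.z i j ∈ Module.End.maxGenEigenspace (DD J.a).toLinearMap (J.d j) := by
  rw [Module.End.mem_maxGenEigenspace]
  obtain ⟨N, hN⟩ := J.nil
  refine ⟨N, ?_⟩
  rw [DD_z_pow, hN]
  simp [cM]

theorem DD_ss_z (J : JD k n) (e : Fin n → k) (i j : Fin n) :
    DD (J.ss e) (J.z i j) = e j • J.z i j := by
  rw [z, DD_XM, ss, cj_mul_P]
  have := XM_diag J e 1 i j
  simpa using this

theorem RR_XM (g : GL (Fin n) k) (c : Matrix (Fin n) (Fin n) k) (i j : Fin n) :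
    RR g ((XM k n * cM c) i j) = (XM k n * cM (g.1 * c)) i j := by
  rw [cM_mul, ← Matrix.mul_assoc]
  simp only [Matrix.mul_apply (M := XM k n * cM g.1)]
  rw [Matrix.mul_apply, map_sum]
  refine Finset.sum_congr rfl fun l _ => ?_
  rw [map_mul]
  congr 1
  · simp [RR, XM]
  · simp [RR, cM, MvPolynomial.algebraMap_eq]

theorem RR_z (J : JD k n) (e : Fin n → ℤ) (t : kˣ) (i j : Fin n) :
    RR (J.lam e t) (J.z i j) = ((t ^ e j : kˣ) : k) • J.z i j := by
  rw [z, RR_XM]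
  have e0 : (J.lam e t).1 = J.cj (Matrix.diagonal fun i => ((t ^ e i : kˣ) : k)) := rfl
  rw [e0, cj_mul_P]
  have := XM_diag J (fun j => ((t ^ e j : kˣ) : k)) 1 i j
  simpa using this

theorem prod_zpow_sum (t : kˣ) (e : Fin n → ℤ) (s : Finset (Fin n)) :
    ∏ i ∈ s, t ^ e i = t ^ (∑ i ∈ s, e i) := by
  classical
  induction s using Finset.induction_on with
  | empty => simp
  | insert a s ha ih => rw [Finset.prod_insert ha, Finset.sum_insert ha, ih, zpow_add]

theorem RR_del (J : JD k n) (e : Fin n → ℤ) (t : kˣ) :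
    RR (J.lam e t) (del k n) = ((t ^ (-∑ i, e i) : kˣ) : k) • del k n := by
  have : ((J.lam e t)⁻¹).1.det = ((t ^ (-∑ i, e i) : kˣ) : k) := by
    show (J.cj (Matrix.diagonal fun i => ((t⁻¹ ^ e i : kˣ) : k))).det = _
    rw [det_cj, Matrix.det_diagonal, ← Units.coe_prod, prod_zpow_sum, inv_zpow', zpow_neg]

  simp only [RR, del, MvPolynomial.aeval_X, Sum.elim_inr, MvPolynomial.smul_eq_C_mul]
  rw [this]

theorem DD_ss_del (J : JD k n) (e : Fin n → k) :
    DD (J.ss e) (del k n) = (-∑ i, e i) • del k n := by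
  rw [del, DD_Xr, ss, trace_cj, Matrix.trace_diagonal, MvPolynomial.smul_eq_C_mul]

theorem del_mem (J : JD k n) :
    del k n ∈ Module.End.maxGenEigenspace (DD J.a).toLinearMap (-∑ i, J.d i) := by
  rw [Module.End.mem_maxGenEigenspace]
  refine ⟨1, ?_⟩
  have : DD J.a (del k n) = (-∑ i, J.d i) • del k n := by
    rw [del, DD_Xr, a, trace_cj, Matrix.trace_add, Matrix.trace_diagonal,
      (Matrix.isNilpotent_trace_of_isNilpotent J.nil).eq_zero, add_zero, MvPolynomial.smul_eq_C_mul]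
  simp [this]

theorem span_good (J : JD k n) (Good : QQ k n → Prop) (h1 : Good 1)
    (hm : ∀ f g, Good f → Good g → Good (f * g)) (hz : ∀ i j, Good (J.z i j))
    (hd : Good (del k n)) : Submodule.span k {f | Good f} = ⊤ := by
  rw [eq_top_iff]
  have hmul : ∀ f ∈ Submodule.span k {f | Good f}, ∀ g ∈ Submodule.span k {f | Good f},
      f * g ∈ Submodule.span k {f | Good f} := by
    intro f hf g hg
    have := Submodule.mul_mem_mul hf hg
    rw [Submodule.span_mul_span] at this
    refine Submodule.span_mono ?_ this
    rintro _ ⟨f, hf, g, hg, rfl⟩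
    exact hm f g hf hg
  intro f _
  induction f using MvPolynomial.induction_on with
  | C c =>
    rw [MvPolynomial.C_eq_smul_one]
    exact Submodule.smul_mem _ _ (Submodule.subset_span h1)
  | add p q hp hq => exact Submodule.add_mem _ (hp trivial) (hq trivial)
  | mul_X p v hp =>
    apply hmul _ (hp trivial)
    rcases v with ⟨i, j⟩ | u
    · have : MvPolynomial.X (Sum.inl (i, j)) = ∑ l, ((J.P⁻¹).1 l j) • J.z i l := by
        have e : (XM k n * cM J.P.1 * cM (J.P⁻¹).1) i j = XM k n i j := by
          rw [Matrix.mul_assoc, ← cM_mul, PP]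
          have : cM (1 : Matrix (Fin n) (Fin n) k) = 1 := by
            apply Matrix.ext; intro i j; by_cases h : i = j <;> simp [cM, Matrix.one_apply, h]
          rw [this, Matrix.mul_one]
        have e2 : XM k n i j = MvPolynomial.X (Sum.inl (i, j)) := rfl
        rw [← e2, ← e, Matrix.mul_apply]
        refine Finset.sum_congr rfl fun l _ => ?_
        simp only [cM, Matrix.map_apply, MvPolynomial.smul_eq_C_mul, z]
        ring
      rw [this]
      exact Submodule.sum_mem _ fun l _ => Submodule.smul_mem _ _ (Submodule.subset_span (hz i l))
    · exact Submodule.subset_span hd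

theorem one_mem (J : JD k n) :
    (1 : QQ k n) ∈ Module.End.maxGenEigenspace (DD J.a).toLinearMap 0 := by
  rw [Module.End.mem_maxGenEigenspace]
  exact ⟨1, by simp⟩

/-- replica in the Lie algebra -/
theorem replica (J : JD k n) {K : Subgroup (GL (Fin n) k)} (ha : J.a ∈ LieK K) (ψ : k →+ k) :
    J.ss (fun i => ψ (J.d i)) ∈ LieK K := by
  apply mem_LieK_of_DD
  refine spec (DD J.a).toLinearMap (DD (J.ss fun i => ψ (J.d i))).toLinearMap ψ ?_
    ((II K).restrictScalars k) (fun f hf => DD_mem_II ha hf)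
  refine span_good J (fun f => ∃ w, f ∈ Module.End.maxGenEigenspace (DD J.a).toLinearMap w ∧
    (DD (J.ss fun i => ψ (J.d i))).toLinearMap f = ψ w • f) ?_ ?_ ?_ ?_
  · exact ⟨0, J.one_mem, by simp⟩
  · rintro f g ⟨w, hf, hf2⟩ ⟨w', hg, hg2⟩
    refine ⟨w + w', maxGen_mul _ _ _ hf hg, ?_⟩
    simp only [toLin_app] at hf2 hg2 ⊢
    rw [Derivation.leibniz, hf2, hg2, map_add]
    simp only [smul_eq_mul, MvPolynomial.smul_eq_C_mul, map_add]
    ring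
  · intro i j
    exact ⟨_, J.z_mem i j, J.DD_ss_z _ i j⟩
  · refine ⟨_, J.del_mem, ?_⟩
    have := J.DD_ss_del (fun i => ψ (J.d i))
    simpa using this

/-- weight decomposition for the torus attached to a rational functional -/
theorem weights (J : JD k n) (ψ : k →+ ℚ) (e : Fin n → ℤ) (he : ∀ i, ψ (J.d i) = e i) (f : QQ k n) :
    ∃ (s : Finset k) (F : k → QQ k n), (∀ w, F w ∈ Module.End.maxGenEigenspace (DD J.a).toLinearMap w)
      ∧ (∀ w ∈ s, F w ≠ 0 → ∃ m : ℤ, ψ w = m ∧ ∀ t, RR (J.lam e t) (F w) = ((t ^ m : kˣ) : k) • F w)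
      ∧ f = ∑ w ∈ s, F w := by
  classical
  let E : k → Submodule k (QQ k n) := fun w =>
    if h : ∃ m : ℤ, ψ w = m then
      { carrier := {f | f ∈ Module.End.maxGenEigenspace (DD J.a).toLinearMap w ∧
          ∀ m : ℤ, ψ w = m → ∀ t, RR (J.lam e t) f = ((t ^ m : kˣ) : k) • f}
        zero_mem' := ⟨Submodule.zero_mem _, by simp⟩
        add_mem' := fun {a b} ha hb => ⟨Submodule.add_mem _ ha.1 hb.1, by
          intro m hm t; rw [map_add, ha.2 m hm, hb.2 m hm, smul_add]⟩
        smul_mem' := fun c a ha => ⟨Submodule.smul_mem _ _ ha.1, by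
          intro m hm t; rw [map_smul, ha.2 m hm, smul_comm]⟩ }
    else ⊥
  have hE : ∀ w f (m : ℤ), ψ w = m → f ∈ Module.End.maxGenEigenspace (DD J.a).toLinearMap w →
      (∀ t, RR (J.lam e t) f = ((t ^ m : kˣ) : k) • f) → f ∈ E w := by
    intro w f m hm hf hR
    simp only [E]
    rw [dif_pos ⟨m, hm⟩]
    refine ⟨hf, fun m' hm' => ?_⟩
    have : m = m' := by exact_mod_cast hm.symm.trans hm'
    rw [← this]; exact hR
  have hE' : ∀ w f, f ∈ E w → f ∈ Module.End.maxGenEigenspace (DD J.a).toLinearMap w ∧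
      (f ≠ 0 → ∃ m : ℤ, ψ w = m ∧ ∀ t, RR (J.lam e t) f = ((t ^ m : kˣ) : k) • f) := by
    intro w f hf
    simp only [E] at hf
    split_ifs at hf with h
    · refine ⟨hf.1, fun _ => ?_⟩
      obtain ⟨m, hm⟩ := h
      exact ⟨m, hm, hf.2 m hm⟩
    · rw [Submodule.mem_bot] at hf
      subst hf
      exact ⟨Submodule.zero_mem _, fun h => absurd rfl h⟩
  obtain ⟨s, F, hF, hs⟩ := span_decomp E (by
    let Good : QQ k n → Prop := fun f => ∃ w, ∃ m : ℤ, ψ w = m ∧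
      f ∈ Module.End.maxGenEigenspace (DD J.a).toLinearMap w ∧
      ∀ t, RR (J.lam e t) f = ((t ^ m : kˣ) : k) • f
    have hg : Submodule.span k {f | Good f} = ⊤ := by
      refine span_good J Good ?_ ?_ ?_ ?_
      · exact ⟨0, 0, by simp, J.one_mem, by simp⟩
      · rintro f g ⟨w, m, hm, hf, hf2⟩ ⟨w', m', hm', hg, hg2⟩
        refine ⟨w + w', m + m', by simp [hm, hm'], maxGen_mul _ _ _ hf hg, fun t => ?_⟩
        rw [map_mul, hf2, hg2, zpow_add, Units.val_mul, smul_mul_smul_comm]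
      · intro i j
        exact ⟨_, e j, he j, J.z_mem i j, fun t => J.RR_z e t i j⟩
      · exact ⟨_, -∑ i, e i, by simp [he], J.del_mem, fun t => J.RR_del e t⟩
    rw [eq_top_iff, ← hg]
    apply Submodule.span_mono
    rintro f ⟨w, m, hm, hf, hf2⟩
    exact ⟨w, hE w f m hm hf hf2⟩) f
  exact ⟨s, F, fun w => (hE' w _ (hF w)).1, fun w _ => (hE' w _ (hF w)).2, hs⟩

theorem lam_mem (J : JD k n) {K : Subgroup (GL (Fin n) k)} (hK : ClosedK K) (ha : J.a ∈ LieK K)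
    (ψ : k →+ ℚ) (e : Fin n → ℤ) (he : ∀ i, ψ (J.d i) = e i) (t : kˣ) : J.lam e t ∈ K := by
  apply mem_of_RR hK
  intro f hf
  obtain ⟨s, F, hF, hR, hs⟩ := J.weights ψ e he f
  have hc := spec_comp (DD J.a).toLinearMap ((II K).restrictScalars k)
    (fun f hf => DD_mem_II ha hf) s F (fun w _ => hF w) (by rw [← hs]; exact hf)
  rw [hs, map_sum]
  refine Submodule.sum_mem _ fun w hw => ?_
  by_cases h0 : F w = 0
  · rw [h0, map_zero]; exact Submodule.zero_mem _
  · obtain ⟨m, hm, hR⟩ := hR w hw h0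
    rw [hR]
    exact Submodule.smul_mem ((II K).restrictScalars k) _ (hc w hw)

/-- derivative of a torus inside `K` -/
theorem ss_mem_of_lam [CharZero k] (J : JD k n) {K : Subgroup (GL (Fin n) k)} (e : Fin n → ℤ)
    (h : ∀ t, J.lam e t ∈ K) : J.ss (fun i => (e i : k)) ∈ LieK K := by
  let t : kˣ := Units.mk0 2 two_ne_zero
  have hinj : Function.Injective (fun m : ℤ => ((t ^ m : kˣ) : k)) := by
    intro m m' hmm
    have h1 : (2 : k) ^ m = (2 : k) ^ m' := by simpa [t] using hmm
    have h2 : ((2 : ℚ) ^ m : ℚ) = (2 : ℚ) ^ m' := by exact_mod_cast (algebraMap ℚ k).injective (by simpa using h1)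
    exact zpow_right_injective₀ (by norm_num) (by norm_num) h2
  apply mem_LieK_of_DD
  refine spec (RR (J.lam e t)).toLinearMap (DD (J.ss fun i => (e i : k))).toLinearMap
    (fun w => ((Function.invFun (fun m : ℤ => ((t ^ m : kˣ) : k)) w : ℤ) : k)) ?_
    ((II K).restrictScalars k) (fun f hf => RR_mem_II hf (h t))
  let Good : QQ k n → Prop := fun f => ∃ m : ℤ, RR (J.lam e t) f = ((t ^ m : kˣ) : k) • f ∧
    DD (J.ss fun i => (e i : k)) f = (m : k) • f
  have hg : Submodule.span k {f | Good f} = ⊤ := by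
    refine span_good J Good ?_ ?_ ?_ ?_
    · exact ⟨0, by simp, by simp⟩
    · rintro f g ⟨m, hf, hf2⟩ ⟨m', hg, hg2⟩
      refine ⟨m + m', ?_, ?_⟩
      · rw [map_mul, hf, hg, zpow_add, Units.val_mul, smul_mul_smul_comm]
      · rw [Derivation.leibniz, hf2, hg2]
        simp only [smul_eq_mul, MvPolynomial.smul_eq_C_mul, map_add, Int.cast_add]
        ring
    · intro i j
      exact ⟨e j, J.RR_z e t i j, J.DD_ss_z _ i j⟩
    · refine ⟨-∑ i, e i, J.RR_del e t, ?_⟩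
      rw [DD_ss_del]; push_cast; rfl
  rw [eq_top_iff, ← hg]
  apply Submodule.span_mono
  rintro f ⟨m, hf, hf2⟩
  refine ⟨((t ^ m : kˣ) : k), ?_, ?_⟩
  · rw [Module.End.mem_maxGenEigenspace]
    refine ⟨1, ?_⟩
    simp only [pow_one, LinearMap.sub_apply, LinearMap.smul_apply, Module.End.one_apply,
      AlgHom.toLinearMap_apply, hf, sub_self]
  · beta_reduce
    rw [Function.leftInverse_invFun hinj m]
    exact hf2

theorem exists_JD [IsAlgClosed k] [CharZero k] (a : Matrix (Fin n) (Fin n) k) :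
    ∃ J : JD k n, J.a = a := by
  classical
  set f : Module.End k (Fin n → k) := Matrix.toLin' a with hf
  obtain ⟨N, hN, S, hS, hNn, hSs, hfe⟩ := f.exists_isNilpotent_isSemisimple
  have hcomm : Commute S N := by
    have h1 : Commute f S := Algebra.commute_of_mem_adjoin_self hS
    have h2 : N = f - S := by rw [hfe]; abel
    rw [h2]
    exact h1.symm.sub_right (Commute.refl S)
  have htop : ⨆ μ, S.eigenspace μ = ⊤ :=
    hSs.iSup_maxGenEigenspace_eq_top_iff.1 (Module.End.iSup_maxGenEigenspace_eq_top S)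
  have hspan : ⊤ ≤ Submodule.span k {v : Fin n → k | ∃ μ : k, S v = μ • v} := by
    rw [← htop]
    refine iSup_le fun μ v hv => Submodule.subset_span ⟨μ, Module.End.mem_eigenspace_iff.1 hv⟩
  let b0 := Module.Basis.ofSpan hspan
  have hb0 : ∀ i, ∃ μ : k, S (b0 i) = μ • b0 i := fun i =>
    Module.Basis.ofSpan_subset hspan ⟨i, rfl⟩
  haveI := Module.Finite.finite_basis b0
  letI := Fintype.ofFinite ↑((linearIndepOn_empty k id).extend (Set.empty_subset {v : Fin n → k | ∃ μ : k, S v = μ • v}))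
  have hcard : Fintype.card ↑((linearIndepOn_empty k id).extend (Set.empty_subset {v : Fin n → k | ∃ μ : k, S v = μ • v})) = n := by
    rw [← Module.finrank_eq_card_basis b0]; simp
  let b : Module.Basis (Fin n) k (Fin n → k) := b0.reindex (Fintype.equivFinOfCardEq hcard)
  have hb : ∀ i, ∃ μ : k, S (b i) = μ • b i := fun i => by
    simp only [b, Module.Basis.reindex_apply]; exact hb0 _
  choose d hd using hb
  let P0 := (Pi.basisFun k (Fin n)).toMatrix b
  let P1 := b.toMatrix (Pi.basisFun k (Fin n))
  have h01 : P0 * P1 = 1 := Module.Basis.toMatrix_mul_toMatrix_flip _ _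
  have h10 : P1 * P0 = 1 := Module.Basis.toMatrix_mul_toMatrix_flip _ _
  let P : GL (Fin n) k := ⟨P0, P1, h01, h10⟩
  let s := LinearMap.toMatrix' S
  let ν := LinearMap.toMatrix' N
  have hs : s * P0 = P0 * Matrix.diagonal d := by
    ext i j
    rw [Matrix.mul_diagonal]
    have : P0 i j = b j i := by simp [P0, Module.Basis.toMatrix_apply]
    rw [this]
    have h2 := congrFun (hd j) i
    rw [Pi.smul_apply, smul_eq_mul, mul_comm] at h2
    rw [← h2, Matrix.mul_apply]
    have h3 : S (b j) i = (s.mulVec (b j)) i := by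
      rw [← Matrix.toLin'_apply, Matrix.toLin'_toMatrix']
    rw [h3, Matrix.mulVec, dotProduct]
    refine Finset.sum_congr rfl fun l _ => ?_
    simp [P0, Module.Basis.toMatrix_apply]
  have hs2 : Matrix.diagonal d = P1 * s * P0 := by
    rw [Matrix.mul_assoc, hs, ← Matrix.mul_assoc, h10, Matrix.one_mul]
  have hsν : s * ν = ν * s := by
    simp only [s, ν, ← LinearMap.toMatrix'_mul]; rw [hcomm.eq]
  have hνnil : IsNilpotent ν := hNn.map (LinearMap.toMatrixAlgEquiv' : _ ≃ₐ[k] _)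
  have hcjm : ∀ c c' : Matrix (Fin n) (Fin n) k, (P1 * c * P0) * (P1 * c' * P0) = P1 * (c * c') * P0 := by
    intro c c'
    calc _ = P1 * c * (P0 * P1) * c' * P0 := by simp only [Matrix.mul_assoc]
      _ = _ := by rw [h01]; simp only [Matrix.mul_assoc, Matrix.one_mul]
  refine ⟨⟨P, d, P1 * ν * P0, ?_, ?_⟩, ?_⟩
  · obtain ⟨r, hr⟩ := hνnil
    have : ∀ r, (P1 * ν * P0) ^ r = P1 * ν ^ r * P0 := by
      intro r
      induction r with
      | zero => simp [h10]
      | succ r ih => rw [pow_succ, ih, hcjm, pow_succ]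
    exact ⟨r, by rw [this, hr]; simp⟩
  · rw [hs2, hcjm, hcjm, hsν]
  · show P0 * (Matrix.diagonal d + P1 * ν * P0) * P1 = a
    have e : a = ν + s := by
      have : a = LinearMap.toMatrix' f := by rw [hf, LinearMap.toMatrix'_toLin']
      rw [this, hfe]; simp [s, ν]
    rw [hs2, e, ← Matrix.add_mul, ← Matrix.mul_add, add_comm s ν]
    calc _ = (P0 * P1) * (ν + s) * (P0 * P1) := by simp only [Matrix.mul_assoc]
      _ = _ := by rw [h01]; simp

end JD
end spec

noncomputable section redu
variable {n : ℕ}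

section engelsec
attribute [local instance] LieRing.ofAssociativeRing

theorem engel_flag (r : Submodule k (Matrix (Fin n) (Fin n) k))
    (hl : ∀ a ∈ r, ∀ b ∈ r, a * b - b * a ∈ r) (hn : ∀ a ∈ r, IsNilpotent a) :
    ∃ (N : ℕ) (W : ℕ → Submodule k (Fin n → k)), W 0 = ⊤ ∧ W N = ⊥ ∧ Antitone W ∧
      ∀ a ∈ r, ∀ j, ∀ v ∈ W j, a.mulVec v ∈ W (j + 1) := by
  let L : LieSubalgebra k (Module.End k (Fin n → k)) :=
    { r.comap (LinearMap.toMatrix' : _ ≃ₗ[k] Matrix (Fin n) (Fin n) k).toLinearMap with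
      lie_mem' := by
        intro x y hx hy
        show LinearMap.toMatrix' (x * y - y * x) ∈ r
        rw [map_sub, LinearMap.toMatrix'_mul, LinearMap.toMatrix'_mul]
        exact hl _ hx _ hy }
  have hnil : LieModule.IsNilpotent L (Fin n → k) := by
    rw [LieModule.isNilpotent_iff_forall' (R := k)]
    rintro ⟨x, hx⟩
    have h1 : IsNilpotent (LinearMap.toMatrix' x) := hn _ hx
    have h2 : IsNilpotent (Matrix.toLinAlgEquiv' (LinearMap.toMatrix' x)) := h1.map _
    have h3 : Matrix.toLinAlgEquiv' (LinearMap.toMatrix' x) = x := Matrix.toLin'_toMatrix' x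
    rw [h3] at h2
    exact h2
  obtain ⟨N, hN⟩ := (LieModule.isNilpotent_iff k L (Fin n → k)).1 hnil
  refine ⟨N, fun j => (LieModule.lowerCentralSeries k L (Fin n → k) j).toSubmodule, ?_, ?_, ?_, ?_⟩
  · simp
  · simp only [hN]; rfl
  · intro i j hij
    exact LieModule.antitone_lowerCentralSeries k L (Fin n → k) hij
  · intro a ha j v hv
    simp only [LieModule.lowerCentralSeries_succ]
    have hx : Matrix.toLin' a ∈ L := by
      show LinearMap.toMatrix' (Matrix.toLin' a) ∈ r
      rwa [LinearMap.toMatrix'_toLin']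
    have := LieSubmodule.lie_mem_lie (I := (⊤ : LieIdeal k L))
      (N := LieModule.lowerCentralSeries k L (Fin n → k) j) (x := ⟨_, hx⟩) (m := v) trivial hv
    exact this
end engelsec

theorem pow_n_of_nil (a : Matrix (Fin n) (Fin n) k) (ha : IsNilpotent a) : a ^ n = 0 := by
  have h := (Matrix.isNilpotent_charpoly_sub_pow_of_isNilpotent ha).eq_zero
  rw [sub_eq_zero] at h
  have h2 := Matrix.aeval_self_charpoly a
  rw [h] at h2
  simpa using h2

theorem closedK_alg (G : AlgGroup k) : ClosedK G.toSubgroup := by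
  obtain ⟨I, hI⟩ := G.closed
  intro g hg
  rw [hI]
  have key : ∀ (A : GL (Fin G.n) k) (f : MvPolynomial (Fin G.n × Fin G.n) k),
      MvPolynomial.eval (pt A) (MvPolynomial.rename Sum.inl f) =
      MvPolynomial.eval (mat2pt (A : Matrix (Fin G.n) (Fin G.n) k)) f := by
    intro A f
    rw [MvPolynomial.eval_rename]; rfl
  intro f hf
  rw [← key]
  apply hg
  intro A hA
  rw [key]
  exact (hI A).1 hA f hf

theorem RR_mul (g h : GL (Fin n) k) (f : QQ k n) : RR g (RR h f) = RR (g * h) f := by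
  induction f using MvPolynomial.induction_on with
  | C c => simp [RR, MvPolynomial.algebraMap_eq]
  | add p q hp hq => simp only [map_add, hp, hq]
  | mul_X p v hp =>
    have key : RR g (RR h (MvPolynomial.X v)) = RR (g * h) (MvPolynomial.X v) := by
      rcases v with p | u
      · have e : ∀ g : GL (Fin n) k, RR g (MvPolynomial.X (Sum.inl p)) =
            (XM k n * cM g.1) p.1 p.2 := by
          intro g; simp [RR]
        rw [e, e, JD.RR_XM, Units.val_mul]
      · have e : ∀ g : GL (Fin n) k, RR g (MvPolynomial.X (Sum.inr u)) =
            ((g⁻¹).1.det) • MvPolynomial.X (Sum.inr ()) := by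
          intro g; simp [RR, MvPolynomial.smul_eq_C_mul]
        cases u
        rw [e h, e (g * h), map_smul, e g, smul_smul, mul_inv_rev, Units.val_mul, Matrix.det_mul]
    rw [map_mul, map_mul, hp, key, ← map_mul]

theorem RR_one (f : QQ k n) : RR (1 : GL (Fin n) k) f = f := by
  induction f using MvPolynomial.induction_on with
  | C c => simp [RR, MvPolynomial.algebraMap_eq]
  | add p q hp hq => simp only [map_add, hp, hq]
  | mul_X p v hp =>
    rw [map_mul, hp]
    congr 1
    rcases v with p | u
    · have : cM (1 : Matrix (Fin n) (Fin n) k) = 1 := by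
        apply Matrix.ext; intro i j; by_cases h : i = j <;> simp [cM, Matrix.one_apply, h]
      simp only [RR, MvPolynomial.aeval_X, Sum.elim_inl, Units.val_one, this, Matrix.mul_one]
      rfl
    · simp [RR]

theorem DD_RR (a : Matrix (Fin n) (Fin n) k) (g : GL (Fin n) k) (f : QQ k n) :
    DD (g.1 * a * (g⁻¹).1) (RR g f) = RR g (DD a f) := by
  induction f using MvPolynomial.induction_on with
  | C c => simp [RR, DD, MvPolynomial.algebraMap_eq]
  | add p q hp hq => simp only [map_add, hp, hq]
  | mul_X p v hp =>
    have hg : (g⁻¹).1 * g.1 = 1 := by rw [← Units.val_mul, inv_mul_cancel]; rfl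
    have : DD (g.1 * a * (g⁻¹).1) (RR g (MvPolynomial.X v)) = RR g (DD a (MvPolynomial.X v)) := by
      rcases v with p | u
      · have e : RR g (MvPolynomial.X (Sum.inl p)) = (XM k n * cM g.1) p.1 p.2 := by
          simp [RR]
        rw [e, DD_X, DD_XM, JD.RR_XM, Matrix.mul_assoc, hg, Matrix.mul_one]
      · have ht : (g.1 * a * (g⁻¹).1).trace = a.trace := by
          rw [Matrix.trace_mul_comm, ← Matrix.mul_assoc, hg, Matrix.one_mul]
        have e : RR g (MvPolynomial.X (Sum.inr u)) = ((g⁻¹).1.det) • MvPolynomial.X (Sum.inr ()) := by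
          simp [RR, MvPolynomial.smul_eq_C_mul]
        rw [DD_Xr, e, Derivation.map_smul, DD_Xr, ht, map_mul, e, MvPolynomial.algHom_C,
          MvPolynomial.algebraMap_eq, mul_smul_comm]
    simp only [map_mul, Derivation.leibniz, hp, this, map_add, smul_eq_mul]

theorem LieK_conj {K : Subgroup (GL (Fin n) k)} {a : Matrix (Fin n) (Fin n) k} (ha : a ∈ LieK K)
    {g : GL (Fin n) k} (hg : g ∈ K) : g.1 * a * (g⁻¹).1 ∈ LieK K := by
  apply mem_LieK_of_DD
  intro f hf
  have e : f = RR g (RR g⁻¹ f) := by rw [RR_mul, mul_inv_cancel, RR_one]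
  rw [e, DD_RR]
  exact RR_mem_II (DD_mem_II ha (RR_mem_II hf (K.inv_mem hg))) hg

/-- radical of the trace form -/
def rad (K : Subgroup (GL (Fin n) k)) : Submodule k (Matrix (Fin n) (Fin n) k) where
  carrier := {a | a ∈ LieK K ∧ ∀ b ∈ LieK K, (a * b).trace = 0}
  zero_mem' := ⟨Submodule.zero_mem _, by simp⟩
  add_mem' := fun {a b} ha hb => ⟨Submodule.add_mem _ ha.1 hb.1, fun c hc => by
    rw [add_mul, Matrix.trace_add, ha.2 c hc, hb.2 c hc, add_zero]⟩
  smul_mem' := fun r a ha => ⟨Submodule.smul_mem _ _ ha.1, fun c hc => by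
    rw [smul_mul_assoc, Matrix.trace_smul, ha.2 c hc, smul_zero]⟩

theorem rad_lie {K : Subgroup (GL (Fin n) k)} {a c : Matrix (Fin n) (Fin n) k} (ha : a ∈ rad K)
    (hc : c ∈ LieK K) : a * c - c * a ∈ rad K := by
  refine ⟨LieK_lie ha.1 hc, fun b hb => ?_⟩
  have h := ha.2 _ (LieK_lie hc hb)
  have e1 : (c * a * b).trace = (a * (b * c)).trace := by
    rw [Matrix.mul_assoc, Matrix.trace_mul_comm, Matrix.mul_assoc]
  rw [sub_mul, Matrix.trace_sub, e1, Matrix.mul_assoc, ← Matrix.trace_sub, ← mul_sub]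
  exact h

theorem rad_conj {K : Subgroup (GL (Fin n) k)} {a : Matrix (Fin n) (Fin n) k} (ha : a ∈ rad K)
    {g : GL (Fin n) k} (hg : g ∈ K) : g.1 * a * (g⁻¹).1 ∈ rad K := by
  refine ⟨LieK_conj ha.1 hg, fun b hb => ?_⟩
  have h := ha.2 _ (LieK_conj hb (K.inv_mem hg))
  rw [inv_inv] at h
  rw [← h, Matrix.mul_assoc, Matrix.mul_assoc, Matrix.trace_mul_comm]
  simp only [Matrix.mul_assoc]

theorem JD.comm_fun (J : JD k n) (φ : k → k) :
    Commute (Matrix.diagonal (fun i => φ (J.d i))) J.nu := by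
  apply Matrix.ext
  intro i j
  have h := congrFun (congrFun J.comm i) j
  rw [Matrix.diagonal_mul, Matrix.mul_diagonal] at h ⊢
  by_cases hij : J.d i = J.d j
  · rw [hij, mul_comm]
  · have : J.nu i j = 0 := by
      have h2 : (J.d i - J.d j) * J.nu i j = 0 := by rw [sub_mul, h]; ring
      exact (mul_eq_zero.1 h2).resolve_left (sub_ne_zero.2 hij)
    simp [this]

theorem JD.nil_cj (J : JD k n) {c : Matrix (Fin n) (Fin n) k} (hc : IsNilpotent c) :
    IsNilpotent (J.cj c) := by
  obtain ⟨r, hr⟩ := hc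
  have : ∀ r, (J.cj c) ^ r = J.cj (c ^ r) := by
    intro r
    induction r with
    | zero => simp [J.cj_one]
    | succ r ih => rw [pow_succ, ih, J.cj_mul, pow_succ]
  exact ⟨r, by rw [this, hr]; simp [JD.cj]⟩

variable [CharZero k]

theorem rad_nil [IsAlgClosed k] {K : Subgroup (GL (Fin n) k)} {a : Matrix (Fin n) (Fin n) k}
    (ha : a ∈ rad K) : IsNilpotent a := by
  obtain ⟨J, rfl⟩ := JD.exists_JD a
  have hd : ∀ i, J.d i = 0 := by
    intro i
    rw [← Module.forall_dual_apply_eq_zero_iff ℚ]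
    intro ψ
    let ψ' : k →+ k := (algebraMap ℚ k).toAddMonoidHom.comp ψ.toAddMonoidHom
    have h := ha.2 _ (J.replica ha.1 ψ')
    rw [JD.a, JD.ss, J.cj_mul, J.trace_cj, add_mul, Matrix.trace_add, Matrix.diagonal_mul_diagonal,
      Matrix.trace_diagonal, trace_nil _ ((J.comm_fun ψ').symm.isNilpotent_mul_right J.nil), add_zero] at h
    have h2 := congrArg ψ h
    rw [map_sum, map_zero] at h2
    have h3 : ∀ j, ψ (J.d j * ψ' (J.d j)) = ψ (J.d j) ^ 2 := by
      intro j
      have : J.d j * ψ' (J.d j) = ψ (J.d j) • J.d j := by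
        rw [Algebra.smul_def, mul_comm]; rfl
      rw [this, map_smul, smul_eq_mul, sq]
    simp only [h3] at h2
    have h4 := (Finset.sum_eq_zero_iff_of_nonneg (fun j _ => sq_nonneg (ψ (J.d j)))).1 h2 i (Finset.mem_univ i)
    exact pow_eq_zero_iff (two_ne_zero) |>.1 h4
  have : Matrix.diagonal J.d = 0 := by
    ext i j; by_cases h : i = j <;> simp [Matrix.diagonal, hd]
  rw [JD.a, this, zero_add]
  exact J.nil_cj J.nil

theorem exG_conj (g : GL (Fin n) k) (a : Matrix (Fin n) (Fin n) k) (ha : IsNilpotent a)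
    (hb : IsNilpotent (g.1 * a * (g⁻¹).1)) :
    g * exG a ha * g⁻¹ = exG (g.1 * a * (g⁻¹).1) hb := by
  apply Units.ext
  show g.1 * IsNilpotent.exp a * (g⁻¹).1 = IsNilpotent.exp (g.1 * a * (g⁻¹).1)
  have hg : (g⁻¹).1 * g.1 = 1 := by rw [← Units.val_mul, inv_mul_cancel]; rfl
  have hg' : g.1 * (g⁻¹).1 = 1 := by rw [← Units.val_mul, mul_inv_cancel]; rfl
  have hp : ∀ r, (g.1 * a * (g⁻¹).1) ^ r = g.1 * a ^ r * (g⁻¹).1 := by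
    intro r
    induction r with
    | zero => simp [hg']
    | succ r ih =>
      rw [pow_succ, ih, pow_succ]
      calc _ = g.1 * a ^ r * ((g⁻¹).1 * g.1) * a * (g⁻¹).1 := by simp only [Matrix.mul_assoc]
        _ = _ := by rw [hg]; simp only [Matrix.mul_assoc, Matrix.one_mul]
  obtain ⟨N, hN⟩ := ha
  rw [IsNilpotent.exp_eq_sum hN, IsNilpotent.exp_eq_sum (k := N) (by rw [hp, hN]; simp),
    Matrix.mul_sum, Matrix.sum_mul]
  refine Finset.sum_congr rfl fun r _ => ?_
  rw [hp]; simp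

open Polynomial in
/-- functions on matrices along a line -/
theorem line_poly (a : Matrix (Fin n) (Fin n) k) (ha : IsNilpotent a) (u : GL (Fin n) k)
    (f : MvPolynomial (Fin n × Fin n) k) : ∃ p : k[X], ∀ t : k, p.eval t =
      MvPolynomial.eval (mat2pt ((u * exG (t • a) (ha.smul t) : GL (Fin n) k) :
        Matrix (Fin n) (Fin n) k)) f := by
  obtain ⟨N, hN⟩ := id ha
  refine ⟨Phi a N u (MvPolynomial.rename Sum.inl f), fun t => ?_⟩
  rw [Phi_eval a ha N hN, MvPolynomial.eval_rename]; rfl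

def expSet (K : Subgroup (GL (Fin n) k)) : Set (GL (Fin n) k) :=
  {g | ∃ (a : Matrix (Fin n) (Fin n) k) (ha : IsNilpotent a), a ∈ rad K ∧ g = exG a ha}

theorem expSet_conn_aux (K : Subgroup (GL (Fin n) k)) (V W : Set (GL (Fin n) k))
    (hV : ClosedInGL V) (hW : ClosedInGL W)
    (hU : (Subgroup.closure (expSet K) : Set (GL (Fin n) k)) ⊆ V ∪ W)
    (hd : (Subgroup.closure (expSet K) : Set (GL (Fin n) k)) ∩ V ∩ W = ∅) (h1 : (1 : GL (Fin n) k) ∈ V) :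
    (Subgroup.closure (expSet K) : Set (GL (Fin n) k)) ⊆ V := by
  have step : ∀ u ∈ Subgroup.closure (expSet K), ∀ y ∈ expSet K, u ∈ V → u * y ∈ V := by
    rintro u hu y ⟨a, ha, har, rfl⟩ huV
    by_contra hnV
    have hmem : ∀ t : k, u * exG (t • a) (ha.smul t) ∈ Subgroup.closure (expSet K) := fun t =>
      Subgroup.mul_mem _ hu (Subgroup.subset_closure ⟨t • a, ha.smul t, (rad K).smul_mem t har, rfl⟩)
    have huW : u ∉ W := fun h => by
      have : u ∈ (∅ : Set (GL (Fin n) k)) := hd ▸ ⟨⟨hu, huV⟩, h⟩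
      exact this
    obtain ⟨IV, rfl⟩ := hV
    obtain ⟨IW, rfl⟩ := hW
    simp only [zeroLocus, Set.mem_setOf_eq, not_forall] at hnV huW
    obtain ⟨f, hf, hfn⟩ := hnV
    obtain ⟨g, hg, hgn⟩ := huW
    obtain ⟨p, hp⟩ := line_poly a ha u f
    obtain ⟨q, hq⟩ := line_poly a ha u g
    have hpq : p * q = 0 := by
      apply Polynomial.funext
      intro t
      rw [Polynomial.eval_mul, hp, hq, Polynomial.eval_zero]
      rcases hU (hmem t) with h | h
      · rw [h f hf, zero_mul]
      · rw [h g hg, mul_zero]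
    rcases mul_eq_zero.1 hpq with h | h
    · have := hp 1
      rw [h, Polynomial.eval_zero, exG_congr (one_smul k a) _ ha] at this
      exact hfn this.symm
    · have := hq 0
      rw [h, Polynomial.eval_zero, exG_congr (zero_smul k a) _ IsNilpotent.zero, exG_zero, mul_one] at this
      exact hgn this.symm
  have hinv : ∀ y ∈ expSet K, y⁻¹ ∈ expSet K := by
    rintro y ⟨a, ha, har, rfl⟩
    exact ⟨-a, ha.neg, (rad K).neg_mem har, exG_neg a ha⟩
  intro u hu
  induction hu using Subgroup.closure_induction_right with
  | one => exact h1
  | mul_right x hx y hy ih => exact step x hx y hy ih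
  | mul_inv_cancel x hx y hy ih => exact step x hx _ (hinv y hy) ih

theorem rad_eq_bot [IsAlgClosed k] (G : AlgGroup k) (hG : IsReductive G)
    {a : Matrix (Fin G.n) (Fin G.n) k} (ha : a ∈ rad G.toSubgroup) : a = 0 := by
  set U := Subgroup.closure (expSet G.toSubgroup) with hU
  have hinv : ∀ y ∈ expSet G.toSubgroup, y⁻¹ ∈ expSet G.toSubgroup := by
    rintro y ⟨a, ha, har, rfl⟩
    exact ⟨-a, ha.neg, Submodule.neg_mem _ har, exG_neg a ha⟩
  have hUG : U ≤ G.toSubgroup := by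
    rw [hU, Subgroup.closure_le]
    rintro y ⟨a, ha, har, rfl⟩
    exact exG_mem (closedK_alg G) ha har.1
  have hconn : IsConnSet (U : Set (GL (Fin G.n) k)) := by
    intro V W hV hW hc hd
    rcases hc U.one_mem with h | h
    · exact Or.inl (expSet_conn_aux _ V W hV hW hc hd h)
    · refine Or.inr (expSet_conn_aux _ W V hW hV (by rwa [Set.union_comm]) ?_ h)
      rw [Set.inter_assoc, Set.inter_comm W V, ← Set.inter_assoc]; exact hd
  have hid : idComponent G ⊆ G.toSubgroup := by
    rintro g ⟨C, ⟨hC, -, -⟩, hg⟩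
    exact hC hg
  have huni : ∀ u ∈ U, IsUnipotentEl u := by
    obtain ⟨N, W, hW0, hWN, hWa, hW⟩ := engel_flag (rad G.toSubgroup)
      (fun a ha b hb => rad_lie ha hb.1) (fun a ha => rad_nil ha)
    have hexp : ∀ y ∈ expSet G.toSubgroup, ∀ j, ∀ v ∈ W j, (y.1 - 1).mulVec v ∈ W (j + 1) := by
      rintro y ⟨a, ha, har, rfl⟩ j v hv
      have h1 : ∀ r : ℕ, (a ^ r).mulVec v ∈ W j := by
        intro r
        induction r with
        | zero => simpa using hv
        | succ r ih =>
          rw [pow_succ', ← Matrix.mulVec_mulVec]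
          exact hWa (Nat.le_succ j) (hW a har j _ ih)
      obtain ⟨M, hM⟩ := id ha
      have hM2 : a ^ (M + 1) = 0 := by rw [pow_succ, hM, zero_mul]
      have e : (exG a ha).1 - 1 = ∑ r ∈ Finset.range M, ((r + 1).factorial : ℚ)⁻¹ • a ^ (r + 1) := by
        show IsNilpotent.exp a - 1 = _
        rw [IsNilpotent.exp_eq_sum hM2, Finset.sum_range_succ']
        simp
      rw [e, Matrix.sum_mulVec]
      refine Submodule.sum_mem _ fun r _ => ?_
      have e2 : ((r + 1).factorial : ℚ)⁻¹ • a ^ (r + 1) = ((r + 1).factorial : k)⁻¹ • a ^ (r + 1) := by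
        ext i j
        simp [Algebra.smul_def]
      rw [e2, Matrix.smul_mulVec, pow_succ', ← Matrix.mulVec_mulVec]
      exact Submodule.smul_mem _ _ (hW a har j _ (h1 r))
    have hall : ∀ u ∈ U, ∀ j, ∀ v ∈ W j, (u.1 - 1).mulVec v ∈ W (j + 1) := by
      have step : ∀ u : GL (Fin G.n) k, ∀ y ∈ expSet G.toSubgroup,
          (∀ j, ∀ v ∈ W j, (u.1 - 1).mulVec v ∈ W (j + 1)) →
          (∀ j, ∀ v ∈ W j, ((u * y).1 - 1).mulVec v ∈ W (j + 1)) := by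
        intro u y hy hu j v hv
        have e : (u * y).1 - 1 = (u.1 - 1) * (y.1 - 1) + (u.1 - 1) + (y.1 - 1) := by
          rw [Units.val_mul]; noncomm_ring
        rw [e, Matrix.add_mulVec, Matrix.add_mulVec, ← Matrix.mulVec_mulVec]
        refine Submodule.add_mem _ (Submodule.add_mem _ ?_ (hu j v hv)) (hexp y hy j v hv)
        exact hu j _ (hWa (Nat.le_succ j) (hexp y hy j v hv))
      intro u hu
      induction hu using Subgroup.closure_induction_right with
      | one => intro j v hv; simp
      | mul_right x hx y hy ih => exact step x y hy ih
      | mul_inv_cancel x hx y hy ih => exact step x _ (hinv y hy) ih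
    intro u hu
    apply pow_n_of_nil
    refine ⟨N, ?_⟩
    have hp : ∀ r v, ((u.1 - 1) ^ r).mulVec v ∈ W r := by
      intro r
      induction r with
      | zero => intro v; rw [hW0]; trivial
      | succ r ih =>
        intro v
        rw [pow_succ', ← Matrix.mulVec_mulVec]
        exact hall u hu r _ (ih v)
    have hz : ∀ v, ((u.1 - 1) ^ N).mulVec v = 0 := fun v => by
      have := hp N v
      rwa [hWN, Submodule.mem_bot] at this
    apply Matrix.ext_of_mulVec_single
    intro i
    rw [hz]; ext j; simp [Matrix.col]
  have hfin := hG U (fun u hu => ⟨U, ⟨hUG, U.one_mem, hconn⟩, hu⟩) U.one_mem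
    (fun a ha b hb => U.mul_mem ha hb) (fun a ha => U.inv_mem ha) (by
      intro g hg h hh
      have hgG := hid hg
      have : U ≤ U.comap (MulAut.conj g).toMonoidHom := by
        conv_lhs => rw [hU]
        rw [Subgroup.closure_le]
        rintro y ⟨a, ha, har, rfl⟩
        show g * exG a ha * g⁻¹ ∈ U
        have hr := rad_conj har hgG
        rw [exG_conj g a ha (rad_nil hr)]
        exact Subgroup.subset_closure ⟨_, rad_nil hr, hr, rfl⟩
      exact this hh) hconn huni
  have h1 : exG a (rad_nil ha) ∈ (U : Set (GL (Fin G.n) k)) :=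
    Subgroup.subset_closure ⟨a, rad_nil ha, ha, rfl⟩
  rw [hfin] at h1
  apply exp_eq_one a (rad_nil ha)
  exact congrArg Units.val (Set.mem_singleton_iff.1 h1)

end redu

noncomputable section linalg
variable {n : ℕ}

section ringpart
variable {A : Type*} [Ring A] [Algebra k A]

theorem comm_pow_z (v z c : A) (hc : v * z - z * v = c) (hvc : v * c = c * v) (i : ℕ) :
    v ^ (i + 1) * z - z * v ^ (i + 1) = ((i + 1 : ℕ) : A) * (v ^ i * c) := by
  induction i with
  | zero => simp [hc]
  | succ i ih =>
    have h1 : v ^ (i + 1) * z = z * v ^ (i + 1) + ((i + 1 : ℕ) : A) * (v ^ i * c) := by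
      rw [← ih]; abel
    have h2 : v * z = z * v + c := by rw [← hc]; abel
    have h3 : v ^ (i + 1 + 1) * z = z * v ^ (i + 1 + 1) + c * v ^ (i + 1)
        + ((i + 1 : ℕ) : A) * (v ^ (i + 1) * c) := by
      calc v ^ (i + 1 + 1) * z = v * (v ^ (i + 1) * z) := by rw [pow_succ', mul_assoc]
        _ = (v * z) * v ^ (i + 1) + v * ((i + 1 : ℕ) : A) * (v ^ i * c) := by
          rw [h1, mul_add]; simp only [mul_assoc]
        _ = _ := by
          rw [h2, ← (Nat.cast_commute (i+1) v).eq, add_mul, mul_assoc z, ← pow_succ', mul_assoc,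
            ← mul_assoc v, ← pow_succ']
    have h4 : c * v ^ (i + 1) = v ^ (i + 1) * c := ((show Commute c v from hvc.symm).pow_right _).eq
    rw [h3, h4]
    push_cast
    noncomm_ring

theorem nil_of_comm [CharZero k] (v z c : A) (hc : v * z - z * v = c) (hvc : v * c = c * v) (q : ℕ) :
    ∀ m : ℕ, v ^ q * c ^ m = 0 → IsNilpotent c := by
  induction q with
  | zero => intro m h; exact ⟨m, by simpa using h⟩
  | succ q ih =>
    intro m h
    apply ih (m + 1 + m)
    have hcv : ∀ a b : ℕ, c ^ a * v ^ b = v ^ b * c ^ a := fun a b =>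
      ((show Commute c v from hvc.symm).pow_pow a b).eq
    have h1 := comm_pow_z v z c hc hvc q
    have h2 : ((q + 1 : ℕ) : A) * (v ^ q * c ^ (m + 1 + m)) = 0 := by
      have e : c ^ m * (((q + 1 : ℕ) : A) * (v ^ q * c)) * c ^ m =
          ((q + 1 : ℕ) : A) * (v ^ q * c ^ (m + 1 + m)) := by
        rw [← mul_assoc, ← (Nat.cast_commute (q+1) (c ^ m)).eq, mul_assoc, mul_assoc,
          ← mul_assoc (c ^ m), ← mul_assoc (c ^ m), hcv, mul_assoc (v ^ q), mul_assoc (v ^ q),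
          ← pow_succ, ← pow_add]
      rw [← e, ← h1]
      calc c ^ m * (v ^ (q + 1) * z - z * v ^ (q + 1)) * c ^ m
          = (c ^ m * v ^ (q + 1)) * z * c ^ m - c ^ m * z * (v ^ (q + 1) * c ^ m) := by noncomm_ring
        _ = 0 := by rw [hcv, h]; simp
    have : ((q + 1 : ℕ) : k) • (v ^ q * c ^ (m + 1 + m)) = 0 := by
      rw [Algebra.smul_def, map_natCast]; exact h2
    exact (smul_eq_zero.1 this).resolve_left (Nat.cast_ne_zero.2 (Nat.succ_ne_zero q))

theorem nil_mul_of_comm [CharZero k] (v z : A) (hv : IsNilpotent v)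
    (h : v * (v * z - z * v) = (v * z - z * v) * v) : IsNilpotent (v * z) := by
  set c := v * z - z * v with hc
  obtain ⟨p, hp⟩ := hv
  obtain ⟨r, hr⟩ := nil_of_comm (k := k) v z c hc.symm h p 0 (by simp [hp])
  have hcv : ∀ b : ℕ, c * v ^ b = v ^ b * c := fun b =>
      ((show Commute c v from h.symm).pow_right b).eq
  have one : ∀ (i : ℕ) (M : A), v ^ (i + 1) * M = 0 →
      v ^ i * (v * z * M - ((i + 1 : ℕ) : A) * (c * M)) = 0 := by
    intro i M hM
    have h1 := comm_pow_z v z c hc.symm h i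
    have h2 : v ^ (i + 1) * z = z * v ^ (i + 1) + ((i + 1 : ℕ) : A) * (v ^ i * c) := by
      rw [← h1]; abel
    calc v ^ i * (v * z * M - ((i + 1 : ℕ) : A) * (c * M))
        = (v ^ (i + 1) * z) * M - (v ^ i * ((i + 1 : ℕ) : A)) * (c * M) := by
          rw [pow_succ]; noncomm_ring
      _ = z * (v ^ (i + 1) * M) := by
          rw [h2, ← (Nat.cast_commute (i+1) (v ^ i)).eq]; noncomm_ring
      _ = 0 := by rw [hM, mul_zero]
  have stab : ∀ (i : ℕ) (M : A), v ^ i * M = 0 → v ^ i * (c * M) = 0 := by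
    intro i M hM
    rw [← mul_assoc, ← hcv, mul_assoc, hM, mul_zero]
  have natstab : ∀ (i j : ℕ) (M : A), v ^ i * M = 0 → v ^ i * ((j : A) * M) = 0 := by
    intro i j M hM
    rw [← mul_assoc, ← (Nat.cast_commute j (v ^ i)).eq, mul_assoc, hM, mul_zero]
  have pres : ∀ (i : ℕ) (M : A), v ^ (i + 1) * M = 0 → v ^ (i + 1) * (v * z * M) = 0 := by
    intro i M hM
    have h1 := one i M hM
    have h2 : v ^ (i + 1) * (v * z * M - ((i + 1 : ℕ) : A) * (c * M)) = 0 := by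
      rw [pow_succ', mul_assoc, h1, mul_zero]
    rw [mul_sub, natstab _ _ _ (stab _ _ hM), sub_zero] at h2
    exact h2
  have pows : ∀ (i s : ℕ) (M : A), v ^ (i + 1) * M = 0 →
      v ^ (i + 1) * ((v * z) ^ s * M) = 0 ∧
      v ^ i * ((v * z) ^ s * M - ((i + 1 : ℕ) : A) ^ s * (c ^ s * M)) = 0 := by
    intro i s M hM
    induction s with
    | zero => simp [hM]
    | succ s ih =>
      obtain ⟨ih1, ih2⟩ := ih
      refine ⟨by rw [pow_succ' (v * z), mul_assoc]; exact pres i _ ih1, ?_⟩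
      have h1 := one i _ ih1
      have h2 := natstab i (i + 1) _ (stab i _ ih2)
      rw [pow_succ' (v * z), mul_assoc (v * z)]
      have e : v * z * ((v * z) ^ s * M) - ((i + 1 : ℕ) : A) ^ (s + 1) * (c ^ (s + 1) * M) =
          (v * z * ((v * z) ^ s * M) - ((i + 1 : ℕ) : A) * (c * ((v * z) ^ s * M))) +
          ((i + 1 : ℕ) : A) * (c * ((v * z) ^ s * M - ((i + 1 : ℕ) : A) ^ s * (c ^ s * M))) := by
        have : c * (((i + 1 : ℕ) : A) ^ s * (c ^ s * M)) = ((i + 1 : ℕ) : A) ^ s * (c ^ (s + 1) * M) := by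
          rw [← mul_assoc, ← ((Nat.cast_commute (i+1) c).pow_left s).eq, mul_assoc, ← mul_assoc c,
            ← pow_succ']
        rw [mul_sub, this, mul_sub, ← mul_assoc (((i + 1 : ℕ) : A)) (((i + 1 : ℕ) : A) ^ s), ← pow_succ']
        abel
      rw [e, mul_add, h1, h2, add_zero]
  have fin : ∀ (i : ℕ) (M : A), v ^ i * M = 0 → ∃ s, (v * z) ^ s * M = 0 := by
    intro i
    induction i with
    | zero => intro M hM; exact ⟨0, by simpa using hM⟩
    | succ i ih =>
      intro M hM
      have h1 := (pows i r M hM).2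
      rw [hr, zero_mul, mul_zero, sub_zero] at h1
      obtain ⟨s, hs⟩ := ih _ h1
      exact ⟨s + r, by rw [pow_add, mul_assoc, hs]⟩
  obtain ⟨s, hs⟩ := fin p 1 (by rw [hp, zero_mul])
  exact ⟨s, by simpa using hs⟩

theorem sl2_comm (N H Y : A) (h1 : N * Y - Y * N = H) (h2 : H * N - N * H = 2 * N) (i : ℕ) :
    N ^ (i + 1) * Y = Y * N ^ (i + 1) + ((i + 1 : ℕ) : A) * ((H - (i : A)) * N ^ i) := by
  induction i with
  | zero => simp [← h1]
  | succ i ih =>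
    have e1 : N * Y = Y * N + H := by rw [← h1]; abel
    have e2 : N * H = H * N - 2 * N := by rw [← h2]; abel
    calc N ^ (i + 1 + 1) * Y = N * (N ^ (i + 1) * Y) := by rw [pow_succ', mul_assoc]
      _ = N * Y * N ^ (i + 1) + ((i + 1 : ℕ) : A) * ((N * H - N * (i : A)) * N ^ i) := by
        rw [ih, mul_add, ← mul_assoc, ← mul_assoc N, ← (Nat.cast_commute (i+1) N).eq, mul_assoc _ N,
          ← mul_assoc N, mul_sub]
      _ = Y * N ^ (i + 1 + 1) + H * N ^ (i + 1) +
          ((i + 1 : ℕ) : A) * ((H - 2 - (i : A)) * N ^ (i + 1)) := by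
        rw [e1, e2, ← (Nat.cast_commute i N).eq, ← sub_mul, ← sub_mul, mul_assoc _ N, ← pow_succ',
          add_mul, mul_assoc Y, ← pow_succ']
      _ = _ := by
        push_cast
        noncomm_ring

end ringpart

section sl2
variable {V : Type*} [AddCommGroup V] [Module k V]

/-- iterated product of `H - j` applied to `x` -/
def prodH (H : Module.End k V) (x : V) : ℕ → V
  | 0 => x
  | (i + 1) => H (prodH H x i) - (i : k) • prodH H x i

theorem prodH_ker (N H : Module.End k V) (h2 : H * N - N * H = 2 * N) (x : V) (hx : N x = 0) (i : ℕ) :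
    N (prodH H x i) = 0 := by
  induction i with
  | zero => exact hx
  | succ i ih =>
    have := congrArg (fun f : Module.End k V => f (prodH H x i)) h2
    simp [two_mul, ih] at this
    simp [prodH, ih, this]

theorem sl2_kill [CharZero k] (N H Y : Module.End k V) (h1 : N * Y - Y * N = H)
    (h2 : H * N - N * H = 2 * N) (hN : IsNilpotent N) (x : V) (hx : N x = 0) :
    ∃ r, prodH H x r = 0 := by
  have key : ∀ i, ∃ w, (N ^ i) w = prodH H x i := by
    intro i
    induction i with
    | zero => exact ⟨x, rfl⟩
    | succ i ih =>
      obtain ⟨w, hw⟩ := ih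
      refine ⟨((i + 1 : ℕ) : k)⁻¹ • Y w, ?_⟩
      have h := congrArg (fun f : Module.End k V => f w) (sl2_comm N H Y h1 h2 i)
      have h3 : (N ^ (i + 1)) w = 0 := by
        rw [pow_succ', Module.End.mul_apply, hw, prodH_ker N H h2 x hx]
      have h4 : (((i + 1 : ℕ) : Module.End k V) * ((H - (i : Module.End k V)) * N ^ i)) w =
          ((i + 1 : ℕ) : k) • prodH H x (i + 1) := by
        rw [Module.End.mul_apply, Module.End.mul_apply, hw, Module.End.natCast_apply,
          Nat.cast_smul_eq_nsmul, LinearMap.sub_apply, Module.End.natCast_apply, prodH,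
          Nat.cast_smul_eq_nsmul]
      have h5 : (N ^ (i + 1)) (Y w) = ((i + 1 : ℕ) : k) • prodH H x (i + 1) := by
        rw [← h4]
        have h' : (N ^ (i + 1)) (Y w) = Y ((N ^ (i + 1)) w) + (((i + 1 : ℕ) : Module.End k V) * ((H - (i : Module.End k V)) * N ^ i)) w := h
        rw [h', h3, map_zero, zero_add]
      rw [map_smul, h5, smul_smul, inv_mul_cancel₀ (Nat.cast_ne_zero.2 (Nat.succ_ne_zero i)), one_smul]
  obtain ⟨r, hr⟩ := hN
  obtain ⟨w, hw⟩ := key r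
  exact ⟨r, by rw [← hw, hr]; rfl⟩

theorem sl2_nil [CharZero k] [FiniteDimensional k V] (N H : Module.End k V)
    (h2 : H * N - N * H = 2 * N) : IsNilpotent N := by
  by_contra hN
  let T : Module.End k (Module.End k V) := LinearMap.mulLeft k H - LinearMap.mulRight k H
  have e : ∀ i : ℕ, T (N ^ i) = ((2 * i : ℕ) : k) • N ^ i := by
    intro i
    induction i with
    | zero => simp [T]
    | succ i ih =>
      have ih' : H * N ^ i - N ^ i * H = ((2 * i : ℕ) : k) • N ^ i := ih
      show H * N ^ (i + 1) - N ^ (i + 1) * H = _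
      calc H * N ^ (i + 1) - N ^ (i + 1) * H = (H * N ^ i - N ^ i * H) * N + N ^ i * (H * N - N * H) := by
            rw [pow_succ]; noncomm_ring
        _ = _ := by
            rw [ih', h2, pow_succ]
            have : N ^ i * (2 * N) = (2 : k) • (N ^ i * N) := by
              rw [two_mul, mul_add, two_smul]
            rw [this, smul_mul_assoc, ← add_smul]; push_cast; ring_nf
  have hev : ∀ i : ℕ, T.HasEigenvalue ((2 * i : ℕ) : k) := fun i =>
    Module.End.hasEigenvalue_of_hasEigenvector (x := N ^ i)
      ⟨Module.End.mem_eigenspace_iff.2 (e i), fun h => hN ⟨i, h⟩⟩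
  have hfin := Module.End.finite_hasEigenvalue T
  have : Function.Injective (fun i : ℕ => ((2 * i : ℕ) : k)) := fun a b h => by
    have := Nat.cast_injective (R := k) h
    omega
  exact (Set.infinite_range_of_injective this) (hfin.subset (by rintro _ ⟨i, rfl⟩; exact hev i))

end sl2

theorem jacobson_morozov [CharZero k] [IsAlgClosed k] (G : AlgGroup k) (hG : IsReductive G)
    (v : Matrix (Fin G.n) (Fin G.n) k) (hv : v ∈ LieK G.toSubgroup) (hnil : IsNilpotent v) :
    ∃ y ∈ LieK G.toSubgroup, ∃ h ∈ LieK G.toSubgroup, v * y - y * v = h ∧ h * v - v * h = 2 * v := by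
  let 𝔤 := LieK G.toSubgroup
  let adv : Matrix (Fin G.n) (Fin G.n) k →ₗ[k] Matrix (Fin G.n) (Fin G.n) k :=
    LinearMap.mulLeft k v - LinearMap.mulRight k v
  have hadv : ∀ z, adv z = v * z - z * v := fun z => rfl
  have hst : ∀ z ∈ 𝔤, adv z ∈ 𝔤 := fun z hz => LieK_lie hv hz
  by_cases hmem : v ∈ 𝔤.map (adv * adv)
  · obtain ⟨y, hy, he⟩ := hmem
    have he' : adv (adv y) = v := he
    refine ⟨(-2 : k) • y, 𝔤.smul_mem _ hy, (-2 : k) • adv y, 𝔤.smul_mem _ (hst y hy), ?_, ?_⟩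
    · rw [hadv, mul_smul_comm, smul_mul_assoc, smul_sub]
    · have : adv y * v - v * adv y = - v := by
        conv_rhs => rw [← he', hadv]
        abel
      rw [smul_mul_assoc, mul_smul_comm, ← smul_sub, this, smul_neg, neg_smul, neg_neg, two_smul, two_mul]
  · exfalso
    let B : 𝔤 →ₗ[k] Module.Dual k 𝔤 :=
      LinearMap.mk₂ k (fun a b => (a.1 * b.1).trace)
        (by intros; simp [add_mul]) (by intros; simp) (by intros; simp [mul_add]) (by intros; simp)
    have hB : ∀ a b, B a b = (a.1 * b.1).trace := fun a b => rfl
    have hinj : Function.Injective B := by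
      rw [← LinearMap.ker_eq_bot, LinearMap.ker_eq_bot']
      intro a ha
      apply Subtype.ext
      apply rad_eq_bot G hG
      refine ⟨a.2, fun b hb => ?_⟩
      have := LinearMap.congr_fun ha ⟨b, hb⟩
      simpa [hB] using this
    have hsurj : Function.Surjective B :=
      (LinearMap.injective_iff_surjective_of_finrank_eq_finrank (Subspace.dual_finrank_eq).symm).1 hinj
    obtain ⟨φ, hφ, hφ2⟩ := Submodule.exists_le_ker_of_notMem hmem
    obtain ⟨z, hz⟩ := hsurj (φ ∘ₗ 𝔤.subtype)
    have hz' : ∀ b (hb : b ∈ 𝔤), (z.1 * b).trace = φ b := fun b hb =>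
      LinearMap.congr_fun hz ⟨b, hb⟩
    have hzero : adv (adv z.1) = 0 := by
      apply rad_eq_bot G hG
      refine ⟨hst _ (hst _ z.2), fun b hb => ?_⟩
      have inv : ∀ a b, (adv a * b).trace = - (a * adv b).trace := by
        intro a b
        rw [hadv, hadv, sub_mul, mul_sub, Matrix.trace_sub, Matrix.trace_sub,
          Matrix.trace_mul_comm (v * a) b, ← Matrix.mul_assoc b, Matrix.trace_mul_comm (b * v),
          ← Matrix.mul_assoc a, ← Matrix.mul_assoc a]
        ring_nf
      rw [inv, inv, neg_neg, hz' _ (hst _ (hst _ hb))]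
      exact hφ2 ⟨b, hb, rfl⟩
    apply hφ
    rw [← hz' v hv, Matrix.trace_mul_comm]
    apply trace_nil
    apply nil_mul_of_comm (k := k) v z.1 hnil
    exact sub_eq_zero.1 hzero
end linalg

noncomputable section geom
variable {n : ℕ}

def stabG {G : AlgGroup k} {m : ℕ} (X : GVariety G m) (x : Fin m → k) (hx : x ∈ X.carrier) :
    Subgroup (GL (Fin G.n) k) where
  carrier := stabSet X x
  one_mem' := ⟨G.toSubgroup.one_mem, X.act_one x hx⟩
  mul_mem' := fun {a b} ha hb => ⟨G.toSubgroup.mul_mem ha.1 hb.1, by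
    rw [X.act_mul a ha.1 b hb.1 x hx, hb.2, ha.2]⟩
  inv_mem' := fun {a} ha => ⟨G.toSubgroup.inv_mem ha.1, by
    have h := X.act_mul _ (G.toSubgroup.inv_mem ha.1) _ ha.1 x hx
    rw [inv_mul_cancel, X.act_one x hx, ha.2] at h
    exact h.symm⟩

def cenG {G : AlgGroup k} {m : ℕ} (X : GVariety G m) : Subgroup (GL (Fin G.n) k) where
  carrier := actionCenter X
  one_mem' := ⟨G.toSubgroup.one_mem, fun x hx => X.act_one x hx⟩
  mul_mem' := fun {a b} ha hb => ⟨G.toSubgroup.mul_mem ha.1 hb.1, fun x hx => by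
    rw [X.act_mul a ha.1 b hb.1 x hx, hb.2 x hx, ha.2 x hx]⟩
  inv_mem' := fun {a} ha => ⟨G.toSubgroup.inv_mem ha.1, fun x hx => by
    have h := X.act_mul _ (G.toSubgroup.inv_mem ha.1) _ ha.1 x hx
    rw [inv_mul_cancel, X.act_one x hx, ha.2 x hx] at h
    exact h.symm⟩

theorem cenG_conj {G : AlgGroup k} {m : ℕ} (X : GVariety G m) {g h : GL (Fin G.n) k}
    (hg : g ∈ G.toSubgroup) (hh : h ∈ cenG X) : g * h * g⁻¹ ∈ cenG X := by
  have hgi := G.toSubgroup.inv_mem hg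
  refine ⟨G.toSubgroup.mul_mem (G.toSubgroup.mul_mem hg hh.1) hgi, fun x hx => ?_⟩
  have hx' := X.act_mem _ hgi x hx
  rw [X.act_mul _ (G.toSubgroup.mul_mem hg hh.1) _ hgi x hx, X.act_mul _ hg _ hh.1 _ hx',
    hh.2 _ hx', ← X.act_mul _ hg _ hgi x hx, mul_inv_cancel, X.act_one x hx]

theorem exists_actPoly {G : AlgGroup k} {m : ℕ} (X : GVariety G m) (x : Fin m → k)
    (hx : x ∈ X.carrier) : ∃ F : Fin m → QQ k G.n, ∀ g ∈ G.toSubgroup, ∀ i,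
      MvPolynomial.eval (pt g) (F i) = X.act g x i := by
  obtain ⟨p, hp⟩ := X.regular
  refine ⟨fun i => MvPolynomial.aeval (Sum.elim (fun q => MvPolynomial.X (Sum.inl q))
    (Sum.elim (fun _ => MvPolynomial.X (Sum.inr ())) (fun j => MvPolynomial.C (x j)))) (p i), ?_⟩
  intro g hg i
  rw [hp g hg x hx i]
  beta_reduce
  generalize p i = f
  induction f using MvPolynomial.induction_on with
  | C c => simp [MvPolynomial.algebraMap_eq]
  | add p q hp hq => rw [map_add, map_add, map_add, hp, hq]
  | mul_X p v hp =>
    rw [map_mul, map_mul, map_mul, hp]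
    rcases v with q | u | j <;> simp [pt]

theorem stab_le {G : AlgGroup k} {m : ℕ} (X : GVariety G m) (x : Fin m → k) (hx : x ∈ X.carrier) :
    stabG X x hx ≤ G.toSubgroup := fun g hg => hg.1

theorem cen_le_stab {G : AlgGroup k} {m : ℕ} (X : GVariety G m) (x : Fin m → k) (hx : x ∈ X.carrier) :
    cenG X ≤ stabG X x hx := fun g hg => ⟨hg.1, hg.2 x hx⟩

theorem closed_stab {G : AlgGroup k} {m : ℕ} (X : GVariety G m) (x : Fin m → k) (hx : x ∈ X.carrier) :
    ClosedK (stabG X x hx) := by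
  intro g hg
  obtain ⟨F, hF⟩ := exists_actPoly X x hx
  have hgG : g ∈ G.toSubgroup := closedK_alg G g fun f hf => hg f (II_mono (stab_le X x hx) hf)
  refine ⟨hgG, funext fun i => ?_⟩
  have := hg (F i - MvPolynomial.C (x i)) (by
    intro h hh
    rw [map_sub, hF h hh.1, MvPolynomial.eval_C, hh.2, sub_self])
  rw [map_sub, hF g hgG, MvPolynomial.eval_C] at this
  exact sub_eq_zero.1 this

theorem closed_cen {G : AlgGroup k} {m : ℕ} (X : GVariety G m) : ClosedK (cenG X) := by
  intro g hg
  have hgG : g ∈ G.toSubgroup := closedK_alg G g fun f hf => hg f (II_mono (K := cenG X) (fun h hh => And.left hh) hf)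
  refine ⟨hgG, fun x hx => ?_⟩
  exact (closed_stab X x hx g fun f hf => hg f (II_mono (cen_le_stab X x hx) hf)).2

theorem DD_C (a : Matrix (Fin n) (Fin n) k) (c : k) : DD a (MvPolynomial.C c) = 0 := by
  simp [DD]

theorem DD_actPoly {G : AlgGroup k} {m : ℕ} (X : GVariety G m) (x : Fin m → k) (hx : x ∈ X.carrier)
    (F : Fin m → QQ k G.n) (hF : ∀ g ∈ G.toSubgroup, ∀ i, MvPolynomial.eval (pt g) (F i) = X.act g x i)
    {v : Matrix (Fin G.n) (Fin G.n) k} (hv : v ∈ LieK (stabG X x hx)) (i : Fin m) :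
    DD v (F i) ∈ II G.toSubgroup := by
  intro g hg
  have h := hv (LL g (F i) - MvPolynomial.C (X.act g x i)) (by
    intro h hh
    rw [map_sub, eval_LL, hF _ (G.toSubgroup.mul_mem hg hh.1), MvPolynomial.eval_C,
      X.act_mul g hg h hh.1 x hx, hh.2, sub_self])
  rwa [map_sub, DD_C, sub_zero, DD_LL, eval_LL, mul_one] at h

/-! polynomials and limits -/

theorem poly_zero_of_units [Infinite k] (p : Polynomial k) (h : ∀ t : kˣ, p.eval (t : k) = 0) : p = 0 := by
  have : p * Polynomial.X = 0 := by
    apply Polynomial.funext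
    intro t
    rw [Polynomial.eval_mul, Polynomial.eval_X, Polynomial.eval_zero]
    by_cases ht : t = 0
    · rw [ht, mul_zero]
    · rw [show p.eval t = 0 from h (Units.mk0 t ht), zero_mul]
  exact (mul_eq_zero.1 this).resolve_right Polynomial.X_ne_zero

theorem closed_limit [Infinite k] {m : ℕ} (S : Set (Fin m → k)) (hS : IsZClosed S)
    (q : Fin m → Polynomial k) (h : ∀ t : kˣ, (fun i => (q i).eval (t : k)) ∈ S) :
    (fun i => (q i).eval 0) ∈ S := by
  obtain ⟨I, rfl⟩ := hS
  intro f hf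
  have e : ∀ t : k, (MvPolynomial.aeval q f : Polynomial k).eval t =
      MvPolynomial.eval (fun i => (q i).eval t) f := by
    intro t
    rw [← Polynomial.coe_evalRingHom, ← MvPolynomial.eval₂_id, MvPolynomial.eval₂_id]
    rw [MvPolynomial.aeval_def, MvPolynomial.hom_eval₂]
    rw [MvPolynomial.eval, MvPolynomial.coe_eval₂Hom]
    congr 1
    ext c; simp
  rw [← e, poly_zero_of_units (MvPolynomial.aeval q f : Polynomial k), Polynomial.eval_zero]
  intro t
  rw [e]
  exact h t f hf

theorem inLambda_of_poly [Infinite k] {G : AlgGroup k} {m : ℕ} (X : GVariety G m) (x : Fin m → k)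
    (hx : x ∈ X.carrier) (lam : OnePS G)
    (h : ∀ i, ∃ q : Polynomial k, ∀ t : kˣ, X.act (lam.toFun t) x i = q.eval (t : k)) :
    InLambda X x lam := by
  choose q hq using h
  refine ⟨fun i => (q i).eval 0, closed_limit _ X.closed q fun t => ?_, q, fun t i => hq i t, fun i => rfl⟩
  have : (fun i => (q i).eval (t : k)) = X.act (lam.toFun t) x := funext fun i => (hq i t).symm
  rw [this]
  exact X.act_mem _ (lam.mem t) x hx

def lamPS {G : AlgGroup k} (J : JD k G.n) (e : Fin G.n → ℤ) (h : ∀ t, J.lam e t ∈ G.toSubgroup) :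
    OnePS G where
  toFun := J.lam e
  mem := h
  regular := by
    refine ⟨fun ij => ∑ l, MvPolynomial.C (J.P.1 ij.1 l) *
      (if 0 ≤ e l then MvPolynomial.X true ^ (e l).toNat else MvPolynomial.X false ^ (-e l).toNat) *
      MvPolynomial.C ((J.P⁻¹).1 l ij.2), fun t ij => ?_⟩
    show (J.P.1 * (Matrix.diagonal fun i => ((t ^ e i : kˣ) : k)) * (J.P⁻¹).1) ij.1 ij.2 = _
    rw [Matrix.mul_apply, map_sum]
    refine Finset.sum_congr rfl fun l _ => ?_
    rw [Matrix.mul_diagonal, map_mul, map_mul, MvPolynomial.eval_C, MvPolynomial.eval_C]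
    congr 2
    by_cases hl : 0 ≤ e l
    · rw [if_pos hl, map_pow, MvPolynomial.eval_X, if_pos rfl, ← Units.val_pow_eq_pow_val]
      congr 1
      rw [← zpow_natCast, Int.toNat_of_nonneg hl]
    · rw [if_neg hl, map_pow, MvPolynomial.eval_X, if_neg (by simp), ← Units.val_pow_eq_pow_val]
      congr 1
      rw [← zpow_natCast, Int.toNat_of_nonneg (by omega), inv_zpow', neg_neg]

/-! finite dimensional stable subspaces -/

def Lsp (k : Type) [Field k] (n : ℕ) : Submodule k (QQ k n) :=
  Submodule.span k (insert 1 (Set.range MvPolynomial.X))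

theorem Lsp_fg (d : ℕ) : ((Lsp k n) ^ d).FG := by
  apply Submodule.FG.pow
  exact Submodule.fg_span ((Set.finite_range _).insert 1)

theorem one_mem_Lsp : (1 : QQ k n) ∈ Lsp k n := Submodule.subset_span (Set.mem_insert _ _)
theorem X_mem_Lsp (v : Vr n) : (MvPolynomial.X v : QQ k n) ∈ Lsp k n :=
  Submodule.subset_span (Set.mem_insert_of_mem _ ⟨v, rfl⟩)

theorem Lsp_mono {c d : ℕ} (h : c ≤ d) : (Lsp k n) ^ c ≤ (Lsp k n) ^ d := by
  obtain ⟨e, rfl⟩ := Nat.exists_eq_add_of_le h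
  intro f hf
  rw [pow_add]
  have := Submodule.mul_mem_mul hf (Submodule.pow_mem_pow (Lsp k n) one_mem_Lsp e)
  simpa using this

theorem exists_Lsp (f : QQ k n) : ∃ d, f ∈ (Lsp k n) ^ d := by
  induction f using MvPolynomial.induction_on with
  | C c => exact ⟨0, by rw [pow_zero]; exact Submodule.mem_one.2 ⟨c, rfl⟩⟩
  | add p q hp hq =>
    obtain ⟨a, ha⟩ := hp
    obtain ⟨b, hb⟩ := hq
    exact ⟨max a b, Submodule.add_mem _ (Lsp_mono (le_max_left a b) ha) (Lsp_mono (le_max_right a b) hb)⟩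
  | mul_X p v hp =>
    obtain ⟨a, ha⟩ := hp
    exact ⟨a + 1, by rw [pow_succ]; exact Submodule.mul_mem_mul ha (X_mem_Lsp v)⟩

theorem DD_Lsp (a : Matrix (Fin n) (Fin n) k) (d : ℕ) : ∀ f ∈ (Lsp k n) ^ d, DD a f ∈ (Lsp k n) ^ d := by
  have h1 : ∀ f ∈ Lsp k n, DD a f ∈ Lsp k n := by
    intro f hf
    induction hf using Submodule.span_induction with
    | mem f hf =>
      rcases hf with rfl | ⟨v, rfl⟩
      · simp
      · rcases v with p | u
        · rw [DD_X, Matrix.mul_apply]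
          refine Submodule.sum_mem _ fun l _ => ?_
          show XM k n p.1 l * MvPolynomial.C (a l p.2) ∈ _
          rw [mul_comm, ← MvPolynomial.smul_eq_C_mul]
          exact Submodule.smul_mem _ _ (X_mem_Lsp _)
        · rw [DD_Xr, ← MvPolynomial.smul_eq_C_mul]
          exact Submodule.smul_mem _ _ (X_mem_Lsp _)
    | zero => simp
    | add f g _ _ hf hg => rw [map_add]; exact Submodule.add_mem _ hf hg
    | smul c f _ hf => rw [Derivation.map_smul]; exact Submodule.smul_mem _ _ hf
  induction d with
  | zero =>
    intro f hf
    rw [pow_zero, Submodule.mem_one] at hf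
    obtain ⟨c, rfl⟩ := hf
    simp
  | succ d ih =>
    intro f hf
    rw [pow_succ] at hf ⊢
    induction hf using Submodule.mul_induction_on' with
    | mem_mul_mem f hf g hg =>
      rw [Derivation.leibniz, smul_eq_mul, smul_eq_mul, mul_comm g]
      exact Submodule.add_mem _ (Submodule.mul_mem_mul hf (h1 g hg)) (Submodule.mul_mem_mul (ih f hf) hg)
    | add f _ g _ hf hg => rw [map_add]; exact Submodule.add_mem _ hf hg

theorem sl2_local [CharZero k] {M : Type*} [AddCommGroup M] [Module k M] (U I : Submodule k M)
    (hU : U.FG) (N H Y : Module.End k M) (hNU : ∀ u ∈ U, N u ∈ U) (hHU : ∀ u ∈ U, H u ∈ U)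
    (hYU : ∀ u ∈ U, Y u ∈ U) (hNI : ∀ u ∈ I, N u ∈ I) (hHI : ∀ u ∈ I, H u ∈ I)
    (hYI : ∀ u ∈ I, Y u ∈ I) (h1 : ∀ u, N (Y u) - Y (N u) = H u)
    (h2 : ∀ u, H (N u) - N (H u) = (2 : k) • N u) (x : M) (hx : x ∈ U) (hxI : N x ∈ I) :
    ∃ r, prodH H x r ∈ I := by
  haveI : FiniteDimensional k U := Module.Finite.iff_fg.2 hU
  let I' : Submodule k U := I.comap U.subtype
  let q : (T : Module.End k M) → (∀ u ∈ U, T u ∈ U) → (∀ u ∈ I, T u ∈ I) → Module.End k (U ⧸ I') :=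
    fun T hU hI => I'.mapQ I' (T.restrict hU) (fun u hu => hI _ hu)
  have hq : ∀ T hU hI (u : U), q T hU hI (I'.mkQ u) = I'.mkQ ⟨T u, hU _ u.2⟩ := fun T hU hI u => rfl
  let N' := q N hNU hNI
  let H' := q H hHU hHI
  let Y' := q Y hYU hYI
  have e1 : N' * Y' - Y' * N' = H' := by
    apply LinearMap.ext
    intro z
    obtain ⟨u, rfl⟩ := I'.mkQ_surjective z
    rw [LinearMap.sub_apply, Module.End.mul_apply, Module.End.mul_apply, hq, hq, hq, hq, hq, ← map_sub]
    congr 1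
    exact Subtype.ext (h1 u)
  have e2 : H' * N' - N' * H' = 2 * N' := by
    rw [two_mul]
    apply LinearMap.ext
    intro z
    obtain ⟨u, rfl⟩ := I'.mkQ_surjective z
    rw [LinearMap.sub_apply, Module.End.mul_apply, Module.End.mul_apply, LinearMap.add_apply, hq, hq, hq, hq,
      ← map_sub, ← map_add]
    congr 1
    apply Subtype.ext
    show H (N u) - N (H u) = N u + N u
    rw [h2, two_smul]
  obtain ⟨r, hr⟩ := sl2_kill N' H' Y' e1 e2 (sl2_nil N' H' e2) (I'.mkQ ⟨x, hx⟩) (by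
    rw [hq, Submodule.mkQ_apply, Submodule.Quotient.mk_eq_zero]; exact hxI)
  refine ⟨r, ?_⟩
  have : ∀ r, ∃ h : prodH H x r ∈ U, prodH H' (I'.mkQ ⟨x, hx⟩) r = I'.mkQ ⟨prodH H x r, h⟩ := by
    intro r
    induction r with
    | zero => exact ⟨hx, rfl⟩
    | succ r ih =>
      obtain ⟨h, e⟩ := ih
      refine ⟨U.sub_mem (hHU _ h) (U.smul_mem _ h), ?_⟩
      rw [prodH, e, hq, ← map_smul, ← map_sub]
      rfl
  obtain ⟨h, e⟩ := this r
  rw [e, Submodule.mkQ_apply, Submodule.Quotient.mk_eq_zero] at hr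
  exact hr

theorem prodH_sum {M : Type*} [AddCommGroup M] [Module k M] (H : Module.End k M) (s : Finset k)
    (F : k → M) (r : ℕ) : prodH H (∑ w ∈ s, F w) r = ∑ w ∈ s, prodH H (F w) r := by
  induction r with
  | zero => rfl
  | succ r ih => simp only [prodH, ih, map_sum, Finset.smul_sum, Finset.sum_sub_distrib]

theorem maxGen_stable {M : Type*} [AddCommGroup M] [Module k M] (T : Module.End k M) (w : k) (f : M)
    (hf : f ∈ T.maxGenEigenspace w) : T f ∈ T.maxGenEigenspace w := by
  rw [Module.End.mem_maxGenEigenspace] at hf ⊢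
  obtain ⟨r, hr⟩ := hf
  refine ⟨r, ?_⟩
  have hc : Commute ((T - w • (1 : Module.End k M)) ^ r) T := by
    apply Commute.pow_left
    exact (Commute.refl T).sub_left ((Commute.one_left T).smul_left w)
  rw [← Module.End.mul_apply, hc.eq, Module.End.mul_apply, hr, map_zero]

theorem prodH_maxGen {M : Type*} [AddCommGroup M] [Module k M] (T : Module.End k M) (w : k) (f : M)
    (hf : f ∈ T.maxGenEigenspace w) (r : ℕ) : prodH T f r ∈ T.maxGenEigenspace w := by
  induction r with
  | zero => exact hf
  | succ r ih => exact Submodule.sub_mem _ (maxGen_stable T w _ ih) (Submodule.smul_mem _ _ ih)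

theorem mem_of_sub {M : Type*} [AddCommGroup M] [Module k M] (T : Module.End k M) (I : Submodule k M)
    (hT : ∀ u ∈ I, T u ∈ I) (w j : k) (hwj : w ≠ j) (f : M)
    (hf : f ∈ T.maxGenEigenspace w) (h : T f - j • f ∈ I) : f ∈ I := by
  rw [Module.End.mem_maxGenEigenspace] at hf
  obtain ⟨r, hr⟩ := hf
  have : ∀ r : ℕ, ((T - w • (1 : Module.End k M)) ^ r) f - (j - w) ^ r • f ∈ I := by
    intro r
    induction r with
    | zero => simp
    | succ r ih =>
      set g := ((T - w • (1 : Module.End k M)) ^ r) f with hg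
      have e : ((T - w • (1 : Module.End k M)) ^ (r + 1)) f - (j - w) ^ (r + 1) • f =
          T (g - (j - w) ^ r • f) - w • (g - (j - w) ^ r • f) + (j - w) ^ r • (T f - j • f) := by
        rw [pow_succ', Module.End.mul_apply, ← hg]
        simp only [LinearMap.sub_apply, LinearMap.smul_apply, Module.End.one_apply, map_sub, map_smul, smul_sub,
          pow_succ]
        module
      rw [e]
      exact I.add_mem (I.sub_mem (hT _ ih) (I.smul_mem _ ih)) (I.smul_mem _ h)
  have h2 := this r
  rw [hr, zero_sub, I.neg_mem_iff] at h2
  exact (I.smul_mem_iff (pow_ne_zero r (sub_ne_zero.2 hwj.symm))).1 h2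

theorem mem_of_prodH {M : Type*} [AddCommGroup M] [Module k M] (T : Module.End k M) (I : Submodule k M)
    (hT : ∀ u ∈ I, T u ∈ I) (w : k) (hw : ∀ j : ℕ, w ≠ j) (f : M)
    (hf : f ∈ T.maxGenEigenspace w) (r : ℕ) (h : prodH T f r ∈ I) : f ∈ I := by
  induction r with
  | zero => exact h
  | succ r ih => exact ih (mem_of_sub T I hT w r (hw r) _ (prodH_maxGen T w f hf r) h)

end geom

noncomputable section nilp
variable {n : ℕ}

theorem exists_den {ι : Type*} [Fintype ι] (q : ι → ℚ) : ∃ D : ℕ, 0 < D ∧ ∃ e : ι → ℤ, ∀ i, (D : ℚ) * q i = e i := by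
  classical
  refine ⟨∏ i, (q i).den, Finset.prod_pos fun i _ => (q i).den_pos, ?_⟩
  have : ∀ i, ∃ e : ℤ, ((∏ i, (q i).den : ℕ) : ℚ) * q i = e := by
    intro i
    obtain ⟨c, hc⟩ := Finset.dvd_prod_of_mem (fun i => (q i).den) (Finset.mem_univ i)
    refine ⟨(q i).num * c, ?_⟩
    rw [hc]
    push_cast
    have := Rat.mul_den_eq_num (q i)
    rw [← this]; ring
  choose e he using this
  exact ⟨e, he⟩

theorem exists_psi [CharZero k] (d : Fin n → k) : ∃ (ψ : k →+ ℚ) (e : Fin n → ℤ) (M : ℕ), 0 < M ∧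
    (∀ i, ψ (d i) = e i) ∧ ψ 1 = M := by
  obtain ⟨φ, hφ⟩ : ∃ φ : Module.Dual ℚ k, φ 1 ≠ 0 := by
    by_contra h
    push Not at h
    exact one_ne_zero ((Module.forall_dual_apply_eq_zero_iff ℚ (1 : k)).1 h)
  obtain ⟨D, hD, e, he⟩ := exists_den (fun i => (φ 1)⁻¹ * φ (d i))
  refine ⟨(((D : ℚ) * (φ 1)⁻¹) • φ).toAddMonoidHom, e, D, hD, fun i => ?_, ?_⟩
  · rw [← he]; simp [mul_assoc]
  · simp [mul_assoc, hφ]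

/-- eigenvectors of `ad h` are eigenvectors of the semisimple part -/
theorem JD.ad_eig (J : JD k n) (c : k) (u : Matrix (Fin n) (Fin n) k)
    (h : (Matrix.diagonal J.d + J.nu) * u - u * (Matrix.diagonal J.d + J.nu) = c • u) (i j : Fin n)
    (hij : u i j ≠ 0) : J.d i - J.d j = c := by
  let A : Module.End k (Matrix (Fin n) (Fin n) k) :=
    LinearMap.mulLeft k (Matrix.diagonal J.d) - LinearMap.mulRight k (Matrix.diagonal J.d) - c • 1
  let B : Module.End k (Matrix (Fin n) (Fin n) k) :=
    LinearMap.mulLeft k J.nu - LinearMap.mulRight k J.nu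
  have hA : ∀ z, A z = Matrix.diagonal J.d * z - z * Matrix.diagonal J.d - c • z := fun z => rfl
  have hB : ∀ z, B z = J.nu * z - z * J.nu := fun z => rfl
  have hcomm : Commute A B := by
    apply LinearMap.ext
    intro z
    rw [Module.End.mul_apply, Module.End.mul_apply, hA, hB, hB, hA]
    have e1 : ∀ y, Matrix.diagonal J.d * (J.nu * y) = J.nu * (Matrix.diagonal J.d * y) := by
      intro y; rw [← Matrix.mul_assoc, J.comm, Matrix.mul_assoc]
    simp only [mul_sub, sub_mul, mul_smul_comm, smul_mul_assoc, smul_sub, e1, Matrix.mul_assoc, J.comm]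
    abel
  have hBn : IsNilpotent B := by
    apply Commute.isNilpotent_sub
    · exact LinearMap.commute_mulLeft_right _ _
    · exact (LinearMap.isNilpotent_mulLeft_iff k _).2 J.nil
    · exact (LinearMap.isNilpotent_mulRight_iff k _).2 J.nil
  have hAB : A u = (-B) u := by
    rw [LinearMap.neg_apply, hA, hB, ← h]
    noncomm_ring
  have hcomm' : Commute A (-B) := hcomm.neg_right
  have hpow : ∀ r : ℕ, (A ^ r) u = ((-B) ^ r) u := by
    intro r
    induction r with
    | zero => rfl
    | succ r ih =>
      rw [pow_succ, Module.End.mul_apply, hAB, ← Module.End.mul_apply, (hcomm'.pow_left r).eq,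
        Module.End.mul_apply, ih, pow_succ' (-B), Module.End.mul_apply]
  have hent : ∀ r : ℕ, (A ^ r) u i j = (J.d i - J.d j - c) ^ r * u i j := by
    intro r
    induction r with
    | zero => simp
    | succ r ih =>
      rw [pow_succ', Module.End.mul_apply, hA]
      rw [Matrix.sub_apply, Matrix.sub_apply, Matrix.diagonal_mul, Matrix.mul_diagonal, Matrix.smul_apply, ih,
        smul_eq_mul]
      ring
  obtain ⟨r, hr⟩ := hBn.neg
  have h0 := hent r
  rw [hpow, hr, LinearMap.zero_apply, Matrix.zero_apply] at h0
  have h1 := (mul_eq_zero.1 h0.symm).resolve_right hij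
  exact sub_eq_zero.1 (IsReduced.eq_zero _ ⟨r, h1⟩)

theorem JD.cj_inj (J : JD k n) {a b : Matrix (Fin n) (Fin n) k} (h : J.cj a = J.cj b) : a = b := by
  have h2 : (J.P⁻¹).1 * (J.cj a * J.P.1) = (J.P⁻¹).1 * (J.cj b * J.P.1) := by rw [h]
  rwa [J.cj_mul_P, J.cj_mul_P, ← Matrix.mul_assoc, ← Matrix.mul_assoc, J.PP', Matrix.one_mul, Matrix.one_mul] at h2

theorem JD.lam_conj [CharZero k] (J : JD k n) (v : Matrix (Fin n) (Fin n) k)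
    (h : J.a * v - v * J.a = 2 * v) (ψ : k →+ ℚ) (e : Fin n → ℤ) (M : ℕ)
    (he : ∀ i, ψ (J.d i) = e i) (hM : ψ 1 = M) (t : kˣ) :
    (J.lam e t).1 * v * ((J.lam e t)⁻¹).1 = ((t : k) ^ (2 * M)) • v := by
  let u := (J.P⁻¹).1 * v * J.P.1
  have hv : v = J.cj u := by
    show v = J.P.1 * ((J.P⁻¹).1 * v * J.P.1) * (J.P⁻¹).1
    calc v = (J.P.1 * (J.P⁻¹).1) * v * (J.P.1 * (J.P⁻¹).1) := by rw [J.PP, Matrix.one_mul, Matrix.mul_one]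
      _ = _ := by simp only [Matrix.mul_assoc]
  have hu : (Matrix.diagonal J.d + J.nu) * u - u * (Matrix.diagonal J.d + J.nu) = (2 : k) • u := by
    apply J.cj_inj
    have e2 : ∀ a b, J.cj (a - b) = J.cj a - J.cj b := by
      intro a b; simp [JD.cj, mul_sub, sub_mul]
    rw [e2, ← J.cj_mul _ u, ← J.cj_mul u, J.cj_smul, ← hv, two_smul, ← two_mul]
    exact h
  rw [← map_inv]
  show J.cj (Matrix.diagonal fun i => ((t ^ e i : kˣ) : k)) * v *
    J.cj (Matrix.diagonal fun i => ((t⁻¹ ^ e i : kˣ) : k)) = _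
  rw [hv, J.cj_mul, J.cj_mul, ← J.cj_smul]
  congr 1
  apply Matrix.ext
  intro i j
  rw [Matrix.mul_diagonal, Matrix.diagonal_mul, Matrix.smul_apply, smul_eq_mul]
  by_cases hij : u i j = 0
  · rw [hij]; ring
  · have hd := J.ad_eig 2 u hu i j hij
    have h2 : e i - e j = (2 * M : ℕ) := by
      have h3 := congrArg ψ hd
      rw [map_sub, he, he, show (2 : k) = 1 + 1 by norm_num, map_add, hM] at h3
      have : ((e i - e j : ℤ) : ℚ) = ((2 * M : ℕ) : ℤ) := by push_cast; linarith
      exact_mod_cast this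
    have h4 : t ^ e i * t⁻¹ ^ e j = t ^ (2 * M) := by
      rw [inv_zpow, ← zpow_neg, ← zpow_add, ← sub_eq_add_neg, h2, zpow_natCast]
    rw [mul_right_comm, ← Units.val_mul, h4, Units.val_pow_eq_pow_val]

theorem nil_mem_cen [CharZero k] [IsAlgClosed k] (G : AlgGroup k) (hG : IsReductive G)
    {m : ℕ} (X : GVariety G m) (x : Fin m → k) (hx : x ∈ X.carrier) (hst : OnePSStable X x)
    (v : Matrix (Fin G.n) (Fin G.n) k) (hv : v ∈ LieK (stabG X x hx)) (hnil : IsNilpotent v) :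
    v ∈ LieK (cenG X) := by
  have hvG := LieK_mono (stab_le X x hx) hv
  obtain ⟨y, hy, h, hh, h1, h2⟩ := jacobson_morozov G hG v hvG hnil
  obtain ⟨J, rfl⟩ := JD.exists_JD h
  obtain ⟨ψ, e, M, hM0, he, hM⟩ := exists_psi J.d
  obtain ⟨F, hF⟩ := exists_actPoly X x hx
  have hlG : ∀ t, J.lam e t ∈ G.toSubgroup := fun t => J.lam_mem (closedK_alg G) hh ψ e he t
  let lam := lamPS J e hlG
  let IG : Submodule k (QQ k G.n) := (II G.toSubgroup).restrictScalars k
  have hkill : ∀ i, ∃ r, prodH (DD J.a).toLinearMap (F i) r ∈ IG := by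
    intro i
    obtain ⟨d, hd⟩ := exists_Lsp (F i)
    refine sl2_local ((Lsp k G.n) ^ d) IG (Lsp_fg d) (DD v).toLinearMap (DD J.a).toLinearMap (DD y).toLinearMap
      (DD_Lsp v d) (DD_Lsp J.a d) (DD_Lsp y d) (fun u hu => DD_mem_II hvG hu) (fun u hu => DD_mem_II hh hu)
      (fun u hu => DD_mem_II hy hu) ?_ ?_ (F i) hd (DD_actPoly X x hx F hF hv i)
    · intro u
      show DD v (DD y u) - DD y (DD v u) = DD J.a u
      rw [← h1, DD_lie, Derivation.commutator_apply]
    · intro u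
      show DD J.a (DD v u) - DD v (DD J.a u) = (2 : k) • DD v u
      rw [← Derivation.commutator_apply, ← DD_lie, h2, two_mul, DD_add, two_smul]
      rfl
  have hlam : InLambda X x lam := by
    apply inLambda_of_poly X x hx
    intro i
    obtain ⟨s, Fw, hFw, hR, hs⟩ := J.weights ψ e he (F i)
    obtain ⟨r, hr⟩ := hkill i
    rw [hs, prodH_sum] at hr
    have hc := spec_comp (DD J.a).toLinearMap IG (fun f hf => DD_mem_II hh hf) s
      (fun w => prodH (DD J.a).toLinearMap (Fw w) r) (fun w _ => prodH_maxGen _ w _ (hFw w) r) hr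
    have hbad : ∀ w ∈ s, (∀ j : ℕ, w ≠ j) → Fw w ∈ IG := fun w hw hj =>
      mem_of_prodH _ IG (fun f hf => DD_mem_II hh hf) w hj _ (hFw w) r (hc w hw)
    have hterm : ∀ w ∈ s, ∃ p : Polynomial k, ∀ t : kˣ,
        MvPolynomial.eval (pt (1 : GL (Fin G.n) k)) (RR (J.lam e t) (Fw w)) = p.eval (t : k) := by
      intro w hw
      by_cases h0 : Fw w = 0
      · exact ⟨0, fun t => by rw [h0]; simp⟩
      by_cases hj : ∀ j : ℕ, w ≠ j
      · refine ⟨0, fun t => ?_⟩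
        have : RR (J.lam e t) (Fw w) ∈ II G.toSubgroup := RR_mem_II (hbad w hw hj) (hlG t)
        rw [this 1 G.toSubgroup.one_mem, Polynomial.eval_zero]
      · push Not at hj
        obtain ⟨j, rfl⟩ := hj
        obtain ⟨mm, hm1, hm2⟩ := hR _ hw h0
        have hmm : mm = ((j * M : ℕ) : ℤ) := by
          have e3 : ψ ((j : k)) = j * M := by
            rw [← hM, ← nsmul_eq_mul, ← map_nsmul, nsmul_one]
          rw [e3] at hm1
          exact_mod_cast hm1.symm
        refine ⟨Polynomial.C (MvPolynomial.eval (pt (1 : GL (Fin G.n) k)) (Fw j)) * Polynomial.X ^ (j * M),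
          fun t => ?_⟩
        rw [hm2 t, hmm, zpow_natCast, Units.val_pow_eq_pow_val, MvPolynomial.smul_eval]
        rw [Polynomial.eval_mul, Polynomial.eval_C, Polynomial.eval_pow, Polynomial.eval_X, mul_comm]
    choose! p hp using hterm
    refine ⟨∑ w ∈ s, p w, fun t => ?_⟩
    show X.act (J.lam e t) x i = _
    rw [← hF _ (hlG t) i, hs, ← one_mul (J.lam e t), ← eval_RR, map_sum, map_sum, Polynomial.eval_finset_sum]
    exact Finset.sum_congr rfl fun w hw => hp w hw t
  have hcen : ∀ t, J.lam e t ∈ cenG X := by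
    by_contra hcon
    exact hst.2 lam hcon hlam
  obtain ⟨t0, ht0⟩ := IsAlgClosed.exists_pow_nat_eq (2 : k) (show 0 < 2 * M by omega)
  have ht00 : t0 ≠ 0 := by
    rintro rfl
    rw [zero_pow (by omega)] at ht0
    exact two_ne_zero ht0.symm
  let t : kˣ := Units.mk0 t0 ht00
  apply mem_LieK_of_exG hnil
  intro c
  have hconj := exG_conj (J.lam e t) (c • v) (hnil.smul c) (by
    rw [mul_smul_comm, smul_mul_assoc, J.lam_conj v h2 ψ e M he hM]; exact (hnil.smul _).smul _)
  have e5 : (J.lam e t).1 * (c • v) * ((J.lam e t)⁻¹).1 = (2 : k) • (c • v) := by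
    rw [mul_smul_comm, smul_mul_assoc, J.lam_conj v h2 ψ e M he hM, smul_comm]
    congr 1
  rw [exG_congr e5 _ ((hnil.smul c).smul 2)] at hconj
  have e6 : exG ((2 : k) • (c • v)) ((hnil.smul c).smul 2) = exG (c • v) (hnil.smul c) * exG (c • v) (hnil.smul c) := by
    apply Units.ext
    show IsNilpotent.exp ((2 : k) • (c • v)) = IsNilpotent.exp (c • v) * IsNilpotent.exp (c • v)
    rw [two_smul, IsNilpotent.exp_add_of_commute (Commute.refl _) (hnil.smul c) (hnil.smul c)]
  have hxG : exG (c • v) (hnil.smul c) ∈ G.toSubgroup :=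
    exG_mem (closedK_alg G) _ (Submodule.smul_mem _ _ hvG)
  rw [e6] at hconj
  set E := exG (c • v) (hnil.smul c) with hE
  have : E = J.lam e t * (E * (J.lam e t)⁻¹ * E⁻¹) := by
    rw [← mul_assoc, ← mul_assoc, hconj, mul_inv_cancel_right]
  rw [this]
  exact (cenG X).mul_mem (hcen t) (cenG_conj X hxG ((cenG X).inv_mem (hcen t)))

theorem LieK_stab_le [CharZero k] [IsAlgClosed k] (G : AlgGroup k) (hG : IsReductive G)
    {m : ℕ} (X : GVariety G m) (x : Fin m → k) (hx : x ∈ X.carrier) (hst : OnePSStable X x) :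
    LieK (stabG X x hx) ≤ LieK (cenG X) := by
  classical
  intro a ha
  obtain ⟨J, rfl⟩ := JD.exists_JD a
  have hsplit : J.a = J.ss J.d + J.cj J.nu := by rw [JD.a, J.cj_add]; rfl
  have hs : J.ss J.d ∈ LieK (stabG X x hx) := J.replica ha (AddMonoidHom.id k)
  have hn : J.cj J.nu ∈ LieK (stabG X x hx) := by
    have : J.cj J.nu = J.a - J.ss J.d := by rw [hsplit]; abel
    rw [this]; exact Submodule.sub_mem _ ha hs
  have hn2 := nil_mem_cen G hG X x hx hst _ hn (J.nil_cj J.nil)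
  have hψ : ∀ φ : Module.Dual ℚ k, J.ss (fun i => algebraMap ℚ k (φ (J.d i))) ∈ LieK (cenG X) := by
    intro φ
    obtain ⟨D, hD, e, he⟩ := exists_den (fun i => φ (J.d i))
    let ψ : k →+ ℚ := ((D : ℚ) • φ).toAddMonoidHom
    have hψe : ∀ i, ψ (J.d i) = e i := fun i => by rw [← he]; rfl
    have hl : ∀ t, J.lam e t ∈ stabG X x hx := fun t => J.lam_mem (closed_stab X x hx) ha ψ e hψe t
    have hlG : ∀ t, J.lam e t ∈ G.toSubgroup := fun t => (hl t).1
    have hcen : ∀ t, J.lam e t ∈ cenG X := by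
      by_contra hcon
      refine hst.2 (lamPS J e hlG) hcon (inLambda_of_poly X x hx _ fun i => ⟨Polynomial.C (x i), fun t => ?_⟩)
      rw [Polynomial.eval_C]
      exact congrFun (hl t).2 i
    have h1 := J.ss_mem_of_lam e hcen
    have h2 : J.ss (fun i => algebraMap ℚ k (φ (J.d i))) = ((D : k)⁻¹) • J.ss (fun i => (e i : k)) := by
      rw [JD.ss, JD.ss, ← J.cj_smul, ← Matrix.diagonal_smul]
      congr 2
      funext i
      have hDk : (D : k) ≠ 0 := Nat.cast_ne_zero.2 hD.ne'
      have h3 : (D : k) * algebraMap ℚ k (φ (J.d i)) = (e i : k) := by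
        have := congrArg (algebraMap ℚ k) (he i)
        rw [map_mul, map_natCast, map_intCast] at this
        exact this
      rw [Pi.smul_apply, smul_eq_mul, ← h3, inv_mul_cancel_left₀ hDk]
    rw [h2]; exact Submodule.smul_mem _ _ h1
  rw [hsplit]
  refine Submodule.add_mem _ ?_ hn2
  let b := Module.Basis.ofVectorSpace ℚ k
  let S : Finset _ := Finset.univ.biUnion (fun i => (b.repr (J.d i)).support)
  have hd : ∀ i, J.d i = ∑ β ∈ S, b β * algebraMap ℚ k (b.coord β (J.d i)) := by
    intro i
    conv_lhs => rw [← b.linearCombination_repr (J.d i), Finsupp.linearCombination_apply,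
      Finsupp.sum_of_support_subset (s := S) _ (Finset.subset_biUnion_of_mem (fun i => (b.repr (J.d i)).support) (Finset.mem_univ i)) _ (by simp)]
    refine Finset.sum_congr rfl fun β _ => ?_
    rw [Algebra.smul_def, mul_comm]; rfl
  have : J.ss J.d = ∑ β ∈ S, (b β : k) • J.ss (fun i => algebraMap ℚ k (b.coord β (J.d i))) := by
    have lin : ∀ (c : k) (f : Fin G.n → k), c • J.ss f = J.ss (c • f) := by
      intro c f; rw [JD.ss, JD.ss, ← J.cj_smul, ← Matrix.diagonal_smul]
    have addl : ∀ f g : Fin G.n → k, J.ss (f + g) = J.ss f + J.ss g := by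
      intro f g; rw [JD.ss, JD.ss, JD.ss, ← J.cj_add, Matrix.diagonal_add]; rfl
    let ssh : (Fin G.n → k) →+ Matrix (Fin G.n) (Fin G.n) k := AddMonoidHom.mk' J.ss addl
    have hssh : ∀ f, ssh f = J.ss f := fun f => rfl
    rw [Finset.sum_congr rfl fun β _ => lin (b β) _, ← hssh,
      Finset.sum_congr rfl fun β _ => (hssh (b β • fun i => algebraMap ℚ k (b.coord β (J.d i)))).symm, ← map_sum]
    congr 1
    funext i
    rw [hd i, Finset.sum_apply]; rfl
  rw [this]
  exact Submodule.sum_mem _ fun β _ => Submodule.smul_mem _ _ (hψ _)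

end nilp

noncomputable section cosetsA
variable {n : ℕ}

/-- evaluation at the identity -/
def ev1 (k : Type) [Field k] (n : ℕ) : QQ k n →+* k := MvPolynomial.eval (pt (1 : GL (Fin n) k))

/-- maximal ideal of the identity -/
def mm (k : Type) [Field k] (n : ℕ) : Ideal (QQ k n) := RingHom.ker (ev1 k n)

theorem mem_mm {f : QQ k n} : f ∈ mm k n ↔ ev1 k n f = 0 := RingHom.mem_ker

theorem ev1_C (c : k) : ev1 k n (MvPolynomial.C c) = c := by simp [ev1]

theorem ev1_Xl (p : Fin n × Fin n) :
    ev1 k n (MvPolynomial.X (Sum.inl p)) = (1 : Matrix (Fin n) (Fin n) k) p.1 p.2 := by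
  simp [ev1, pt, mat2pt]

theorem ev1_Xr (u : Unit) : ev1 k n (MvPolynomial.X (Sum.inr u)) = 1 := by
  simp [ev1, pt]

theorem II_le_mm (H : Subgroup (GL (Fin n) k)) : II H ≤ mm k n :=
  fun f hf => hf 1 H.one_mem

theorem det_mem_II (H : Subgroup (GL (Fin n) k)) :
    MvPolynomial.X (Sum.inr ()) * (XM k n).det - 1 ∈ II H := by
  intro g _
  rw [map_sub, map_mul, RingHom.map_det, map_one, MvPolynomial.eval_X]
  have : (MvPolynomial.eval (pt g)).mapMatrix (XM k n) = g.1 := by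
    ext i j; simp [XM, pt, mat2pt]
  rw [this]
  show ((g⁻¹).1).det * g.1.det - 1 = 0
  rw [← Matrix.det_mul, ← Units.val_mul, inv_mul_cancel]; simp

/-- point derivations -/
structure PDer (D : QQ k n →ₗ[k] k) : Prop where
  leib : ∀ f g, D (f * g) = ev1 k n f * D g + ev1 k n g * D f
  cst : ∀ c, D (MvPolynomial.C c) = 0

theorem PDer.ext' {D E : QQ k n →ₗ[k] k} (hD : PDer D) (hE : PDer E)
    (h : ∀ v, D (MvPolynomial.X v) = E (MvPolynomial.X v)) (f : QQ k n) : D f = E f := by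
  induction f using MvPolynomial.induction_on with
  | C c => rw [hD.cst, hE.cst]
  | add p q hp hq => rw [map_add, map_add, hp, hq]
  | mul_X p v hp => rw [hD.leib, hE.leib, hp, h]

def evDD (a : Matrix (Fin n) (Fin n) k) : QQ k n →ₗ[k] k where
  toFun f := ev1 k n (DD a f)
  map_add' f g := by rw [map_add, map_add]
  map_smul' c f := by
    rw [Derivation.map_smul, MvPolynomial.smul_eq_C_mul, map_mul, ev1_C]; rfl

theorem evDD_apply (a : Matrix (Fin n) (Fin n) k) (f : QQ k n) : evDD a f = ev1 k n (DD a f) := rfl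

theorem evDD_pder (a : Matrix (Fin n) (Fin n) k) : PDer (evDD a) where
  leib f g := by
    rw [evDD_apply, Derivation.leibniz, map_add, smul_eq_mul, smul_eq_mul, map_mul, map_mul]; rfl
  cst c := by rw [evDD_apply, DD_C, map_zero]

theorem evDD_X (a : Matrix (Fin n) (Fin n) k) (p : Fin n × Fin n) :
    evDD a (MvPolynomial.X (Sum.inl p)) = a p.1 p.2 := by
  rw [evDD_apply, DD_X, Matrix.mul_apply, map_sum]
  have : ∀ j, ev1 k n (XM k n p.1 j * cM a j p.2) = (1 : Matrix (Fin n) (Fin n) k) p.1 j * a j p.2 := by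
    intro j
    rw [map_mul]
    congr 1
    · exact ev1_Xl (p.1, j)
    · exact ev1_C _
  rw [Finset.sum_congr rfl fun j _ => this j, ← Matrix.mul_apply, one_mul]

theorem evDD_Xr (a : Matrix (Fin n) (Fin n) k) :
    evDD a (MvPolynomial.X (Sum.inr ())) = - a.trace := by
  rw [evDD_apply, DD_Xr, map_mul, ev1_C, ev1_Xr, mul_one]

theorem PDer.one {D : QQ k n →ₗ[k] k} (hD : PDer D) : D 1 = 0 := by
  rw [← MvPolynomial.C_1, hD.cst]

theorem PDer.det {D : QQ k n →ₗ[k] k} (hD : PDer D) :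
    D (XM k n).det = ∑ i, D (MvPolynomial.X (Sum.inl (i, i))) := by
  let M : Matrix (Fin n) (Fin n) k := Matrix.of fun i j => D (MvPolynomial.X (Sum.inl (i, j)))
  let w : Vr n → Polynomial k := Sum.elim
    (fun p => Polynomial.C ((1 : Matrix (Fin n) (Fin n) k) p.1 p.2) + Polynomial.X * Polynomial.C (M p.1 p.2))
    (fun _ => 1 + Polynomial.X * Polynomial.C (D (MvPolynomial.X (Sum.inr ()))))
  let Φ : QQ k n →ₐ[k] Polynomial k := MvPolynomial.aeval w
  have hΦ : ∀ f, ev1 k n f = (Φ f).eval 0 ∧ D f = (Polynomial.derivative (Φ f)).eval 0 := by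
    intro f
    induction f using MvPolynomial.induction_on with
    | C c =>
      rw [ev1_C, hD.cst, MvPolynomial.algHom_C]
      simp
    | add p q hp hq =>
      simp only [map_add, Polynomial.eval_add, hp.1, hp.2, hq.1, hq.2, and_self]
    | mul_X p v hp =>
      have hv : ev1 k n (MvPolynomial.X v) = (Φ (MvPolynomial.X v)).eval 0 ∧
          D (MvPolynomial.X v) = (Polynomial.derivative (Φ (MvPolynomial.X v))).eval 0 := by
        rcases v with p | u
        · rw [ev1_Xl]; simp [Φ, w, M]
        · rw [ev1_Xr]; simp [Φ, w, M]
      rw [hD.leib, map_mul, map_mul, Polynomial.eval_mul, Polynomial.derivative_mul,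
        Polynomial.eval_add, Polynomial.eval_mul, Polynomial.eval_mul, hp.1, hp.2, hv.1, hv.2]
      exact ⟨rfl, by ring⟩
  rw [(hΦ _).2, AlgHom.map_det]
  have : Φ.mapMatrix (XM k n) = 1 + (Polynomial.X : Polynomial k) • M.map Polynomial.C := by
    ext1 i j
    simp only [AlgHom.mapMatrix_apply, Matrix.map_apply, XM, Matrix.of_apply, Matrix.add_apply,
      Matrix.smul_apply, smul_eq_mul]
    rw [MvPolynomial.aeval_X]
    show Polynomial.C ((1 : Matrix (Fin n) (Fin n) k) i j) + _ = _
    congr 1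
    by_cases h : i = j
    · subst h; simp
    · simp [h]
  rw [this, Matrix.derivative_det_one_add_X_smul]
  rfl

theorem PDer.eq_DD {D : QQ k n →ₗ[k] k} (hD : PDer D) (H : Subgroup (GL (Fin n) k))
    (hI : ∀ f ∈ II H, D f = 0) : ∃ a ∈ LieK H, ∀ f, D f = ev1 k n (DD a f) := by
  let M : Matrix (Fin n) (Fin n) k := Matrix.of fun i j => D (MvPolynomial.X (Sum.inl (i, j)))
  have hd := hI _ (det_mem_II H)
  have e : ∀ f, D f = evDD M f := by
    refine hD.ext' (evDD_pder M) ?_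
    rintro (p | u)
    · rw [evDD_X]; rfl
    · rw [evDD_Xr]
      rw [map_sub, hD.one, sub_zero, hD.leib, ev1_Xr, one_mul, hD.det] at hd
      have : ev1 k n (XM k n).det = 1 := by
        have := II_le_mm H (det_mem_II H)
        rw [mem_mm, map_sub, map_mul, ev1_Xr, one_mul, map_one] at this
        exact sub_eq_zero.1 this
      rw [this, one_mul] at hd
      exact eq_neg_of_add_eq_zero_right hd
  refine ⟨M, fun f hf => ?_, e⟩
  exact (e f).symm.trans (hI f hf)

theorem claimA (H : Subgroup (GL (Fin n) k)) (g : QQ k n) (hg : ev1 k n g = 0)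
    (h : ∀ a ∈ LieK H, ev1 k n (DD a g) = 0) : g ∈ mm k n ^ 2 ⊔ II H := by
  by_contra hn
  obtain ⟨l, hl, hle⟩ := Submodule.exists_le_ker_of_notMem
    (p := (mm k n ^ 2 ⊔ II H).restrictScalars k) (v := g) hn
  have hl0 : ∀ f ∈ mm k n ^ 2 ⊔ II H, l f = 0 := fun f hf => hle hf
  let D : QQ k n →ₗ[k] k :=
    { toFun := fun f => l (f - MvPolynomial.C (ev1 k n f))
      map_add' := by
        intro f g
        rw [← map_add]; congr 1
        rw [map_add, map_add]; ring
      map_smul' := by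
        intro c f
        rw [RingHom.id_apply, ← map_smul]; congr 1
        rw [MvPolynomial.smul_eq_C_mul, MvPolynomial.smul_eq_C_mul, map_mul, ev1_C, map_mul]; ring }
  have hDa : ∀ f, D f = l (f - MvPolynomial.C (ev1 k n f)) := fun f => rfl
  have hm : ∀ f : QQ k n, f - MvPolynomial.C (ev1 k n f) ∈ mm k n := by
    intro f; rw [mem_mm, map_sub, ev1_C, sub_self]
  have hD : PDer D := by
    constructor
    · intro f g
      have : f * g - MvPolynomial.C (ev1 k n (f * g)) =
          (f - MvPolynomial.C (ev1 k n f)) * (g - MvPolynomial.C (ev1 k n g)) +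
          (ev1 k n f • (g - MvPolynomial.C (ev1 k n g)) +
            ev1 k n g • (f - MvPolynomial.C (ev1 k n f))) := by
        rw [MvPolynomial.smul_eq_C_mul, MvPolynomial.smul_eq_C_mul, map_mul, map_mul]; ring
      rw [hDa, this, map_add, hl0 _ (Ideal.mem_sup_left (by rw [pow_two]; exact Ideal.mul_mem_mul (hm f) (hm g))),
        zero_add, map_add, map_smul, map_smul]
      rfl
    · intro c; rw [hDa, ev1_C, sub_self, map_zero]
  obtain ⟨a, ha, haD⟩ := hD.eq_DD H (by
    intro f hf
    rw [hDa, mem_mm.1 (II_le_mm H hf), map_zero, sub_zero]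
    exact hl0 _ (Ideal.mem_sup_right hf))
  apply hl
  have := haD g
  rw [h a ha, hDa, hg, map_zero, sub_zero] at this
  exact this

end cosetsA

noncomputable section cosetsB
variable {n : ℕ}

theorem mul_mem_pow_sup (I : Ideal (QQ k n)) {r s : ℕ} {x y : QQ k n} (hx : x ∈ mm k n ^ r)
    (hy : y ∈ mm k n ^ s ⊔ I) : x * y ∈ mm k n ^ (r + s) ⊔ I := by
  obtain ⟨u, hu, v, hv, rfl⟩ := Submodule.mem_sup.1 hy
  rw [mul_add, pow_add]
  exact Ideal.add_mem _ (Ideal.mem_sup_left (Ideal.mul_mem_mul hx hu))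
    (Ideal.mem_sup_right (Ideal.mul_mem_left _ _ hv))

/-- displaced coordinates -/
def dX (p : Fin n × Fin n) : QQ k n :=
  MvPolynomial.X (Sum.inl p) - MvPolynomial.C ((1 : Matrix (Fin n) (Fin n) k) p.1 p.2)

theorem dX_mem (p : Fin n × Fin n) : dX p ∈ mm k n := by
  rw [mem_mm, dX, map_sub, ev1_Xl, ev1_C, sub_self]

theorem evDD_dX (a : Matrix (Fin n) (Fin n) k) (p : Fin n × Fin n) :
    ev1 k n (DD a (dX p)) = a p.1 p.2 := by
  rw [dX, map_sub, DD_C, sub_zero]; exact evDD_X a p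

/-- Euler derivation -/
def EE (b : Fin n × Fin n → Matrix (Fin n) (Fin n) k) : Derivation k (QQ k n) (QQ k n) :=
  ∑ p, (dX p : QQ k n) • DD (b p)

theorem EE_apply (b : Fin n × Fin n → Matrix (Fin n) (Fin n) k) (f : QQ k n) :
    EE b f = ∑ p, dX p * DD (b p) f := by
  have : EE b f = Derivation.coeFnAddMonoidHom (EE b) f := rfl
  rw [this, EE, map_sum, Finset.sum_apply]
  rfl

theorem exists_Euler (H : Subgroup (GL (Fin n) k)) :
    ∃ b : Fin n × Fin n → Matrix (Fin n) (Fin n) k, (∀ p, b p ∈ LieK H) ∧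
      ∀ a ∈ LieK H, a = ∑ p, a p.1 p.2 • b p := by
  obtain ⟨P, hP⟩ := LinearMap.exists_leftInverse_of_injective (LieK H).subtype
    (LinearMap.ker_eq_bot.2 (Submodule.injective_subtype _))
  refine ⟨fun p => (P (Matrix.single p.1 p.2 1)).1, fun p => (P _).2, fun a ha => ?_⟩
  have h1 : P a = ⟨a, ha⟩ := LinearMap.congr_fun hP ⟨a, ha⟩
  have h2 : a = ∑ p : Fin n × Fin n, a p.1 p.2 • Matrix.single p.1 p.2 (1 : k) := by
    conv_lhs => rw [Matrix.matrix_eq_sum_single a]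
    rw [Fintype.sum_prod_type]
    simp [Matrix.smul_single]
  have h3 := congrArg (fun z => ((P z : LieK H) : Matrix (Fin n) (Fin n) k)) h2
  simp only [h1, map_sum, map_smul] at h3
  refine h3.trans ?_
  simp

theorem EE_base (H : Subgroup (GL (Fin n) k)) (b : Fin n × Fin n → Matrix (Fin n) (Fin n) k)
    (hb2 : ∀ a ∈ LieK H, a = ∑ p, a p.1 p.2 • b p)
    (g : QQ k n) (hg : g ∈ mm k n) : EE b g - g ∈ mm k n ^ 2 ⊔ II H := by
  apply claimA
  · rw [map_sub, mem_mm.1 hg, sub_zero, EE_apply, map_sum]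
    refine Finset.sum_eq_zero fun p _ => ?_
    rw [map_mul, mem_mm.1 (dX_mem p), zero_mul]
  · intro a ha
    rw [map_sub, map_sub, EE_apply, map_sum, map_sum]
    have h1 : ∀ p, ev1 k n (DD a (dX p * DD (b p) g)) = a p.1 p.2 * ev1 k n (DD (b p) g) := by
      intro p
      rw [Derivation.leibniz, map_add, smul_eq_mul, smul_eq_mul, map_mul, map_mul,
        mem_mm.1 (dX_mem p), evDD_dX, zero_mul, zero_add, mul_comm]
    rw [Finset.sum_congr rfl fun p _ => h1 p]
    have h2 : DD (∑ p, a p.1 p.2 • b p) g = ∑ p, MvPolynomial.C (a p.1 p.2) * DD (b p) g := by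
      have : DD (∑ p, a p.1 p.2 • b p) = DDl k n (∑ p, a p.1 p.2 • b p) := rfl
      rw [this, map_sum]
      have e : ∀ D : Derivation k (QQ k n) (QQ k n), D g = Derivation.coeFnAddMonoidHom D g := fun _ => rfl
      rw [e, map_sum, Finset.sum_apply]
      refine Finset.sum_congr rfl fun p _ => ?_
      rw [map_smul, ← MvPolynomial.smul_eq_C_mul]
      rfl
    rw [← hb2 a ha] at h2
    rw [h2, map_sum, sub_eq_zero]
    refine Finset.sum_congr rfl fun p _ => ?_
    rw [map_mul, ev1_C]

theorem EE_pow (H : Subgroup (GL (Fin n) k)) (b : Fin n × Fin n → Matrix (Fin n) (Fin n) k)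
    (hb2 : ∀ a ∈ LieK H, a = ∑ p, a p.1 p.2 • b p) (j : ℕ) :
    ∀ g ∈ mm k n ^ j, EE b g - (j : QQ k n) * g ∈ mm k n ^ (j + 1) ⊔ II H := by
  induction j with
  | zero =>
    intro g _
    rw [Nat.cast_zero, zero_mul, sub_zero, EE_apply, zero_add, pow_one]
    exact Ideal.mem_sup_left (Ideal.sum_mem _ fun p _ => Ideal.mul_mem_right _ _ (dX_mem p))
  | succ j ih =>
    intro g hg
    rw [pow_succ] at hg
    induction hg using Submodule.mul_induction_on' with
    | mem_mul_mem x hx y hy =>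
      have e : EE b (x * y) - ((j + 1 : ℕ) : QQ k n) * (x * y) =
          x * (EE b y - y) + y * (EE b x - (j : QQ k n) * x) := by
        rw [Derivation.leibniz, smul_eq_mul, smul_eq_mul, Nat.cast_add, Nat.cast_one]; ring
      rw [e]
      refine Ideal.add_mem _ (mul_mem_pow_sup (II H) (r := j) (s := 2) hx (EE_base H b hb2 y hy)) ?_
      have := mul_mem_pow_sup (II H) (r := 1) (by rwa [pow_one]) (ih x hx) (x := y)
      rwa [add_comm 1] at this
    | add x _ y _ hx hy =>
      have e : EE b (x + y) - ((j + 1 : ℕ) : QQ k n) * (x + y) =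
          (EE b x - ((j + 1 : ℕ) : QQ k n) * x) + (EE b y - ((j + 1 : ℕ) : QQ k n) * y) := by
        rw [map_add]; ring
      rw [e]; exact Ideal.add_mem _ hx hy

theorem J_le_pow [CharZero k] (H N : Subgroup (GL (Fin n) k)) (hL : LieK H ≤ LieK N) (j : ℕ) :
    II N ≤ mm k n ^ j ⊔ II H := by
  obtain ⟨b, hb, hb2⟩ := exists_Euler H
  induction j with
  | zero => rw [pow_zero, Ideal.one_eq_top, top_sup_eq]; exact le_top
  | succ j ih =>
    rcases Nat.eq_zero_or_pos j with rfl | hj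
    · rw [zero_add, pow_one]; exact (II_le_mm N).trans le_sup_left
    intro f hf
    obtain ⟨u, hu, i, hi, rfl⟩ := Submodule.mem_sup.1 (ih hf)
    have h1 : EE b (u + i) ∈ mm k n ^ (j + 1) ⊔ II H := by
      rw [EE_apply]
      refine Ideal.sum_mem _ fun p _ => ?_
      have := mul_mem_pow_sup (II H) (r := 1) (by rw [pow_one]; exact dX_mem p)
        (ih (DD_mem_II (hL (hb p)) hf))
      rwa [add_comm 1] at this
    have h2 : EE b i ∈ mm k n ^ (j + 1) ⊔ II H := by
      rw [EE_apply]
      exact Ideal.mem_sup_right (Ideal.sum_mem _ fun p _ => Ideal.mul_mem_left _ _ (DD_mem_II (hb p) hi))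
    have h3 := EE_pow H b hb2 j u hu
    have h4 : (j : QQ k n) * u ∈ mm k n ^ (j + 1) ⊔ II H := by
      have e : (j : QQ k n) * u = EE b (u + i) - EE b i - (EE b u - (j : QQ k n) * u) := by
        rw [map_add]; ring
      rw [e]
      exact Ideal.sub_mem _ (Ideal.sub_mem _ h1 h2) h3
    have h5 : u = MvPolynomial.C ((j : k)⁻¹) * ((j : QQ k n) * u) := by
      rw [← map_natCast (MvPolynomial.C : k →+* QQ k n) j, ← mul_assoc, ← map_mul,
        inv_mul_cancel₀ (Nat.cast_ne_zero.2 hj.ne'), map_one, one_mul]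
    refine Ideal.add_mem _ ?_ (Ideal.mem_sup_right hi)
    rw [h5]; exact Ideal.mul_mem_left _ _ h4

theorem exists_one_sub (H N : Subgroup (GL (Fin n) k)) (h : ∀ j, II N ≤ mm k n ^ j ⊔ II H)
    (f : QQ k n) (hf : f ∈ II N) : ∃ e, ev1 k n e = 1 ∧ e * f ∈ II H := by
  have h1 : Ideal.Quotient.mk (II H) f ∈
      (⨅ i : ℕ, mm k n ^ i • (⊤ : Submodule (QQ k n) (QQ k n ⧸ II H))) := by
    rw [Submodule.mem_iInf]
    intro j
    obtain ⟨u, hu, i, hi, rfl⟩ := Submodule.mem_sup.1 (h j hf)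
    rw [map_add, Ideal.Quotient.eq_zero_iff_mem.2 hi, add_zero]
    have : Ideal.Quotient.mk (II H) u = u • (1 : QQ k n ⧸ II H) := by
      rw [← map_one (Ideal.Quotient.mk (II H))]
      exact congrArg (Ideal.Quotient.mk (II H)) (mul_one u).symm
    rw [this]
    exact Submodule.smul_mem_smul hu trivial
  obtain ⟨r, hr⟩ := (Ideal.mem_iInf_smul_pow_eq_bot_iff _ _).1 h1
  refine ⟨1 - r, by rw [map_sub, map_one, mem_mm.1 r.2, sub_zero], ?_⟩
  rw [← Ideal.Quotient.eq_zero_iff_mem, sub_mul, one_mul, map_sub, map_mul]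
  have h2 : (r : QQ k n) • Ideal.Quotient.mk (II H) f = Ideal.Quotient.mk (II H) r * Ideal.Quotient.mk (II H) f := rfl
  rw [← h2, hr, sub_self]

theorem exists_sep (H N : Subgroup (GL (Fin n) k)) (h : ∀ j, II N ≤ mm k n ^ j ⊔ II H) :
    ∃ e, ev1 k n e = 1 ∧ ∀ f ∈ II N, e * f ∈ II H := by
  classical
  obtain ⟨S, hS⟩ := (isNoetherianRing_iff_ideal_fg (QQ k n)).1 inferInstance (II N)
  have hSN : ∀ s ∈ S, s ∈ II N := fun s hs => hS ▸ Ideal.subset_span hs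
  have hex : ∀ s : QQ k n, ∃ e, ev1 k n e = 1 ∧ (s ∈ II N → e * s ∈ II H) := by
    intro s
    by_cases hs : s ∈ II N
    · obtain ⟨e, h1, h2⟩ := exists_one_sub H N h s hs
      exact ⟨e, h1, fun _ => h2⟩
    · exact ⟨1, map_one _, fun h => absurd h hs⟩
  choose e he1 he2 using hex
  refine ⟨∏ s ∈ S, e s, by rw [map_prod]; exact Finset.prod_eq_one fun s _ => he1 s, ?_⟩
  intro f hf
  rw [← hS] at hf
  refine Submodule.span_induction (p := fun f _ => (∏ s ∈ S, e s) * f ∈ II H) ?_ ?_ ?_ ?_ hf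
  · intro s hs
    rw [← Finset.mul_prod_erase S e hs, mul_right_comm]
    exact Ideal.mul_mem_right _ _ (he2 s (hSN s hs))
  · rw [mul_zero]; exact Ideal.zero_mem _
  · intro x y _ _ hx hy; rw [mul_add]; exact Ideal.add_mem _ hx hy
  · intro a x _ hx; rw [smul_eq_mul, mul_left_comm]; exact Ideal.mul_mem_left _ _ hx

theorem finite_cosets [CharZero k] (H N : Subgroup (GL (Fin n) k)) (hN : ClosedK N)
    (hL : LieK H ≤ LieK N) :
    Set.Finite ((fun g => (fun h => g * h) '' (N : Set (GL (Fin n) k))) '' (H : Set (GL (Fin n) k))) := by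
  classical
  obtain ⟨e, he1, he⟩ := exists_sep H N (J_le_pow H N hL)
  have key : ∀ h ∈ H, MvPolynomial.eval (pt h) e ≠ 0 → h ∈ N := by
    intro h hh hne
    apply hN
    intro f hf
    have := he f hf h hh
    rw [map_mul] at this
    exact (mul_eq_zero.1 this).resolve_left hne
  let S : Set (QQ k n) := (fun g => LL g⁻¹ e) '' (H : Set (GL (Fin n) k))
  have hfg : (Submodule.span (QQ k n) S).FG :=
    (isNoetherianRing_iff_ideal_fg (QQ k n)).1 inferInstance (Ideal.span S)
  obtain ⟨T, hTS, hT⟩ := (Submodule.fg_span_iff_fg_span_finset_subset S).1 hfg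
  have hch : ∀ t : QQ k n, ∃ g : GL (Fin n) k, t ∈ T → g ∈ H ∧ LL g⁻¹ e = t := by
    intro t
    by_cases ht : t ∈ T
    · obtain ⟨g, hg, hgt⟩ := hTS ht
      exact ⟨g, fun _ => ⟨hg, hgt⟩⟩
    · exact ⟨1, fun h => absurd h ht⟩
  choose γ hγ using hch
  refine Set.Finite.subset (T.finite_toSet.image
    fun t => (fun h => γ t * h) '' (N : Set (GL (Fin n) k))) ?_
  rintro _ ⟨h, hh, rfl⟩
  have hex : ∃ t ∈ T, MvPolynomial.eval (pt h) t ≠ 0 := by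
    by_contra hcon
    push Not at hcon
    have hsp : ∀ f ∈ Submodule.span (QQ k n) S, MvPolynomial.eval (pt h) f = 0 := by
      intro f hf
      rw [hT] at hf
      refine Submodule.span_induction (p := fun f _ => MvPolynomial.eval (pt h) f = 0)
        (fun t ht => hcon t ht) (map_zero _) ?_ ?_ hf
      · intro x y _ _ hx hy; rw [map_add, hx, hy, add_zero]
      · intro a x _ hx; rw [smul_eq_mul, map_mul, hx, mul_zero]
    have := hsp _ (Submodule.subset_span ⟨h, hh, rfl⟩)
    rw [eval_LL, inv_mul_cancel] at this
    exact one_ne_zero (he1.symm.trans this)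
  obtain ⟨t, ht, hne⟩ := hex
  refine ⟨t, ht, ?_⟩
  obtain ⟨hgH, hgt⟩ := hγ t ht
  rw [← hgt, eval_LL] at hne
  have hmem := key _ (H.mul_mem (H.inv_mem hgH) hh) hne
  ext z
  constructor
  · rintro ⟨w, hw, rfl⟩
    exact ⟨((γ t)⁻¹ * h)⁻¹ * w, N.mul_mem (N.inv_mem hmem) hw, by simp only []; group⟩
  · rintro ⟨w, hw, rfl⟩
    exact ⟨((γ t)⁻¹ * h) * w, N.mul_mem hmem hw, by simp only []; group⟩

end cosetsB

noncomputable section cosetsC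
variable {n : ℕ}

theorem eval_aeval_poly {σ : Type} (q : σ → Polynomial k) (f : MvPolynomial σ k) (t : k) :
    (MvPolynomial.aeval q f : Polynomial k).eval t = MvPolynomial.eval (fun i => (q i).eval t) f := by
  induction f using MvPolynomial.induction_on with
  | C c => simp [MvPolynomial.algebraMap_eq]
  | add p q hp hq => rw [map_add, map_add, Polynomial.eval_add, hp, hq]
  | mul_X p v hp => rw [map_mul, map_mul, Polynomial.eval_mul, hp]; simp

theorem limit_fixed [Infinite k] {G : AlgGroup k} {m : ℕ} (X : GVariety G m) (x y : Fin m → k)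
    (hx : x ∈ X.carrier) (lam : OnePS G) (h : XLimit X lam x y) (s : kˣ) :
    X.act (lam.toFun s) y = y := by
  obtain ⟨hy, q, hq, hq0⟩ := h
  obtain ⟨p, hp⟩ := X.regular
  funext i
  let w : (Fin G.n × Fin G.n) ⊕ (Unit ⊕ Fin m) → Polynomial k :=
    Sum.elim (fun a => Polynomial.C (mat2pt (lam.toFun s : Matrix (Fin G.n) (Fin G.n) k) a))
      (Sum.elim (fun _ => Polynomial.C (((lam.toFun s)⁻¹ : GL (Fin G.n) k) : Matrix (Fin G.n) (Fin G.n) k).det) q)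
  have hw : ∀ t : k, (fun a => (w a).eval t) =
      Sum.elim (mat2pt (lam.toFun s : Matrix (Fin G.n) (Fin G.n) k))
        (Sum.elim (fun _ => (((lam.toFun s)⁻¹ : GL (Fin G.n) k) : Matrix (Fin G.n) (Fin G.n) k).det)
          (fun j => (q j).eval t)) := by
    intro t
    funext a
    rcases a with a | u | j <;> simp [w, -Matrix.coe_units_inv]
  have hz : (MvPolynomial.aeval w (p i) : Polynomial k) - (q i).comp (Polynomial.C (s : k) * Polynomial.X) = 0 := by
    apply poly_zero_of_units
    intro t
    have e : (fun j => (q j).eval (t : k)) = X.act (lam.toFun t) x := funext fun j => (hq t j).symm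
    rw [Polynomial.eval_sub, eval_aeval_poly, hw, e,
      ← hp _ (lam.mem s) _ (X.act_mem _ (lam.mem t) x hx), ← X.act_mul _ (lam.mem s) _ (lam.mem t) x hx,
      ← map_mul, hq, Polynomial.eval_comp]
    simp
  have h0 := congrArg (Polynomial.eval 0) hz
  have e : (fun j => (q j).eval (0 : k)) = y := funext fun j => (hq0 j).symm
  rw [Polynomial.eval_sub, eval_aeval_poly, hw, e, ← hp _ (lam.mem s) _ hy, Polynomial.eval_comp] at h0
  simp only [Polynomial.eval_mul, Polynomial.eval_X, mul_zero, Polynomial.eval_zero] at h0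
  rw [hq0 i]
  exact sub_eq_zero.1 h0

theorem divisible_mem [IsAlgClosed k] [CharZero k] {n : ℕ} (mu : kˣ →* GL (Fin n) k)
    (H N : Subgroup (GL (Fin n) k)) (hmu : ∀ t, mu t ∈ H)
    (hfin : Set.Finite ((fun g => (fun h => g * h) '' (N : Set (GL (Fin n) k))) '' (H : Set (GL (Fin n) k))))
    (t : kˣ) : mu t ∈ N := by
  let A : Subgroup kˣ := N.comap mu
  have hF : Finite (kˣ ⧸ A) := by
    have := hfin.to_subtype
    refine Finite.of_injective (β := ((fun g => (fun h => g * h) '' (N : Set (GL (Fin n) k))) ''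
      (H : Set (GL (Fin n) k)) : Set (Set (GL (Fin n) k))))
      (fun c => ⟨_, ⟨mu c.out, hmu _, rfl⟩⟩) ?_
    intro c d hcd
    have h1 := congrArg Subtype.val hcd
    simp only [] at h1
    have h2 : mu d.out ∈ (fun h => mu c.out * h) '' (N : Set (GL (Fin n) k)) := by
      rw [h1]; exact ⟨1, N.one_mem, mul_one _⟩
    obtain ⟨w, hw, hwe⟩ := h2
    rw [← Quotient.out_eq c, ← Quotient.out_eq d]
    refine QuotientGroup.eq.2 ?_
    show mu ((c.out)⁻¹ * d.out) ∈ N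
    rw [map_mul, map_inv, ← hwe]
    simpa using hw
  have hi : A.index ≠ 0 := (Subgroup.finiteIndex_of_finite_quotient (H := A)).index_ne_zero
  obtain ⟨z, hz⟩ := IsAlgClosed.exists_pow_nat_eq (t : k) (Nat.pos_of_ne_zero hi)
  have hz0 : z ≠ 0 := by
    rintro rfl
    rw [zero_pow hi] at hz
    exact t.ne_zero hz.symm
  have : t = Units.mk0 z hz0 ^ A.index := by
    ext; rw [Units.val_pow_eq_pow_val, Units.val_mk0, hz]
  rw [this]
  exact Subgroup.pow_index_mem A _

theorem stable_imp [IsAlgClosed k] [CharZero k] {G : AlgGroup k} {m : ℕ} (X : GVariety G m) (x : Fin m → k)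
    (hx : x ∈ X.carrier) (h : Stable X x) : OnePSStable X x := by
  refine ⟨h.1, fun lam hlam hin => hlam ?_⟩
  obtain ⟨y, hy⟩ := hin
  have hfix := limit_fixed X x y hx lam hy
  have hyo : y ∈ orbitSet X x := by
    obtain ⟨_, q, hq, hq0⟩ := hy
    have := closed_limit _ h.1 q (fun t => ⟨lam.toFun t, lam.mem t, funext fun i => (hq t i).symm⟩)
    rwa [← funext hq0] at this
  obtain ⟨g, hg, rfl⟩ := hyo
  have hgi := G.toSubgroup.inv_mem hg
  let mu : kˣ →* GL (Fin G.n) k := (MulAut.conj g⁻¹).toMonoidHom.comp lam.toFun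
  have hmua : ∀ t, mu t = g⁻¹ * lam.toFun t * g := by intro t; simp [mu, MulAut.conj_apply]
  have hmu : ∀ t, mu t ∈ stabG X x hx := by
    intro t
    rw [hmua]
    refine ⟨G.toSubgroup.mul_mem (G.toSubgroup.mul_mem hgi (lam.mem t)) hg, ?_⟩
    rw [X.act_mul _ (G.toSubgroup.mul_mem hgi (lam.mem t)) _ hg x hx,
      X.act_mul _ hgi _ (lam.mem t) _ (X.act_mem _ hg x hx), hfix t, ← X.act_mul _ hgi _ hg x hx,
      inv_mul_cancel, X.act_one x hx]
  intro t
  have h1 := divisible_mem mu (stabG X x hx) (cenG X) hmu h.2 t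
  have h2 := cenG_conj X hg h1
  rw [hmua] at h2
  have e : g * (g⁻¹ * lam.toFun t * g) * g⁻¹ = lam.toFun t := by group
  rw [e] at h2
  exact h2

end cosetsC


/-- Theorem 3.15 of the paper. A point `x` of an affine
`G`-variety `X` is stable if and only if it is 1PS stable. -/
theorem stable_iff_onePSStable
    {k : Type} [Field k] [IsAlgClosed k] [CharZero k]
    (G : AlgGroup k) (hG : IsReductive G)
    {m : ℕ} (X : GVariety G m) (x : Fin m → k) (hx : x ∈ X.carrier) :
    Stable X x ↔ OnePSStable X x :=
  ⟨stable_imp X x hx, fun h => ⟨h.1,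
    finite_cosets (stabG X x hx) (cenG X) (closed_cen X) (LieK_stab_le G hG X x hx h)⟩⟩

end PaperGIT
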